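/- Let p be an odd prime, t ≥ 1 an integer, q = p^t, and m ≥ 2. Let D be the m × m matrix over ℚ with rows and columns indexed by {1,…,m} whose (a,b)-entry is d_{(a,b)}. Then rank_p(A^m_{1,m}(p^t)) = 1 + trace(D^t) (an equality of rational numbers). -/

import Mathlib

open scoped Classical

noncomputable section

/-- The `2m`-dimensional standard symplectic space over `F_q = GaloisField p t`:
pairs `(x, y)` of `m`-tuples. -/
abbrev SympV (p t m : ℕ) [Fact p.Prime] : Type :=
  (Fin m → GaloisField p t) × (Fin m → GaloisField p t)

/-- The nonsingular alternating bilinear form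
`⟨(x,y),(x',y')⟩ = Σ_i (x_i y'_i − y_i x'_i)`. -/
def sform {p t m : ℕ} [Fact p.Prime] (v w : SympV p t m) : GaloisField p t :=
  ∑ i, (v.1 i * w.2 i - v.2 i * w.1 i)

/-- A subspace is totally isotropic if the form vanishes identically on it. -/
def IsTotIso {p t m : ℕ} [Fact p.Prime]
    (W : Submodule (GaloisField p t) (SympV p t m)) : Prop :=
  ∀ u ∈ W, ∀ w ∈ W, sform u w = 0

instance {p t m : ℕ} [Fact p.Prime] :
    Finite (Submodule (GaloisField p t) (SympV p t m)) :=
  Finite.of_injective (fun W => (W : Set (SympV p t m))) SetLike.coe_injective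

/-- Row index type: totally isotropic `r`-dimensional subspaces. -/
abbrev IsoFlats (p t m r : ℕ) [Fact p.Prime] : Type :=
  {W : Submodule (GaloisField p t) (SympV p t m) //
    IsTotIso W ∧ Module.finrank (GaloisField p t) W = r}

/-- Column index type: `1`-dimensional subspaces (points). -/
abbrev Pts (p t m : ℕ) [Fact p.Prime] : Type :=
  {Z : Submodule (GaloisField p t) (SympV p t m) //
    Module.finrank (GaloisField p t) Z = 1}

noncomputable instance (p t m r : ℕ) [Fact p.Prime] : Fintype (IsoFlats p t m r) :=
  Fintype.ofFinite _

noncomputable instance (p t m : ℕ) [Fact p.Prime] : Fintype (Pts p t m) :=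
  Fintype.ofFinite _

/-- The incidence matrix `A^m_{1,r}(p^t)` over `F_p` between totally isotropic
`r`-dimensional subspaces and points: entry `1` if the point lies in the flat. -/
def incMat (p t m r : ℕ) [Fact p.Prime] :
    Matrix (IsoFlats p t m r) (Pts p t m) (ZMod p) :=
  fun W Z => if Z.val ≤ W.val then 1 else 0


/-- `d_λ`: the number of tuples `c ∈ {0,…,p−1}^{2m}` with `Σ_i c_i = λ`
(`λ` an integer, the count being `0` for negative `λ`). -/
def dlam (p m : ℕ) (lam : ℤ) : ℕ :=
  (Finset.univ.filter (fun c : Fin (2 * m) → Fin p => (∑ i, (c i : ℤ)) = lam)).card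

/-- `d_{(a,b)}` for `1 ≤ a,b ≤ m`: equal to `(d_{m(p−1)} + p^m)/2` if `a = b = m`,
and to `d_{pb−a}` otherwise. -/
def dpair (p m a b : ℕ) : ℚ :=
  if a = m ∧ b = m then ((dlam p m (m * (p - 1)) : ℚ) + (p : ℚ) ^ m) / 2
  else (dlam p m ((p : ℤ) * b - a) : ℚ)

/-- The `m × m` matrix `D` over `ℚ` with `(a,b)`-entry `d_{(a,b)}`,
rows and columns indexed by `{1,…,m}` (encoded as `Fin m` via `+1`). -/
def Dmat (p m : ℕ) : Matrix (Fin m) (Fin m) ℚ :=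
  fun a b => dpair p m ((a : ℕ) + 1) ((b : ℕ) + 1)

namespace PR
set_option linter.all false

abbrev Ix (m : ℕ) := Fin m ⊕ Fin m
abbrev Ex (t m : ℕ) := Fin t × Ix m → ℕ

section basic
variable {K : Type} [Field K] [Fintype K] {p t m : ℕ} [Fact p.Prime] [CharP K p]
  [NeZero t] [Fact (Fintype.card K = p ^ t)]

/-- monomial function -/
def mono (K : Type) [Field K] (p : ℕ) {t m : ℕ} (N : Ex t m) : (Ix m → K) → K :=
  fun v => ∏ z, (v z.2) ^ (p ^ (z.1 : ℕ) * N z)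

/-- unit exponent -/
def dl {t m : ℕ} (z : Fin t × Ix m) : Ex t m := Pi.single z 1

def size {t m : ℕ} (N : Ex t m) : ℕ := ∑ z, N z

def Rd (p : ℕ) {t m : ℕ} (N : Ex t m) : Prop := ∀ z, N z < p

theorem mono_add (N N' : Ex t m) : mono K p (N + N') = mono K p N * mono K p N' := by
  funext v
  simp only [mono, Pi.mul_apply, Pi.add_apply, mul_add, pow_add, Finset.prod_mul_distrib]

theorem mono_zero : mono K p (0 : Ex t m) = 1 := by
  funext v
  simp [mono]

theorem mono_smul (n : ℕ) (N : Ex t m) : mono K p (n • N) = mono K p N ^ n := by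
  induction n with
  | zero => simp [mono_zero]
  | succ n ih => rw [succ_nsmul, mono_add, ih, pow_succ]

theorem mono_dl (z : Fin t × Ix m) : mono K p (dl z) = fun v => (v z.2) ^ (p ^ (z.1 : ℕ)) := by
  funext v
  simp only [mono, dl]
  rw [Finset.prod_eq_single z]
  · simp
  · intro b _ hb
    simp [Pi.single_eq_of_ne hb]
  · simp

theorem size_add (N N' : Ex t m) : size (N + N') = size N + size N' := by
  simp [size, Finset.sum_add_distrib]

theorem size_dl (z : Fin t × Ix m) : size (dl z) = 1 := by
  simp [size, dl]

theorem size_smul (n : ℕ) (N : Ex t m) : size (n • N) = n * size N := by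
  simp [size, Finset.mul_sum]

theorem frob_succ (j : Fin t) (x : K) :
    (x ^ (p ^ (j : ℕ))) ^ p = x ^ (p ^ ((j + 1 : Fin t) : ℕ)) := by
  have hc : Fintype.card K = p ^ t := Fact.out
  rw [← pow_mul, ← pow_succ]
  have ht : 0 < t := Nat.pos_of_ne_zero (NeZero.ne t)
  by_cases h : (j : ℕ) + 1 = t
  · have h2 : ((j + 1 : Fin t) : ℕ) = 0 := by
      rw [Fin.val_add, Fin.val_one']
      simp [h]
    rw [h2, h, ← hc, FiniteField.pow_card]
    simp
  · have h2 : ((j + 1 : Fin t) : ℕ) = j + 1 := by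
      rw [Fin.val_add, Fin.val_one']
      rw [Nat.add_mod_mod, Nat.mod_eq_of_lt]
      have := j.2
      omega
    rw [h2]

theorem mono_carry1 (j : Fin t) (i : Ix m) :
    mono K p (p • dl (j, i)) = mono K p (dl (j + 1, i)) := by
  rw [mono_smul, mono_dl, mono_dl]
  funext v
  exact frob_succ j (v i)

theorem mono_carry (N : Ex t m) (j : Fin t) (i : Ix m) :
    mono K p (N + p • dl (j, i)) = mono K p (N + dl (j + 1, i)) := by
  rw [mono_add, mono_add, mono_carry1]

theorem exists_sub (N : Ex t m) (z : Fin t × Ix m) (n : ℕ) (h : n ≤ N z) :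
    ∃ N0 : Ex t m, N = N0 + n • dl z := by
  refine ⟨N - n • dl z, ?_⟩
  funext z'
  by_cases hz : z' = z
  · subst hz
    simp [dl, h]
  · simp [dl, Pi.single_eq_of_ne hz]

theorem exists_red (N : Ex t m) :
    ∃ a : Ex t m, Rd p a ∧ size a ≤ size N ∧ mono K p a = mono K p N := by
  have hp : 2 ≤ p := (Fact.out : p.Prime).two_le
  induction h : size N using Nat.strong_induction_on generalizing N with
  | _ n ih =>
    by_cases hr : Rd p N
    · exact ⟨N, hr, h.le, rfl⟩
    · unfold Rd at hr
      push Not at hr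
      obtain ⟨⟨j, i⟩, hz⟩ := hr
      obtain ⟨N0, rfl⟩ := exists_sub N (j, i) p hz
      have h1 : size (N0 + dl (j + 1, i)) = size N0 + 1 := by rw [size_add, size_dl]
      have h2 : size (N0 + p • dl (j, i)) = size N0 + p := by
        rw [size_add, size_smul, size_dl, mul_one]
      obtain ⟨a, ha, hs, hm⟩ := ih _ (by omega) (N0 + dl (j + 1, i)) rfl
      exact ⟨a, ha, by omega, by rw [hm, mono_carry]⟩

/-- Reduced index -/
abbrev RI (p t m : ℕ) := Fin t × Ix m → Fin p

def toE {p t m : ℕ} (a : RI p t m) : Ex t m := fun z => (a z : ℕ)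

theorem toE_rd (a : RI p t m) : Rd p (toE a) := fun z => (a z).2

def ofE {p t m : ℕ} (a : Ex t m) (h : Rd p a) : RI p t m := fun z => ⟨a z, h z⟩

theorem toE_ofE (a : Ex t m) (h : Rd p a) : toE (ofE a h) = a := rfl

theorem toE_inj {a b : RI p t m} (h : toE a = toE b) : a = b := by
  funext z
  exact Fin.ext (congrFun h z)

theorem mono_span : ⊤ ≤ Submodule.span K (Set.range (fun a : RI p t m => mono K p (toE a))) := by
  intro f _
  have h1 := MvPolynomial.map_restrict_dom_evalₗ K (Ix m)
  have hf : f ∈ Submodule.map (MvPolynomial.evalₗ K (Ix m))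
    (MvPolynomial.restrictDegree (Ix m) K (Fintype.card K - 1)) := by rw [h1]; trivial
  obtain ⟨P, -, rfl⟩ := hf
  rw [MvPolynomial.as_sum P, map_sum]
  refine Submodule.sum_mem _ fun e _ => ?_
  set N : Ex t m := fun z => if z.1 = 0 then e z.2 else 0 with hN
  have : MvPolynomial.evalₗ K (Ix m) (MvPolynomial.monomial e (MvPolynomial.coeff e P)) =
      MvPolynomial.coeff e P • mono K p N := by
    funext v
    simp only [MvPolynomial.evalₗ_apply, MvPolynomial.eval_monomial, Pi.smul_apply, smul_eq_mul,
      mono, hN]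
    congr 1
    rw [Fintype.prod_prod_type, Finset.prod_eq_single 0]
    · simp [Finsupp.prod_fintype]
    · intro b _ hb
      simp [hb]
    · simp
  rw [this]
  obtain ⟨a, ha, -, hm⟩ := exists_red (K := K) (p := p) N
  rw [← hm]
  exact Submodule.smul_mem _ _ (Submodule.subset_span ⟨ofE a ha, rfl⟩)

theorem mono_li : LinearIndependent K (fun a : RI p t m => mono K p (toE a)) := by
  refine linearIndependent_of_top_le_span_of_card_eq_finrank mono_span ?_
  have hc : Fintype.card K = p ^ t := Fact.out
  simp only [Module.finrank_fintype_fun_eq_card, Fintype.card_fun, Fintype.card_fin,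
    Fintype.card_prod, hc, pow_mul]

def mb (K : Type) [Field K] [Fintype K] (p t m : ℕ) [Fact p.Prime] [CharP K p]
  [NeZero t] [Fact (Fintype.card K = p ^ t)] : Module.Basis (RI p t m) K ((Ix m → K) → K) :=
  Module.Basis.mk mono_li mono_span

theorem mb_apply (a : RI p t m) : mb K p t m a = mono K p (toE a) := by
  simp [mb]

/-- filtration by size -/
def Fil (K : Type) [Field K] (p t m : ℕ) (d z : ℕ) : Submodule K ((Ix m → K) → K) :=
  Submodule.span K {f | ∃ N : Ex t m, size N + z ≤ d ∧ f = mono K p N}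

theorem mono_mem_Fil (N : Ex t m) {d z : ℕ} (h : size N + z ≤ d) : mono K p N ∈ Fil K p t m d z :=
  Submodule.subset_span ⟨N, h, rfl⟩

theorem Fil_mono {d z d' z' : ℕ} (h : d + z' ≤ d' + z) : Fil K p t m d z ≤ Fil K p t m d' z' := by
  refine Submodule.span_mono ?_
  rintro f ⟨N, hN, rfl⟩
  exact ⟨N, by omega, rfl⟩

/-- projection onto reduced monomials satisfying Q -/
def proj (K : Type) [Field K] [Fintype K] {p t m : ℕ} [Fact p.Prime] [CharP K p]
  [NeZero t] [Fact (Fintype.card K = p ^ t)] (Q : Ex t m → Prop) :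
  ((Ix m → K) → K) →ₗ[K] ((Ix m → K) → K) :=
  (mb K p t m).constr K (fun a => if Q (toE a) then mono K p (toE a) else 0)

theorem proj_mono (Q : Ex t m → Prop) (a : Ex t m) (h : Rd p a) :
    proj K (p := p) Q (mono K p a) = if Q a then mono K p a else 0 := by
  have := (mb K p t m).constr_basis K
    (fun a => if Q (toE a) then mono K p (toE a) else 0) (ofE a h)
  rw [mb_apply, toE_ofE] at this
  exact this

theorem proj_Fil (d z : ℕ) (f : (Ix m → K) → K) (hf : f ∈ Fil K p t m d z) :
    proj K (p := p) (t := t) (fun a => size a + z ≤ d) f = f := by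
  induction hf using Submodule.span_induction with
  | mem x h =>
    obtain ⟨N, hN, rfl⟩ := h
    obtain ⟨a, ha, hs, hm⟩ := exists_red (K := K) (p := p) N
    rw [← hm, proj_mono _ _ ha, if_pos (by omega)]
  | zero => simp
  | add x y _ _ hx hy => rw [map_add, hx, hy]
  | smul c x _ hx => rw [map_smul, hx]

/-- type of a exponent -/
def HT (p : ℕ) {t m : ℕ} [NeZero t] (N : Ex t m) (s : Fin t → ℕ) : Prop :=
  ∀ j, (∑ i, N (j, i)) + s j = p * s (j + 1)

theorem fin_sum_shift {M : Type} [AddCommMonoid M] (g : Fin t → M) : ∑ j, g (j + 1) = ∑ j, g j :=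
  Equiv.sum_comp (Equiv.addRight (1 : Fin t)) g

theorem HT_size (N : Ex t m) (s : Fin t → ℕ) (h : HT p N s) :
    size N + ∑ j, s j = p * ∑ j, s j := by
  have h1 : ∑ j, ((∑ i, N (j, i)) + s j) = ∑ j, p * s (j + 1) :=
    Finset.sum_congr rfl fun j _ => h j
  rw [Finset.sum_add_distrib, ← Finset.mul_sum, fin_sum_shift] at h1
  rw [← h1, size, Fintype.sum_prod_type]

theorem HT_add (N N' : Ex t m) (s s' : Fin t → ℕ) (h : HT p N s) (h' : HT p N' s') :
    HT p (N + N') (s + s') := by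
  intro j
  have h1 := h j
  have h2 := h' j
  simp only [Pi.add_apply, Finset.sum_add_distrib, mul_add]
  omega

/-- uniqueness of the type -/
theorem HT_unique (N : Ex t m) (s s' : Fin t → ℕ) (h : HT p N s) (h' : HT p N s') : s = s' := by
  have hp : 2 ≤ p := (Fact.out : p.Prime).two_le
  have h1 : ∀ j, (p : ℤ) * (s (j + 1) - s' (j + 1)) = s j - s' j := by
    intro j
    have a := h j
    have b := h' j
    zify at a b
    linarith
  have h2 : ∀ j, p * Int.natAbs (s (j + 1) - s' (j + 1)) = Int.natAbs ((s j : ℤ) - s' j) := by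
    intro j
    rw [← h1 j, Int.natAbs_mul]
    simp
  have h3 : p * ∑ j, Int.natAbs ((s j : ℤ) - s' j) = ∑ j, Int.natAbs ((s j : ℤ) - s' j) := by
    have h5 := Finset.sum_congr rfl (fun j (_ : j ∈ Finset.univ) => h2 j)
    rw [← Finset.mul_sum, fin_sum_shift (fun j => Int.natAbs ((s j : ℤ) - s' j))] at h5
    exact h5
  have h4 : ∑ j, Int.natAbs ((s j : ℤ) - s' j) = 0 := by nlinarith
  rw [Finset.sum_eq_zero_iff] at h4
  funext j
  have := h4 j (Finset.mem_univ _)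
  omega

theorem sum_dl (z : Fin t × Ix m) (j : Fin t) :
    ∑ i, dl z (j, i) = if j = z.1 then 1 else 0 := by
  obtain ⟨j', i'⟩ := z
  split_ifs with h
  · subst h
    rw [Finset.sum_eq_single i']
    · simp [dl]
    · intro b _ hb
      simp [dl, hb]
    · simp
  · apply Finset.sum_eq_zero
    intro i _
    simp only [dl]
    rw [Pi.single_eq_of_ne]
    intro hh
    exact h (by simpa using congrArg Prod.fst hh)

open scoped Fin.NatCast Fin.CommRing in
theorem HT_pos (s : Fin t → ℕ) (N : Ex t m) (h : HT p N s) (j : Fin t)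
  (hj : s j = 0) : s = 0 := by
  have key : ∀ n : ℕ, s (j - (n : Fin t)) = 0 := by
    intro n
    induction n with
    | zero => simpa using hj
    | succ n ih =>
      have := h (j - ((n + 1 : ℕ) : Fin t))
      have e : j - ((n + 1 : ℕ) : Fin t) + 1 = j - (n : Fin t) := by
        push_cast; ring
      rw [e, ih] at this
      omega
  funext i
  have := key ((j - i : Fin t) : ℕ)
  simpa using this

theorem HT_carry (s : Fin t → ℕ) (N : Ex t m) (j : Fin t) (i : Ix m)
    (h : HT p (N + p • dl (j, i)) s) :
    1 ≤ s (j + 1) ∧ HT p (N + dl (j + 1, i)) (s - Pi.single (j + 1) 1) := by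
  have hp : 2 ≤ p := (Fact.out : p.Prime).two_le
  have h1 : 1 ≤ s (j + 1) := by
    have := h j
    simp only [Pi.add_apply, Pi.smul_apply, Finset.sum_add_distrib, smul_eq_mul,
      ← Finset.mul_sum, sum_dl, if_true] at this
    by_contra hc
    have h0 : s (j + 1) = 0 := by omega
    rw [h0, mul_zero] at this
    omega
  refine ⟨h1, ?_⟩
  intro l
  have := h l
  simp only [Pi.add_apply, Pi.smul_apply, Finset.sum_add_distrib, smul_eq_mul,
      ← Finset.mul_sum, sum_dl, Pi.sub_apply] at this ⊢
  by_cases h2 : l = j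
  · subst h2
    by_cases h3 : l = l + 1
    · have e : l + 1 = l := h3.symm
      simp only [e, if_true, Pi.single_eq_same] at h1 this ⊢
      have h5 : p * 1 ≤ p * s l := Nat.mul_le_mul_left p h1
      rw [Nat.mul_sub]
      omega
    · simp only [if_true, Pi.single_eq_same, if_neg h3, Pi.single_eq_of_ne h3] at *
      rw [Nat.mul_sub]
      omega
  · have h4 : l + 1 ≠ j + 1 := by simpa using h2
    rw [if_neg h2] at this
    rw [Pi.single_eq_of_ne h4]
    by_cases h3 : l = j + 1
    · subst h3
      simp only [if_true, Pi.single_eq_same] at *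
      simp only [Nat.sub_zero]
      omega
    · simp only [if_neg h3, Pi.single_eq_of_ne h3]
      simpa using this

end basic
end PR

namespace PR
set_option linter.all false

section flips
variable {K : Type} [Field K] [Fintype K] {p t m : ℕ} [Fact p.Prime] [CharP K p]
  [NeZero t] [Fact (Fintype.card K = p ^ t)]

def flip (p : ℕ) {t m : ℕ} (T : Finset (Fin t)) (a : Ex t m) : Ex t m :=
  fun z => if z.1 ∈ T then p - 1 - a (z.1, z.2.swap) else a z

theorem flip_rd (T : Finset (Fin t)) (a : Ex t m) (h : Rd p a) : Rd p (flip p T a) := by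
  have hp : 2 ≤ p := (Fact.out : p.Prime).two_le
  intro z
  unfold flip
  split_ifs
  · omega
  · exact h z

theorem flip_empty (a : Ex t m) : flip p ∅ a = a := by
  funext z
  simp [flip]

theorem flip_flip (T T' : Finset (Fin t)) (a : Ex t m) (h : Rd p a) :
    flip p T (flip p T' a) = flip p (symmDiff T T') a := by
  funext z
  have h1 := h z
  simp only [flip, Finset.mem_symmDiff]
  by_cases hT : z.1 ∈ T <;> by_cases hT' : z.1 ∈ T' <;> simp [hT, hT'] <;> omega

def Jset {t : ℕ} [NeZero t] (m : ℕ) (s : Fin t → ℕ) : Finset (Fin t) :=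
  Finset.univ.filter (fun j => s j = m ∧ s (j + 1) = m)

theorem mem_Jset (s : Fin t → ℕ) (j : Fin t) : j ∈ Jset m s ↔ s j = m ∧ s (j + 1) = m := by
  simp [Jset]

theorem sum_swap {M : Type} [AddCommMonoid M] (g : Ix m → M) : ∑ i : Ix m, g (Sum.swap i) = ∑ i, g i :=
  Equiv.sum_comp (Equiv.sumComm (Fin m) (Fin m)) g

theorem flip_sum (T : Finset (Fin t)) (a : Ex t m) (h : Rd p a)
    (hT : ∀ j ∈ T, ∑ i, a (j, i) = m * (p - 1)) (j : Fin t) :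
    ∑ i, flip p T a (j, i) = ∑ i, a (j, i) := by
  by_cases hj : j ∈ T
  · have h1 : ∑ i, flip p T a (j, i) + ∑ i, a (j, i) = 2 * m * (p - 1) := by
      rw [← sum_swap (fun i => a (j, i)), ← Finset.sum_add_distrib]
      rw [Finset.sum_congr rfl (g := fun _ => p - 1)]
      · simp only [Finset.sum_const, Finset.card_univ, Fintype.card_sum, Fintype.card_fin, smul_eq_mul]; ring
      · intro i _
        have := h (j, i.swap)
        simp only [flip, hj, if_true]
        omega
    have := hT j hj
    rw [this] at h1 ⊢
    nlinarith
  · simp [flip, hj]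

theorem J_deg (s : Fin t → ℕ) (a : Ex t m) (h : HT p a s) (j : Fin t) (hj : j ∈ Jset m s) :
    ∑ i, a (j, i) = m * (p - 1) := by
  have h1 := h j
  rw [mem_Jset] at hj
  rw [hj.1, hj.2] at h1
  rw [Nat.mul_sub, mul_comm m p]
  omega

theorem flip_HT (s : Fin t → ℕ) (T : Finset (Fin t)) (hT : T ⊆ Jset m s) (a : Ex t m)
    (h : Rd p a) (ha : HT p a s) : HT p (flip p T a) s := by
  intro j
  rw [flip_sum T a h (fun j hj => J_deg s a ha j (hT hj))]
  exact ha j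

theorem flip_size (s : Fin t → ℕ) (T : Finset (Fin t)) (hT : T ⊆ Jset m s) (a : Ex t m)
    (h : Rd p a) (ha : HT p a s) : size (flip p T a) = size a := by
  simp only [size]
  rw [Fintype.sum_prod_type, Fintype.sum_prod_type]
  exact Finset.sum_congr rfl
    fun j _ => flip_sum T a h (fun j hj => J_deg s a ha j (hT hj)) j

def fct (K : Type) [Field K] {t m : ℕ} (a : Ex t m) : K :=
  ∏ j : Fin t, ∏ k : Fin m, ((Nat.factorial (a (j, Sum.inr k)) : ℕ) : K)

theorem fact_ne (n : ℕ) (h : n < p) : ((Nat.factorial n : ℕ) : K) ≠ 0 := by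
  rw [Ne, CharP.cast_eq_zero_iff K p, (Fact.out : p.Prime).dvd_factorial]
  omega

theorem nat_ne (n : ℕ) (h : n < p) (h0 : 0 < n) : (n : K) ≠ 0 := by
  rw [Ne, CharP.cast_eq_zero_iff K p]
  exact Nat.not_dvd_of_pos_of_lt h0 h

theorem fct_ne (a : Ex t m) (h : Rd p a) : fct K a ≠ 0 := by
  refine Finset.prod_ne_zero_iff.2 fun j _ => Finset.prod_ne_zero_iff.2 fun k _ => ?_
  exact fact_ne (p := p) _ (h _)

def wf (K : Type) [Field K] (p : ℕ) {t m : ℕ} (a : Ex t m) : (Ix m → K) → K :=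
  (fct K a)⁻¹ • mono K p a

def YJ (K : Type) [Field K] (p : ℕ) {t m : ℕ} (J : Finset (Fin t)) (a : Ex t m) :
    (Ix m → K) → K := ∑ T ∈ J.powerset, wf K p (flip p T a)

theorem YJ_flip (J T : Finset (Fin t)) (hT : T ⊆ J) (a : Ex t m) (h : Rd p a) :
    YJ K p J (flip p T a) = YJ K p J a := by
  unfold YJ
  refine Finset.sum_bij' (fun T' _ => symmDiff T' T) (fun T' _ => symmDiff T' T) ?_ ?_ ?_ ?_ ?_
  · intro T' h'
    rw [Finset.mem_powerset] at *
    intro x hx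
    rw [Finset.mem_symmDiff] at hx
    rcases hx with hx | hx
    · exact h' hx.1
    · exact hT hx.1
  · intro T' h'
    rw [Finset.mem_powerset] at *
    intro x hx
    rw [Finset.mem_symmDiff] at hx
    rcases hx with hx | hx
    · exact h' hx.1
    · exact hT hx.1
  · intro T' _
    simp
  · intro T' _
    simp
  · intro T' _
    rw [flip_flip _ _ _ h]

def Sm {t : ℕ} (m : ℕ) (s : Fin t → ℕ) : Prop := (∀ j, 1 ≤ s j ∧ s j ≤ m) ∨ s = 0

def gens (K : Type) [Field K] (p t m : ℕ) [NeZero t] (Q : Ex t m → Prop) :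
    Set ((Ix m → K) → K) :=
  {f | ∃ (s : Fin t → ℕ) (a : Ex t m), Sm m s ∧ Rd p a ∧ HT p a s ∧ Q a ∧
    f = YJ K p (Jset m s) a}

def MM (K : Type) [Field K] (p t m : ℕ) [NeZero t] : Submodule K ((Ix m → K) → K) :=
  Submodule.span K (gens K p t m (fun _ => True))

theorem proj_YJ (s : Fin t → ℕ) (a : Ex t m) (ha : Rd p a) (hs : HT p a s) (d z : ℕ) :
    proj K (p := p) (t := t) (fun a => size a + z ≤ d) (YJ K p (Jset m s) a) =
      if size a + z ≤ d then YJ K p (Jset m s) a else 0 := by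
  simp only [YJ, map_sum, wf, map_smul]
  rw [Finset.sum_congr rfl (g := fun T => if size a + z ≤ d then
    (fct K (flip p T a))⁻¹ • mono K p (flip p T a) else 0)]
  · split_ifs <;> simp
  · intro T hT
    rw [proj_mono _ _ (flip_rd _ _ ha), flip_size s T (Finset.mem_powerset.1 hT) a ha hs]
    split_ifs <;> simp

theorem MM_Fil (f : (Ix m → K) → K) (d z : ℕ) (hf : f ∈ MM K p t m) (hf' : f ∈ Fil K p t m d z) :
    f ∈ Submodule.span K (gens K p t m (fun a => size a + z ≤ d)) := by
  rw [← proj_Fil d z f hf']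
  clear hf'
  induction hf using Submodule.span_induction with
  | mem x h =>
    obtain ⟨s, a, h1, h2, h3, -, rfl⟩ := h
    rw [proj_YJ s a h2 h3]
    split_ifs with h
    · exact Submodule.subset_span ⟨s, a, h1, h2, h3, h, rfl⟩
    · exact Submodule.zero_mem _
  | zero => simp
  | add x y _ _ hx hy => rw [map_add]; exact Submodule.add_mem _ hx hy
  | smul c x _ hx => rw [map_smul]; exact Submodule.smul_mem _ _ hx

end flips
end PR

namespace PR
set_option linter.all false

section ops
variable {K : Type} [Field K] [Fintype K] {p t m : ℕ} [Fact p.Prime] [CharP K p]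
  [NeZero t] [Fact (Fintype.card K = p ^ t)]

/-- the shear `v ↦ v + c ρ_P(v) u_Q` -/
def shear {K : Type} [Field K] {m : ℕ} (P Q : Finset (Ix m)) (c : K) (v : Ix m → K) : Ix m → K :=
  fun i => v i + if i ∈ Q then c * ∑ k ∈ P, v k else 0

def op {K : Type} [Field K] [Fintype K] (p : ℕ) {t m : ℕ} (P Q : Finset (Ix m)) (j : Fin t) :
    ((Ix m → K) → K) →ₗ[K] ((Ix m → K) → K) where
  toFun f := fun v => - ∑ c : K, c ^ (p ^ t - 1 - p ^ (j : ℕ)) * f (shear P Q c v)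
  map_add' f g := by
    funext v
    simp [mul_add, Finset.sum_add_distrib]
    ring
  map_smul' r f := by
    funext v
    simp only [Pi.smul_apply, smul_eq_mul, RingHom.id_apply]
    rw [mul_neg, Finset.mul_sum]
    congr 1
    exact Finset.sum_congr rfl fun _ _ => by ring

def box {t m : ℕ} (N : Ex t m) : Finset (Ex t m) :=
  Fintype.piFinset (fun z => Finset.range (N z + 1))

theorem mem_box (N n : Ex t m) : n ∈ box N ↔ n ≤ N := by
  simp [box, Fintype.mem_piFinset, Pi.le_def, Nat.lt_succ_iff]

def wt (p : ℕ) {t m : ℕ} (n : Ex t m) : ℕ := ∑ z, p ^ (z.1 : ℕ) * n z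

def cf (K : Type) [Field K] {t m : ℕ} (N n : Ex t m) : K := ∏ z, ((N z).choose (n z) : K)

theorem mono_shift (N : Ex t m) (u v : Ix m → K) :
    mono K p N (v + u) = ∑ n ∈ box N, cf K N n * mono K p n u * mono K p (N - n) v := by
  have h1 : ∀ z : Fin t × Ix m, ((v + u) z.2) ^ (p ^ (z.1 : ℕ) * N z) =
      ∑ n ∈ Finset.range (N z + 1), ((N z).choose n : K) * (u z.2) ^ (p ^ (z.1 : ℕ) * n) *
        (v z.2) ^ (p ^ (z.1 : ℕ) * (N z - n)) := by
    intro z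
    have : CharP K p := inferInstance
    haveI : ExpChar K p := ExpChar.prime Fact.out
    rw [pow_mul, Pi.add_apply, add_pow_expChar_pow, add_comm, add_pow]
    refine Finset.sum_congr rfl fun n _ => ?_
    rw [pow_mul, pow_mul]
    ring
  simp only [mono]
  rw [Finset.prod_congr rfl (fun z _ => h1 z), Finset.prod_univ_sum]
  refine Finset.sum_congr rfl fun n _ => ?_
  simp only [Finset.prod_mul_distrib, cf, Pi.sub_apply]

theorem mono_ind (n : Ex t m) (Q : Finset (Ix m)) (c : K) :
    mono K p n (fun i => if i ∈ Q then c else 0) =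
      if (∀ z, n z ≠ 0 → z.2 ∈ Q) then c ^ wt p n else 0 := by
  have hp : 2 ≤ p := (Fact.out : p.Prime).two_le
  split_ifs with h
  · simp only [mono, wt]
    rw [← Finset.prod_pow_eq_pow_sum]
    refine Finset.prod_congr rfl fun z _ => ?_
    by_cases hz : n z = 0
    · simp [hz]
    · simp [h z hz]
  · push Not at h
    obtain ⟨z, hz, hzQ⟩ := h
    simp only [mono]
    refine Finset.prod_eq_zero (Finset.mem_univ z) ?_
    rw [if_neg hzQ, zero_pow]
    have : 0 < p ^ (z.1 : ℕ) := by positivity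
    positivity

def adm {t m : ℕ} (p : ℕ) (Q : Finset (Ix m)) (j : Fin t) (N : Ex t m) : Finset (Ex t m) :=
  (box N).filter (fun n => (∀ z, n z ≠ 0 → z.2 ∈ Q) ∧
    (p ^ t - 1) ∣ (p ^ t - 1 - p ^ (j : ℕ)) + wt p n)

theorem pj_lt (hp3 : 3 ≤ p) (j : Fin t) : p ^ (j : ℕ) < p ^ t - 1 := by
  have h1 : p ^ ((j : ℕ) + 1) ≤ p ^ t := Nat.pow_le_pow_right (by omega) j.2
  have h2 : 1 ≤ p ^ (j : ℕ) := Nat.one_le_pow _ _ (by omega)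
  rw [pow_succ] at h1
  have h3 : p ^ (j : ℕ) * 3 ≤ p ^ (j : ℕ) * p := Nat.mul_le_mul_left _ hp3
  omega

theorem sum_pow_pos (e : ℕ) (he : 0 < e) :
    ∑ c : K, c ^ e = if (p ^ t - 1) ∣ e then (-1 : K) else 0 := by
  have hc : Fintype.card K = p ^ t := Fact.out
  have := FiniteField.sum_pow_units K e
  rw [hc] at this
  rw [← this]
  rw [← Finset.sum_subset (Finset.subset_univ (Finset.univ.filter (fun c : K => c ≠ 0)))]
  · refine (Finset.sum_bij (fun (u : Kˣ) _ => (u : K)) ?_ ?_ ?_ ?_).symm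
    · intro u _
      simp
    · intro a _ b _ h
      exact Units.ext h
    · intro b hb
      exact ⟨Units.mk0 b (by simpa using hb), Finset.mem_univ _, rfl⟩
    · intro u _
      simp
  · intro c _ hc
    simp at hc
    simp [hc, he.ne']

theorem pow_congr (hp3 : 3 ≤ p) (j : Fin t) (w : ℕ)
    (h : (p ^ t - 1) ∣ (p ^ t - 1 - p ^ (j : ℕ)) + w) (r : K) : r ^ w = r ^ (p ^ (j : ℕ)) := by
  have hc : Fintype.card K = p ^ t := Fact.out
  have hj := pj_lt hp3 j
  have h1 : 1 ≤ p ^ (j : ℕ) := Nat.one_le_pow _ _ (by omega)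
  obtain ⟨e, he⟩ := h
  have he1 : 1 ≤ e := by
    by_contra hcon
    have : e = 0 := by omega
    rw [this] at he
    omega
  obtain ⟨e, rfl⟩ := Nat.exists_eq_add_of_le he1
  have hw : w = p ^ (j : ℕ) + (p ^ t - 1) * e := by
    rw [mul_add, mul_one] at he
    omega
  by_cases hr : r = 0
  · subst hr
    rw [zero_pow (by omega), zero_pow (by omega)]
  · rw [hw, pow_add, pow_mul]
    have := FiniteField.pow_card_sub_one_eq_one r hr
    rw [hc] at this
    rw [this]
    simp

theorem op_mono (hp3 : 3 ≤ p) (P Q : Finset (Ix m)) (j : Fin t) (N : Ex t m) :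
    op p P Q j (mono K p N) =
      ∑ n ∈ adm p Q j N, cf K N n • ∑ k ∈ P, mono K p (N - n + dl (j, k)) := by
  have hj := pj_lt hp3 j
  funext v
  have h1 : ∀ c : K, mono K p N (shear P Q c v) = ∑ n ∈ box N, cf K N n *
      (if (∀ z, n z ≠ 0 → z.2 ∈ Q) then (c * ∑ k ∈ P, v k) ^ wt p n else 0) *
        mono K p (N - n) v := by
    intro c
    have : shear P Q c v = v + fun i => if i ∈ Q then c * ∑ k ∈ P, v k else 0 := rfl
    rw [this, mono_shift]
    simp only [mono_ind]
  have h2 : op p P Q j (mono K p N) v = ∑ n ∈ box N, ∑ c : K, - (c ^ (p ^ t - 1 - p ^ (j : ℕ)) * (cf K N n *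
      (if (∀ z, n z ≠ 0 → z.2 ∈ Q) then (c * ∑ k ∈ P, v k) ^ wt p n else 0) *
        mono K p (N - n) v)) := by
    rw [Finset.sum_comm]
    change - ∑ c : K, c ^ (p ^ t - 1 - p ^ (j : ℕ)) * mono K p N (shear P Q c v) = _
    rw [← Finset.sum_neg_distrib]
    refine Finset.sum_congr rfl fun c _ => ?_
    rw [h1 c, Finset.mul_sum, Finset.sum_neg_distrib]
  rw [h2, adm, Finset.sum_filter, Finset.sum_apply]
  refine Finset.sum_congr rfl fun n _ => ?_
  by_cases hn : ∀ z, n z ≠ 0 → z.2 ∈ Q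
  · have h3 : ∑ c : K, - (c ^ (p ^ t - 1 - p ^ (j : ℕ)) * (cf K N n *
      (if (∀ z, n z ≠ 0 → z.2 ∈ Q) then (c * ∑ k ∈ P, v k) ^ wt p n else 0) *
        mono K p (N - n) v)) = - (∑ c : K, c ^ (p ^ t - 1 - p ^ (j : ℕ) + wt p n)) *
        (cf K N n * (∑ k ∈ P, v k) ^ wt p n * mono K p (N - n) v) := by
      rw [← Finset.sum_neg_distrib, Finset.sum_mul]
      refine Finset.sum_congr rfl fun c _ => ?_
      rw [if_pos hn, pow_add, mul_pow]
      ring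
    rw [h3, sum_pow_pos (p := p) (t := t) _ (by omega)]
    by_cases hd : (p ^ t - 1) ∣ (p ^ t - 1 - p ^ (j : ℕ)) + wt p n
    · rw [if_pos hd, if_pos ⟨hn, hd⟩, pow_congr hp3 j _ hd]
      haveI : ExpChar K p := ExpChar.prime Fact.out
      rw [sum_pow_char_pow]
      simp only [Pi.smul_apply, Finset.sum_apply, mono_add, mono_dl, Pi.mul_apply, smul_eq_mul,
        neg_neg, one_mul, ← Finset.mul_sum]
      ring
    · rw [if_neg hd, if_neg (fun h => hd h.2)]
      simp
  · rw [if_neg (fun h => hn h.1)]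
    simp only [if_neg hn]
    simp

theorem size_sub (N n : Ex t m) (h : n ≤ N) : size (N - n) + size n = size N := by
  rw [← size_add, tsub_add_cancel_of_le h]

theorem size_zero_iff (n : Ex t m) : size n = 0 ↔ n = 0 := by
  simp [size, Finset.sum_eq_zero_iff, funext_iff]

theorem size_one (n : Ex t m) (h : size n = 1) : ∃ z, n = dl z := by
  have : n ≠ 0 := by
    rintro rfl
    simp [size] at h
  obtain ⟨z, hz⟩ := Function.ne_iff.1 this
  obtain ⟨n0, rfl⟩ := exists_sub n z 1 (Nat.one_le_iff_ne_zero.2 hz)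
  rw [size_add, size_smul, size_dl] at h
  have : n0 = 0 := (size_zero_iff n0).1 (by omega)
  exact ⟨z, by rw [this]; simp⟩

theorem wt_dl (z : Fin t × Ix m) : wt p (dl z) = p ^ (z.1 : ℕ) := by
  simp only [wt, dl]
  rw [Finset.sum_eq_single z]
  · simp
  · intro b _ hb
    simp [Pi.single_eq_of_ne hb]
  · simp

theorem dl_inj {z z' : Fin t × Ix m} (h : dl z = dl z') : z = z' := by
  by_contra hne
  have := congrFun h z
  simp [dl, Pi.single_eq_of_ne hne] at this

theorem dl_le (z : Fin t × Ix m) (N : Ex t m) : dl z ≤ N ↔ 1 ≤ N z := by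
  constructor
  · intro h
    have := h z
    simpa [dl] using this
  · intro h z'
    by_cases hz : z' = z
    · subst hz
      simpa [dl] using h
    · simp [dl, Pi.single_eq_of_ne hz]

theorem cf_dl (z : Fin t × Ix m) (N : Ex t m) : cf K N (dl z) = N z := by
  simp only [cf, dl]
  rw [Finset.prod_eq_single z]
  · simp
  · intro b _ hb
    simp [Pi.single_eq_of_ne hb]
  · simp

theorem adm_dl (hp3 : 3 ≤ p) (Q : Finset (Ix m)) (j : Fin t) (N : Ex t m) (z : Fin t × Ix m) :
    dl z ∈ adm p Q j N ↔ z.1 = j ∧ z.2 ∈ Q ∧ N z ≠ 0 := by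
  have hj := pj_lt hp3 j
  have hz := pj_lt hp3 z.1
  have h1 : 1 ≤ p ^ (z.1 : ℕ) := Nat.one_le_pow _ _ (by omega)
  simp only [adm, Finset.mem_filter, mem_box, dl_le, wt_dl]
  have e1 : (∀ z', dl z z' ≠ 0 → z'.2 ∈ Q) ↔ z.2 ∈ Q := by
    constructor
    · intro h
      exact h z (by simp [dl])
    · intro h z' hz'
      by_cases hh : z' = z
      · rw [hh]; exact h
      · simp [dl, Pi.single_eq_of_ne hh] at hz'
  have e2 : (p ^ t - 1) ∣ (p ^ t - 1 - p ^ (j : ℕ)) + p ^ (z.1 : ℕ) ↔ z.1 = j := by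
    constructor
    · rintro ⟨e, he⟩
      have he2 : e = 1 := by
        by_contra hne
        rcases Nat.lt_or_gt_of_ne hne with h | h
        · have : e = 0 := by omega
          rw [this] at he
          omega
        · have : (p ^ t - 1) * 2 ≤ (p ^ t - 1) * e := Nat.mul_le_mul_left _ h
          omega
      rw [he2] at he
      have h5 : p ^ (z.1 : ℕ) = p ^ (j : ℕ) := by omega
      exact Fin.ext (Nat.pow_right_injective (by omega) h5)
    · intro h
      rw [h]
      exact ⟨1, by omega⟩
  rw [e1, e2]
  constructor
  · rintro ⟨a, b, c⟩
    exact ⟨c, b, by omega⟩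
  · rintro ⟨a, b, c⟩
    exact ⟨by omega, b, a⟩

theorem adm_zero (hp3 : 3 ≤ p) (Q : Finset (Ix m)) (j : Fin t) (N : Ex t m) :
    (0 : Ex t m) ∉ adm p Q j N := by
  have hj := pj_lt hp3 j
  have h1 : 1 ≤ p ^ (j : ℕ) := Nat.one_le_pow _ _ (by omega)
  intro h
  have h2 := (Finset.mem_filter.1 h).2.2
  simp only [wt, Pi.zero_apply, mul_zero, Finset.sum_const_zero, add_zero] at h2
  have := Nat.le_of_dvd (by omega) h2
  omega

theorem op_mono_mod (hp3 : 3 ≤ p) (P Q : Finset (Ix m)) (j : Fin t) (N : Ex t m) :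
    op p P Q j (mono K p N) - ∑ l ∈ Q, ∑ k ∈ P, (N (j, l) : K) • mono K p (N - dl (j, l) + dl (j, k))
      ∈ Fil K p t m (size N) 1 := by
  rw [op_mono hp3]
  rw [← Finset.sum_filter_add_sum_filter_not (adm p Q j N) (fun n => size n = 1)]
  have h1 : (adm p Q j N).filter (fun n => size n = 1) =
      (Q.filter (fun l => N (j, l) ≠ 0)).image (fun l => dl (j, l)) := by
    ext n
    simp only [Finset.mem_filter, Finset.mem_image]
    constructor
    · rintro ⟨hn, hs⟩
      obtain ⟨z, rfl⟩ := size_one n hs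
      rw [adm_dl hp3] at hn
      refine ⟨z.2, ⟨hn.2.1, ?_⟩, ?_⟩
      · rw [← hn.1]; exact hn.2.2
      · rw [← hn.1]
    · rintro ⟨l, ⟨hl, hl'⟩, rfl⟩
      rw [adm_dl hp3]
      exact ⟨⟨rfl, hl, hl'⟩, size_dl _⟩
  have h2 : ∑ n ∈ (adm p Q j N).filter (fun n => size n = 1),
      cf K N n • ∑ k ∈ P, mono K p (N - n + dl (j, k)) =
      ∑ l ∈ Q, ∑ k ∈ P, (N (j, l) : K) • mono K p (N - dl (j, l) + dl (j, k)) := by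
    rw [h1, Finset.sum_image, Finset.sum_filter]
    · refine Finset.sum_congr rfl fun l _ => ?_
      rw [cf_dl, Finset.smul_sum]
      split_ifs with h
      · rfl
      · have h : N (j, l) = 0 := by simpa using h
        simp [h]
    · intro a _ b _ h
      have := dl_inj h
      simpa using this
  rw [h2, add_sub_cancel_left]
  refine Submodule.sum_mem _ fun n hn => Submodule.smul_mem _ _ <| Submodule.sum_mem _ fun k _ => ?_
  apply mono_mem_Fil
  rw [Finset.mem_filter] at hn
  have h3 : n ≠ 0 := by
    rintro rfl
    exact adm_zero hp3 Q j N hn.1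
  have h4 : size n ≠ 0 := fun h => h3 ((size_zero_iff n).1 h)
  have h5 := size_sub N n ((mem_box N n).1 (Finset.mem_filter.1 hn.1).1)
  rw [size_add, size_dl]
  omega

theorem op_Fil (hp3 : 3 ≤ p) (P Q : Finset (Ix m)) (j : Fin t) (d z : ℕ) (f : (Ix m → K) → K)
    (hf : f ∈ Fil K p t m d z) : op p P Q j f ∈ Fil K p t m d z := by
  induction hf using Submodule.span_induction with
  | mem x h =>
    obtain ⟨N, hN, rfl⟩ := h
    rw [op_mono hp3]
    refine Submodule.sum_mem _ fun n hn => Submodule.smul_mem _ _ <| Submodule.sum_mem _ fun k _ => ?_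
    apply mono_mem_Fil
    have h3 : n ≠ 0 := by
      rintro rfl
      exact adm_zero hp3 Q j N hn
    have h4 : size n ≠ 0 := fun h => h3 ((size_zero_iff n).1 h)
    have h5 := size_sub N n ((mem_box N n).1 (Finset.mem_filter.1 hn).1)
    rw [size_add, size_dl]
    omega
  | zero => simp
  | add x y _ _ hx hy => rw [map_add]; exact Submodule.add_mem _ hx hy
  | smul c x _ hx => rw [map_smul]; exact Submodule.smul_mem _ _ hx

end ops
end PR

namespace PR
set_option linter.all false

section act
variable {K : Type} [Field K] [Fintype K] {p t m : ℕ} [Fact p.Prime] [CharP K p]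
  [NeZero t] [Fact (Fintype.card K = p ^ t)]

theorem mono_unred (N : Ex t m) (h : ¬ Rd p N) : mono K p N ∈ Fil K p t m (size N) (p - 1) := by
  have hp : 2 ≤ p := (Fact.out : p.Prime).two_le
  unfold Rd at h
  push Not at h
  obtain ⟨⟨j, i⟩, hz⟩ := h
  obtain ⟨N0, rfl⟩ := exists_sub N (j, i) p hz
  rw [mono_carry]
  apply mono_mem_Fil
  rw [size_add, size_add, size_smul, size_dl, size_dl]
  omega

theorem mono_unred1 (N : Ex t m) (h : ¬ Rd p N) : mono K p N ∈ Fil K p t m (size N) 1 := by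
  have hp : 2 ≤ p := (Fact.out : p.Prime).two_le
  exact Fil_mono (by omega) (mono_unred N h)

def stp {t m : ℕ} (k l : Fin m) (j : Fin t) (a : Ex t m) : Ex t m :=
  a - dl (j, Sum.inr l) + dl (j, Sum.inl k)

def stpF {t m : ℕ} (k : Fin m) (j : Fin t) (a : Ex t m) : Ex t m :=
  a - dl (j, Sum.inl k) + dl (j, Sum.inr k)

def cnd (p : ℕ) {t m : ℕ} (k l : Fin m) (j : Fin t) (a : Ex t m) : Prop :=
  a (j, Sum.inl k) + 1 < p ∧ 1 ≤ a (j, Sum.inr l)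

def cndF (p : ℕ) {t m : ℕ} (k : Fin m) (j : Fin t) (a : Ex t m) : Prop :=
  1 ≤ a (j, Sum.inl k) ∧ a (j, Sum.inr k) + 1 < p

theorem fct_inr (a : Ex t m) (j : Fin t) (l : Fin m) :
    fct K (a + dl (j, Sum.inr l)) = (a (j, Sum.inr l) + 1) * fct K a := by
  simp only [fct, ← Fintype.prod_prod_type']
  rw [← Finset.mul_prod_erase Finset.univ _ (Finset.mem_univ (j, l)),
    ← Finset.mul_prod_erase Finset.univ (fun x : Fin t × Fin m =>
      ((Nat.factorial (a (x.1, Sum.inr x.2)) : ℕ) : K)) (Finset.mem_univ (j, l)), ← mul_assoc]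
  congr 1
  · simp [dl, Nat.factorial_succ]
  · refine Finset.prod_congr rfl fun x hx => ?_
    have hne : x ≠ (j, l) := (Finset.mem_erase.1 hx).1
    have : (x.1, (Sum.inr x.2 : Ix m)) ≠ (j, Sum.inr l) := by
      intro h
      apply hne
      simp only [Prod.mk.injEq, Sum.inr.injEq] at h
      exact Prod.ext h.1 h.2
    simp [dl, Pi.single_eq_of_ne this]

theorem fct_inl (a : Ex t m) (j : Fin t) (l : Fin m) :
    fct K (a + dl (j, Sum.inl l)) = fct K a := by
  simp [fct, dl, Pi.single_apply]

theorem sub_dl_add (a : Ex t m) (z : Fin t × Ix m) (h : 1 ≤ a z) : a - dl z + dl z = a :=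
  tsub_add_cancel_of_le ((dl_le z a).2 h)

theorem size_sub_dl (a : Ex t m) (z z' : Fin t × Ix m) (h : 1 ≤ a z) :
    size (a - dl z + dl z') = size a := by
  conv_rhs => rw [← sub_dl_add a z h]
  rw [size_add, size_add, size_dl, size_dl]

theorem cnd_rd (k l : Fin m) (j : Fin t) (a : Ex t m) (ha : Rd p a)
    (h : a (j, Sum.inl k) + 1 < p) : Rd p (stp k l j a) := by
  intro z
  have := ha z
  simp only [stp, Pi.add_apply, Pi.sub_apply, dl, Pi.single_apply]
  split_ifs with h1 h2 h2
  · omega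
  · omega
  · subst h2; omega
  · omega

theorem cndF_rd (k : Fin m) (j : Fin t) (a : Ex t m) (ha : Rd p a)
    (h : a (j, Sum.inr k) + 1 < p) : Rd p (stpF k j a) := by
  intro z
  have := ha z
  simp only [stpF, Pi.add_apply, Pi.sub_apply, dl, Pi.single_apply]
  split_ifs with h1 h2 h2
  · omega
  · omega
  · subst h2; omega
  · omega

theorem op_wf (hp3 : 3 ≤ p) (T : Finset (Fin m)) (j : Fin t) (a : Ex t m) (ha : Rd p a) :
    op p (T.map ⟨Sum.inl, Sum.inl_injective⟩) (T.map ⟨Sum.inr, Sum.inr_injective⟩) j (wf K p a) -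
      ∑ l ∈ T, ∑ k ∈ T, (if cnd p k l j a then wf K p (stp k l j a) else 0) ∈
      Fil K p t m (size a) 1 := by
  have h1 := op_mono_mod (K := K) hp3 (T.map ⟨Sum.inl, Sum.inl_injective⟩)
    (T.map ⟨Sum.inr, Sum.inr_injective⟩) j a
  have h2 := Submodule.smul_mem _ ((fct K a)⁻¹) h1
  rw [smul_sub, ← map_smul] at h2
  rw [wf]
  rw [← sub_add_sub_cancel]
  refine Submodule.add_mem _ h2 ?_
  simp only [Finset.sum_map, Finset.smul_sum, Function.Embedding.coeFn_mk]
  rw [← Finset.sum_sub_distrib]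
  refine Submodule.sum_mem _ fun l hl => ?_
  rw [← Finset.sum_sub_distrib]
  refine Submodule.sum_mem _ fun k hk => ?_
  by_cases hb : 1 ≤ a (j, Sum.inr l)
  · by_cases hx : a (j, Sum.inl k) + 1 < p
    · rw [if_pos ⟨hx, hb⟩]
      have : fct K a = (a (j, Sum.inr l) : K) * fct K (stp k l j a) := by
        conv_lhs => rw [← sub_dl_add a _ hb]
        rw [fct_inr, stp, fct_inl]
        congr 1
        rw [Pi.sub_apply]
        simp only [dl, Pi.single_eq_same]
        have := Nat.sub_add_cancel hb
        exact_mod_cast congrArg (Nat.cast (R := K)) this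
      have h0 : (a (j, Sum.inr l) : K) ≠ 0 := nat_ne (p := p) _ (ha _) hb
      rw [wf, this, smul_smul, ← stp]
      have h3 : ((a (j, Sum.inr l) : K) * fct K (stp k l j a))⁻¹ * (a (j, Sum.inr l) : K) =
          (fct K (stp k l j a))⁻¹ := by
        rw [mul_inv]
        field_simp
      rw [h3, sub_self]
      exact Submodule.zero_mem _
    · rw [if_neg (fun h => hx h.1), sub_zero]
      refine Submodule.smul_mem _ _ (Submodule.smul_mem _ _ ?_)
      rw [← size_sub_dl a _ (j, Sum.inl k) hb]
      apply mono_unred1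
      intro h
      have := h (j, Sum.inl k)
      simp [dl, Pi.single_apply] at this
      omega
  · rw [if_neg (fun h => hb h.2)]
    have : a (j, Sum.inr l) = 0 := by omega
    simp [this]

theorem op_wfF (hp3 : 3 ≤ p) (k : Fin m) (j : Fin t) (a : Ex t m) (ha : Rd p a) :
    op p {Sum.inr k} {Sum.inl k} j (wf K p a) -
      (if cndF p k j a then ((a (j, Sum.inl k) : K) * (a (j, Sum.inr k) + 1)) •
        wf K p (stpF k j a) else 0) ∈ Fil K p t m (size a) 1 := by
  have h1 := op_mono_mod (K := K) hp3 {Sum.inr k} {Sum.inl k} j a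
  have h2 := Submodule.smul_mem _ ((fct K a)⁻¹) h1
  rw [smul_sub, ← map_smul] at h2
  rw [wf]
  rw [← sub_add_sub_cancel]
  refine Submodule.add_mem _ h2 ?_
  simp only [Finset.sum_singleton]
  by_cases hb : 1 ≤ a (j, Sum.inl k)
  · by_cases hx : a (j, Sum.inr k) + 1 < p
    · rw [if_pos ⟨hb, hx⟩]
      have h0 : ((a (j, Sum.inr k) : K) + 1) ≠ 0 := by
        exact_mod_cast nat_ne (K := K) (p := p) _ hx (by omega)
      have : fct K (stpF k j a) = (a (j, Sum.inr k) + 1) * fct K a := by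
        rw [stpF, fct_inr]
        conv_rhs => rw [← sub_dl_add a _ hb]
        rw [fct_inl]
        simp [dl, Pi.single_apply]
      have h3 := fct_ne (K := K) a ha
      rw [wf, this, smul_smul, smul_smul, ← stpF]
      have h3 : (fct K a)⁻¹ * (a (j, Sum.inl k) : K) = (a (j, Sum.inl k) : K) *
          (a (j, Sum.inr k) + 1) * ((a (j, Sum.inr k) + 1) * fct K a)⁻¹ := by
        field_simp
      rw [h3, sub_self]
      exact Submodule.zero_mem _
    · rw [if_neg (fun h => hx h.2), sub_zero]
      refine Submodule.smul_mem _ _ (Submodule.smul_mem _ _ ?_)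
      rw [← size_sub_dl a _ (j, Sum.inr k) hb]
      apply mono_unred1
      intro h
      have := h (j, Sum.inr k)
      simp [dl, Pi.single_apply] at this
      omega
  · rw [if_neg (fun h => hb h.1)]
    have : a (j, Sum.inl k) = 0 := by omega
    simp [this]

theorem stp_flip (U : Finset (Fin t)) (k l : Fin m) (j : Fin t) (a : Ex t m) (ha : Rd p a)
    (h : if j ∈ U then cnd p l k j a else cnd p k l j a) :
    stp k l j (flip p U a) = flip p U (if j ∈ U then stp l k j a else stp k l j a) := by
  funext z
  obtain ⟨j', i⟩ := z
  have h1 := ha (j', Sum.swap i)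
  by_cases hj : j ∈ U
  · simp only [hj, if_true] at h ⊢
    obtain ⟨h2, h3⟩ := h
    by_cases hjj : j' = j
    · subst hjj
      rcases i with i | i
      · simp only [stp, flip, dl, Pi.add_apply, Pi.sub_apply, Pi.single_apply, hj, if_true,
          Sum.swap_inl, Prod.mk.injEq, true_and, reduceCtorEq, if_false, Sum.inl.injEq, Sum.inr.injEq] at h1 ⊢
        split_ifs with h4
        · subst h4; omega
        · omega
      · simp only [stp, flip, dl, Pi.add_apply, Pi.sub_apply, Pi.single_apply, hj, if_true,
          Sum.swap_inr, Prod.mk.injEq, true_and, reduceCtorEq, if_false, Sum.inl.injEq, Sum.inr.injEq] at h1 ⊢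
        split_ifs with h4
        · subst h4; omega
        · omega
    · simp [stp, flip, dl, Pi.single_apply, hjj]
  · simp only [hj, if_false] at h ⊢
    by_cases hjj : j' = j
    · subst hjj
      simp [stp, flip, dl, Pi.single_apply, hj]
    · simp [stp, flip, dl, Pi.single_apply, hjj]

theorem cnd_flip (U : Finset (Fin t)) (k l : Fin m) (j : Fin t) (a : Ex t m) (ha : Rd p a) :
    cnd p k l j (flip p U a) ↔ if j ∈ U then cnd p l k j a else cnd p k l j a := by
  have h1 := ha (j, Sum.inl l)
  have h2 := ha (j, Sum.inr k)
  by_cases hj : j ∈ U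
  · simp only [cnd, flip, hj, if_true, Sum.swap_inl, Sum.swap_inr]
    omega
  · simp [cnd, flip, hj]

theorem stpF_flip (U : Finset (Fin t)) (k : Fin m) (j : Fin t) (a : Ex t m) (ha : Rd p a)
    (h : cndF p k j a) :
    stpF k j (flip p U a) = flip p U (stpF k j a) := by
  funext z
  obtain ⟨j', i⟩ := z
  have h1 := ha (j', Sum.swap i)
  by_cases hj : j ∈ U
  · obtain ⟨h2, h3⟩ := h
    by_cases hjj : j' = j
    · subst hjj
      rcases i with i | i
      · simp only [stpF, flip, dl, Pi.add_apply, Pi.sub_apply, Pi.single_apply, hj, if_true,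
          Sum.swap_inl, Prod.mk.injEq, true_and, reduceCtorEq, if_false, Sum.inl.injEq, Sum.inr.injEq] at h1 ⊢
        split_ifs with h4
        · subst h4; omega
        · omega
      · simp only [stpF, flip, dl, Pi.add_apply, Pi.sub_apply, Pi.single_apply, hj, if_true,
          Sum.swap_inr, Prod.mk.injEq, true_and, reduceCtorEq, if_false, Sum.inl.injEq, Sum.inr.injEq] at h1 ⊢
        split_ifs with h4
        · subst h4; omega
        · omega
    · simp [stpF, flip, dl, Pi.single_apply, hjj]
  · by_cases hjj : j' = j
    · subst hjj
      simp [stpF, flip, dl, Pi.single_apply, hj]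
    · simp [stpF, flip, dl, Pi.single_apply, hjj]

theorem cndF_flip (U : Finset (Fin t)) (k : Fin m) (j : Fin t) (a : Ex t m) (ha : Rd p a) :
    cndF p k j (flip p U a) ↔ cndF p k j a := by
  have h1 := ha (j, Sum.inl k)
  have h2 := ha (j, Sum.inr k)
  by_cases hj : j ∈ U
  · simp only [cndF, flip, hj, if_true, Sum.swap_inl, Sum.swap_inr]
    omega
  · simp [cndF, flip, hj]

theorem op_YJ (hp3 : 3 ≤ p) (s : Fin t → ℕ) (T : Finset (Fin m)) (j : Fin t) (a : Ex t m) (ha : Rd p a)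
    (hs : HT p a s) :
    op p (T.map ⟨Sum.inl, Sum.inl_injective⟩) (T.map ⟨Sum.inr, Sum.inr_injective⟩) j
      (YJ K p (Jset m s) a) -
      ∑ l ∈ T, ∑ k ∈ T, (if cnd p k l j a then YJ K p (Jset m s) (stp k l j a) else 0) ∈
      Fil K p t m (size a) 1 := by
  have e : ∑ l ∈ T, ∑ k ∈ T, (if cnd p k l j a then YJ K p (Jset m s) (stp k l j a) else 0) =
      ∑ U ∈ (Jset m s).powerset, ∑ l ∈ T, ∑ k ∈ T,
        (if cnd p k l j (flip p U a) then wf K p (stp k l j (flip p U a)) else 0) := by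
    have e2 : ∀ U : Finset (Fin t), ∑ l ∈ T, ∑ k ∈ T,
        (if cnd p k l j (flip p U a) then wf K p (stp k l j (flip p U a)) else 0) =
        ∑ l ∈ T, ∑ k ∈ T, (if cnd p k l j a then wf K p (flip p U (stp k l j a)) else 0) := by
      intro U
      by_cases hj : j ∈ U
      · rw [Finset.sum_comm]
        refine Finset.sum_congr rfl fun l _ => Finset.sum_congr rfl fun k _ => ?_
        rw [cnd_flip U _ _ j a ha, if_pos hj]
        split_ifs with h
        · rw [stp_flip U _ _ j a ha (by rw [if_pos hj]; exact h), if_pos hj]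
        · rfl
      · refine Finset.sum_congr rfl fun l _ => Finset.sum_congr rfl fun k _ => ?_
        rw [cnd_flip U _ _ j a ha, if_neg hj]
        split_ifs with h
        · rw [stp_flip U _ _ j a ha (by rw [if_neg hj]; exact h), if_neg hj]
        · rfl
    simp only [e2]
    conv_rhs => rw [Finset.sum_comm]
    refine Finset.sum_congr rfl fun l _ => ?_
    conv_rhs => rw [Finset.sum_comm]
    refine Finset.sum_congr rfl fun k _ => ?_
    split_ifs
    · rfl
    · simp
  rw [e, YJ, map_sum, ← Finset.sum_sub_distrib]
  refine Submodule.sum_mem _ fun U hU => ?_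
  rw [← flip_size s U (Finset.mem_powerset.1 hU) a ha hs]
  exact op_wf hp3 T j _ (flip_rd U a ha)

theorem op_YJF (hp3 : 3 ≤ p) (s : Fin t → ℕ) (k : Fin m) (j : Fin t) (a : Ex t m) (ha : Rd p a)
    (hs : HT p a s) :
    op p {Sum.inr k} {Sum.inl k} j (YJ K p (Jset m s) a) -
      (if cndF p k j a then ((a (j, Sum.inl k) : K) * (a (j, Sum.inr k) + 1)) •
        YJ K p (Jset m s) (stpF k j a) else 0) ∈ Fil K p t m (size a) 1 := by
  have e : (if cndF p k j a then ((a (j, Sum.inl k) : K) * (a (j, Sum.inr k) + 1)) •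
        YJ K p (Jset m s) (stpF k j a) else 0) =
      ∑ U ∈ (Jset m s).powerset, (if cndF p k j (flip p U a) then
        ((flip p U a (j, Sum.inl k) : K) * (flip p U a (j, Sum.inr k) + 1)) •
        wf K p (stpF k j (flip p U a)) else 0) := by
    by_cases h : cndF p k j a
    · rw [if_pos h, YJ, Finset.smul_sum]
      refine Finset.sum_congr rfl fun U _ => ?_
      rw [cndF_flip U k j a ha, if_pos h, stpF_flip U k j a ha h]
      congr 1
      by_cases hj : j ∈ U
      · have h1 := ha (j, Sum.inl k)
        have h2 := ha (j, Sum.inr k)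
        simp only [flip, hj, if_true, Sum.swap_inl, Sum.swap_inr]
        rw [Nat.sub_sub, Nat.sub_sub, Nat.cast_sub (by omega), Nat.cast_sub (by omega)]
        push_cast
        rw [CharP.cast_eq_zero K p]
        ring
      · simp [flip, hj]
    · rw [if_neg h]
      refine (Finset.sum_eq_zero fun U _ => ?_).symm
      rw [cndF_flip U k j a ha, if_neg h]
  rw [e, YJ, map_sum, ← Finset.sum_sub_distrib]
  refine Submodule.sum_mem _ fun U hU => ?_
  rw [← flip_size s U (Finset.mem_powerset.1 hU) a ha hs]
  exact op_wfF hp3 k j _ (flip_rd U a ha)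

end act
end PR

namespace PR
set_option linter.all false

section comb
variable {m : ℕ}

def tr (k l : Fin m) (n : Fin m → ℕ) : Fin m → ℕ := fun i =>
  n i + (if i = k then 1 else 0) - (if i = l then 1 else 0)

def Vl (h lam : ℕ) (n : Fin m → ℕ) : Prop := (∀ i, n i ≤ 2 * h) ∧ ∑ i, n i = lam

theorem tr_sum (k l : Fin m) (n : Fin m → ℕ) (hkl : k ≠ l) (hl : 1 ≤ n l) :
    ∑ i, tr k l n i = ∑ i, n i := by
  have h1 : ∑ i, (tr k l n i + (if i = l then 1 else 0)) =
      ∑ i, (n i + (if i = k then 1 else 0)) := by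
    refine Finset.sum_congr rfl fun i _ => ?_
    unfold tr
    split_ifs with h1 h2 h2
    · omega
    · omega
    · subst h2; omega
    · omega
  simp only [Finset.sum_add_distrib, Finset.sum_ite_eq', Finset.mem_univ, if_true] at h1
  omega

theorem tr_vl (h lam : ℕ) (k l : Fin m) (n : Fin m → ℕ) (hkl : k ≠ l) (hn : Vl h lam n)
    (hl : 1 ≤ n l) (hk : n k + 1 ≤ 2 * h) : Vl h lam (tr k l n) := by
  refine ⟨fun i => ?_, by rw [tr_sum k l n hkl hl]; exact hn.2⟩
  have := hn.1 i
  unfold tr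
  split_ifs with h1
  · omega
  · subst h1; omega
  · omega
  · omega

theorem exists_lt_gt (n n' : Fin m → ℕ) (h : ∑ i, n i = ∑ i, n' i) (hne : n ≠ n') :
    ∃ k l, k ≠ l ∧ n k < n' k ∧ n' l < n l := by
  have h1 : ∃ k, n k < n' k := by
    by_contra hc
    push Not at hc
    apply hne
    have := (Finset.sum_eq_sum_iff_of_le (fun i _ => hc i)).1 h.symm
    exact funext fun i => (this i (Finset.mem_univ _)).symm
  have h2 : ∃ k, n' k < n k := by
    by_contra hc
    push Not at hc
    apply hne
    have := (Finset.sum_eq_sum_iff_of_le (fun i _ => hc i)).1 h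
    exact funext fun i => (this i (Finset.mem_univ _))
  obtain ⟨k, hk⟩ := h1
  obtain ⟨l, hl⟩ := h2
  exact ⟨k, l, by rintro rfl; omega, hk, hl⟩

def dst (n n' : Fin m → ℕ) : ℕ := ∑ i, (n i - n' i)

theorem dst_tr (n n' : Fin m → ℕ) (k l : Fin m) (hkl : k ≠ l) (hk : n k < n' k) (hl : n' l < n l) :
    dst (tr k l n) n' < dst n n' := by
  unfold dst
  refine Finset.sum_lt_sum (fun i _ => ?_) ⟨l, Finset.mem_univ _, ?_⟩
  · unfold tr
    split_ifs with h1 h2 h2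
    · omega
    · subst h1; omega
    · omega
    · omega
  · unfold tr
    rw [if_neg hkl.symm, if_pos rfl]
    omega

variable (h lam : ℕ) (hh : 2 ≤ h) (Good : (Fin m → ℕ) → Prop)
  (H1 : ∀ n k l, k ≠ l → Vl h lam n → Good n → 1 ≤ n l → n k + 1 ≤ 2 * h →
    ¬ (n k = h ∧ n l = h) → Good (tr k l n))
  (H2 : ∀ n k l, k ≠ l → Vl h lam n → Good n → n k = h → n l = h →
    Good (tr l k n) → Good (tr k l n))
include hh H1

theorem comb_free (n : Fin m → ℕ) (hn : Vl h lam n) (hg : Good n) (hc : n ≠ fun _ => h)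
    (k l : Fin m) (hkl : k ≠ l) (hl : 1 ≤ n l) (hk : n k + 1 ≤ 2 * h) : Good (tr k l n) := by
  by_cases hb : n k = h ∧ n l = h
  · obtain ⟨r, hr⟩ := Function.ne_iff.1 hc
    have hrk : r ≠ k := by rintro rfl; exact hr hb.1
    have hrl : r ≠ l := by rintro rfl; exact hr hb.2
    by_cases hr2 : 1 ≤ n r ∧ n r ≠ h + 1
    · have g1 := H1 n k r hrk.symm hn hg hr2.1 hk (fun h => hr h.2)
      have v1 := tr_vl h lam k r n hrk.symm hn hr2.1 hk
      have hb2 := hn.1 r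
      have e1 : tr k r n r = n r - 1 := by simp [tr, hrk]
      have e2 : tr k r n l = n l := by simp [tr, hrl.symm, hkl.symm]
      have g2 := H1 _ r l hrl v1 g1 (by omega) (by omega) (by omega)
      convert g2 using 1
      funext i
      unfold tr
      split_ifs <;> subst_vars <;> first | omega | contradiction
    · have hb2 := hn.1 r
      have hr' : n r ≠ h := hr
      have g1 := H1 n r l hrl hn hg hl (by omega) (fun h => hr h.1)
      have v1 := tr_vl h lam r l n hrl hn hl (by omega)
      have e1 : tr r l n r = n r + 1 := by simp [tr, hrl]
      have e2 : tr r l n k = n k := by simp [tr, hrk.symm, hkl]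
      have g2 := H1 _ k r hrk.symm v1 g1 (by omega) (by omega) (by omega)
      convert g2 using 1
      funext i
      unfold tr
      split_ifs <;> subst_vars <;> first | omega | contradiction
  · exact H1 n k l hkl hn hg hl hk hb

theorem comb_walk (hN : Good (fun _ => h) → ∑ i : Fin m, h = lam →
      ∀ k l, k ≠ l → Good (tr k l (fun _ => h)))
    (n n' : Fin m → ℕ) (hn : Vl h lam n) (hn' : Vl h lam n') (hg : Good n) : Good n' := by
  induction hd : dst n n' using Nat.strong_induction_on generalizing n with
  | _ d ih =>
    by_cases hne : n = n'
    · rw [← hne]; exact hg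
    · obtain ⟨k, l, hkl, hk, hl⟩ := exists_lt_gt n n' (by rw [hn.2, hn'.2]) hne
      have hb := hn'.1 k
      have hv := tr_vl h lam k l n hkl hn (by omega) (by omega)
      have hlt := dst_tr n n' k l hkl hk hl
      refine ih _ (by omega) (tr k l n) hv ?_ rfl
      by_cases hc : n = fun _ => h
      · subst hc
        exact hN hg hn.2 k l hkl
      · exact comb_free h lam hh Good H1 n hn hg hc k l hkl (by omega) (by omega)

include H2

theorem comb_nb (hm : 2 ≤ m) (hlam : ∑ i : Fin m, h = lam) (hgc : Good (fun _ => h)) (a b : Fin m) (hab : a ≠ b)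
    (hg : Good (tr a b (fun _ => h))) (k l : Fin m) (hkl : k ≠ l) : Good (tr k l (fun _ => h)) := by
  have vc : Vl h lam (fun _ : Fin m => h) := ⟨fun _ => by show h ≤ 2 * h; omega, hlam⟩
  by_cases hcase : k = b ∧ l = a
  · rw [hcase.1, hcase.2]
    exact H2 _ b a hab.symm vc hgc rfl rfl hg
  · have v1 := tr_vl h lam a b _ hab vc (by omega) (by omega)
    have hne : tr a b (fun _ => h) ≠ fun _ => h := by
      intro hh
      have := congrFun hh a
      simp [tr, hab] at this
    have el : h - 1 ≤ tr a b (fun _ => h) l := by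
      simp only [tr]; split_ifs <;> omega
    have ek : tr a b (fun _ => h) k ≤ h + 1 := by
      simp only [tr]; split_ifs <;> omega
    have g1 := comb_free h lam hh Good H1 _ v1 hg hne k l hkl (by omega) (by omega)
    have v2 := tr_vl h lam k l _ hkl v1 (by omega) (by omega)
    have hne2 : tr k l (tr a b (fun _ => h)) ≠ fun _ => h := by
      intro hh2
      have hka := congrFun hh2 a
      have hkb := congrFun hh2 b
      have ea : ¬ (a = b) := hab
      have eb : ¬ (b = a) := fun h => hab h.symm
      simp only [tr, ea, eb, if_true, if_false] at hka hkb
      apply hcase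
      constructor
      · by_contra hc
        rw [if_neg (fun h => hc h.symm)] at hkb
        split_ifs at hkb <;> omega
      · by_contra hc
        rw [if_neg (fun h : a = l => hc h.symm)] at hka
        split_ifs at hka <;> omega
    have ea : h ≤ tr k l (tr a b (fun _ => h)) a := by
      have e1 : ¬ (a = b) := hab
      simp only [tr, e1, if_true, if_false]
      split_ifs <;> omega
    have eb : tr k l (tr a b (fun _ => h)) b ≤ h := by
      have e1 : ¬ (b = a) := fun h => hab h.symm
      simp only [tr, e1, if_true, if_false]
      split_ifs <;> omega
    have g2 := comb_free h lam hh Good H1 _ v2 g1 hne2 b a hab.symm (by omega) (by omega)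
    convert g2 using 1
    funext i
    simp only [tr]
    split_ifs <;> first | omega | (subst_vars; contradiction)

theorem comb_B (hm : 2 ≤ m) (hlam : ∑ i : Fin m, h = lam) (hgc : Good (fun _ => h))
    (n : Fin m → ℕ) (hn : Vl h lam n) (hg : Good n) (hne : n ≠ fun _ => h) :
    ∀ k l, k ≠ l → Good (tr k l (fun _ => h)) := by
  induction hd : dst n (fun _ => h) using Nat.strong_induction_on generalizing n with
  | _ d ih =>
    obtain ⟨k, l, hkl, hk, hl⟩ := exists_lt_gt n (fun _ => h) (by rw [hn.2, hlam]) hne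
    have hv := tr_vl h lam k l n hkl hn (by omega) (by omega)
    have hlt := dst_tr n (fun _ => h) k l hkl hk hl
    have hg' := comb_free h lam hh Good H1 n hn hg hne k l hkl (by omega) (by omega)
    by_cases hc : tr k l n = fun _ => h
    · have e : n = tr l k (fun _ => h) := by
        funext i
        have := congrFun hc i
        simp only [tr] at this ⊢
        have hll : i = l → h < n i := by rintro rfl; exact hl
        split_ifs at this ⊢ with h1 h2 h2
        · exact absurd (h2.symm.trans h1) hkl
        · have := hll h1; omega
        · omega
        · omega
      rw [e] at hg
      exact comb_nb h lam hh Good H1 H2 hm hlam hgc l k hkl.symm hg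
    · exact ih _ (by omega) _ hv hg' hc rfl

theorem comb_main (hm : 2 ≤ m) (n n' : Fin m → ℕ) (hn : Vl h lam n) (hn' : Vl h lam n') (hg : Good n)
    (H3 : n ≠ (fun _ => h) ∨ (∀ k l, k ≠ l → ∑ i : Fin m, h = lam →
      Good (fun _ => h) → Good (tr k l (fun _ => h)))) : Good n' := by
  refine comb_walk h lam hh Good H1 ?_ n n' hn hn' hg
  intro hgc hlam
  rcases H3 with H3 | H3
  · exact comb_B h lam hh Good H1 H2 hm hlam hgc n hn hg H3
  · exact fun k l hkl => H3 k l hkl hlam hgc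

end comb
end PR

namespace PR
set_option linter.all false

section gen
variable {K : Type} [Field K] [Fintype K] {p t m : ℕ} [Fact p.Prime] [CharP K p]
  [NeZero t] [Fact (Fintype.card K = p ^ t)]

theorem HT_mv (s : Fin t → ℕ) (a : Ex t m) (j : Fin t) (i i' : Ix m) (h : 1 ≤ a (j, i))
    (hs : HT p a s) : HT p (a - dl (j, i) + dl (j, i')) s := by
  intro j'
  have h1 := hs j'
  rw [← sub_dl_add a (j, i) h] at h1
  simp only [Pi.add_apply (a - dl (j, i)), Finset.sum_add_distrib, sum_dl] at h1 ⊢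
  exact h1

def opE (K : Type) [Field K] [Fintype K] (p : ℕ) {t m : ℕ} (T : Finset (Fin m)) (j : Fin t) :
    ((Ix m → K) → K) →ₗ[K] ((Ix m → K) → K) :=
  op p (T.map ⟨Sum.inl, Sum.inl_injective⟩) (T.map ⟨Sum.inr, Sum.inr_injective⟩) j

def opF (K : Type) [Field K] [Fintype K] (p : ℕ) {t m : ℕ} (k : Fin m) (j : Fin t) :
    ((Ix m → K) → K) →ₗ[K] ((Ix m → K) → K) :=
  op p {Sum.inr k} {Sum.inl k} j

def Clo (p t : ℕ) {m : ℕ} (G : Submodule K ((Ix m → K) → K)) : Prop :=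
  (∀ (T : Finset (Fin m)) (j : Fin t), ∀ f ∈ G, opE K p T j f ∈ G) ∧
  (∀ (k : Fin m) (j : Fin t), ∀ f ∈ G, opF K p k j f ∈ G)

variable (hp3 : 3 ≤ p) (G : Submodule K ((Ix m → K) → K)) (hG : Clo p t G) (s : Fin t → ℕ) (d : ℕ)
  (hd : d + ∑ j, s j = p * ∑ j, s j) (hFil : Fil K p t m d 1 ≤ G)
include hp3 hd hFil

theorem gE0 (T : Finset (Fin m)) (j : Fin t) (a : Ex t m) (ha : Rd p a) (hs : HT p a s) :
    opE K p T j (YJ K p (Jset m s) a) -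
      ∑ l ∈ T, ∑ k ∈ T, (if cnd p k l j a then YJ K p (Jset m s) (stp k l j a) else 0) ∈
      Fil K p t m d 1 := by
  have := op_YJ (K := K) hp3 s T j a ha hs
  rwa [show size a = d by have := HT_size a s hs; omega] at this

theorem gF0 (k : Fin m) (j : Fin t) (a : Ex t m) (ha : Rd p a) (hs : HT p a s) :
    opF K p k j (YJ K p (Jset m s) a) -
      (if cndF p k j a then ((a (j, Sum.inl k) : K) * (a (j, Sum.inr k) + 1)) •
        YJ K p (Jset m s) (stpF k j a) else 0) ∈ Fil K p t m d 1 := by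
  have := op_YJF (K := K) hp3 s k j a ha hs
  rwa [show size a = d by have := HT_size a s hs; omega] at this

theorem stp_stpF (k : Fin m) (j : Fin t) (a : Ex t m) (h : 1 ≤ a (j, Sum.inr k)) :
    stpF k j (stp k k j a) = a := by
  funext z
  simp only [stpF, stp, dl, Pi.add_apply, Pi.sub_apply, Pi.single_apply]
  by_cases h1 : z = (j, Sum.inr k)
  · subst h1
    simp
    omega
  · by_cases h2 : z = (j, Sum.inl k)
    · subst h2
      simp
    · simp [h1, h2]

theorem gD0 (k : Fin m) (j : Fin t) (a : Ex t m) (ha : Rd p a) (hs : HT p a s) :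
    opF K p k j (opE K p {k} j (YJ K p (Jset m s) a)) -
      ((a (j, Sum.inr k) : K) * (a (j, Sum.inl k) + 1)) • YJ K p (Jset m s) a ∈
      Fil K p t m d 1 := by
  have h1 := gE0 (K := K) hp3 G s d hd hFil {k} j a ha hs
  simp only [Finset.sum_singleton] at h1
  have h2 := op_Fil hp3 {Sum.inr k} {Sum.inl k} j _ _ _ h1
  rw [← opF, map_sub] at h2
  rw [← sub_add_sub_cancel]
  refine Submodule.add_mem _ h2 ?_
  have hx := ha (j, Sum.inl k)
  have hb := ha (j, Sum.inr k)
  by_cases hc : cnd p k k j a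
  · rw [if_pos hc]
    have h3 := gF0 (K := K) hp3 G s d hd hFil k j (stp k k j a) (cnd_rd k k j a ha hc.1) (HT_mv s a j _ _ hc.2 hs)
    have e1 : stp k k j a (j, Sum.inl k) = a (j, Sum.inl k) + 1 := by
      simp [stp, dl, Pi.single_apply]
    have e2 : stp k k j a (j, Sum.inr k) = a (j, Sum.inr k) - 1 := by
      simp [stp, dl, Pi.single_apply]
    have e3 : ((a (j, Sum.inr k) - 1 : ℕ) : K) + 1 = a (j, Sum.inr k) := by
      exact_mod_cast congrArg (Nat.cast (R := K)) (Nat.sub_add_cancel hc.2)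
    rw [stp_stpF hp3 G s d hd hFil k j a hc.2, if_pos ⟨by omega, by have := hc.2; omega⟩, e1, e2, e3] at h3
    convert h3 using 3
    push_cast
    ring
  · rw [if_neg hc]
    have : ((a (j, Sum.inr k) : K) * (a (j, Sum.inl k) + 1)) = 0 := by
      by_cases hb0 : a (j, Sum.inr k) = 0
      · simp [hb0]
      · have : a (j, Sum.inl k) + 1 = p := by
          unfold cnd at hc
          omega
        have h5 : (a (j, Sum.inl k) : K) + 1 = 0 := by
          rw [← CharP.cast_eq_zero K p, ← this]
          push_cast
          ring
        rw [h5, mul_zero]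
    rw [this]
    simp

include hG

theorem gE (k : Fin m) (j : Fin t) (a : Ex t m) (ha : Rd p a) (hs : HT p a s)
    (hY : YJ K p (Jset m s) a ∈ G) (hc : cnd p k k j a) : YJ K p (Jset m s) (stp k k j a) ∈ G := by
  have h1 := hFil (gE0 (K := K) hp3 G s d hd hFil {k} j a ha hs)
  simp only [Finset.sum_singleton, if_pos hc] at h1
  have h2 := hG.1 {k} j _ hY
  have := Submodule.sub_mem _ h2 h1
  simpa using this

theorem gF (k : Fin m) (j : Fin t) (a : Ex t m) (ha : Rd p a) (hs : HT p a s)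
    (hY : YJ K p (Jset m s) a ∈ G) (hc : cndF p k j a) : YJ K p (Jset m s) (stpF k j a) ∈ G := by
  have h1 := hFil (gF0 (K := K) hp3 G s d hd hFil k j a ha hs)
  rw [if_pos hc] at h1
  have h2 := hG.2 k j _ hY
  have := Submodule.sub_mem _ h2 h1
  rw [sub_sub_cancel] at this
  refine (Submodule.smul_mem_iff _ ?_).1 this
  refine mul_ne_zero (nat_ne (p := p) _ (ha _) hc.1) ?_
  have := nat_ne (K := K) (p := p) _ hc.2 (by omega)
  exact_mod_cast this

theorem gS (k l : Fin m) (hkl : k ≠ l) (j : Fin t) (a : Ex t m) (ha : Rd p a) (hs : HT p a s)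
    (hY : YJ K p (Jset m s) a ∈ G) :
    (if cnd p k l j a then YJ K p (Jset m s) (stp k l j a) else 0) +
    (if cnd p l k j a then YJ K p (Jset m s) (stp l k j a) else 0) ∈ G := by
  have h1 := hFil (gE0 (K := K) hp3 G s d hd hFil {k, l} j a ha hs)
  have h2 := hFil (gE0 (K := K) hp3 G s d hd hFil {k} j a ha hs)
  have h3 := hFil (gE0 (K := K) hp3 G s d hd hFil {l} j a ha hs)
  have h1' := Submodule.sub_mem _ (hG.1 {k, l} j _ hY) h1
  have h2' := Submodule.sub_mem _ (hG.1 {k} j _ hY) h2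
  have h3' := Submodule.sub_mem _ (hG.1 {l} j _ hY) h3
  rw [sub_sub_cancel] at h1' h2' h3'
  rw [Finset.sum_pair hkl, Finset.sum_pair hkl, Finset.sum_pair hkl] at h1'
  simp only [Finset.sum_singleton] at h2' h3'
  have := Submodule.sub_mem _ (Submodule.sub_mem _ h1' h2') h3'
  convert this using 1
  abel

theorem gSep (k : Fin m) (j : Fin t) (a a' : Ex t m) (ha : Rd p a) (hs : HT p a s)
    (ha' : Rd p a') (hs' : HT p a' s)
    (hY : YJ K p (Jset m s) a + YJ K p (Jset m s) a' ∈ G)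
    (hne : ((a (j, Sum.inr k) : K) * (a (j, Sum.inl k) + 1)) ≠
      ((a' (j, Sum.inr k) : K) * (a' (j, Sum.inl k) + 1))) : YJ K p (Jset m s) a ∈ G := by
  have h1 := hFil (gD0 (K := K) hp3 G s d hd hFil k j a ha hs)
  have h2 := hFil (gD0 (K := K) hp3 G s d hd hFil k j a' ha' hs')
  have h3 := hG.2 k j _ (hG.1 {k} j _ hY)
  rw [map_add, map_add] at h3
  have h4 := Submodule.sub_mem _ h3 (Submodule.add_mem _ h1 h2)
  have h5 := Submodule.sub_mem _ h4 (Submodule.smul_mem _ ((a' (j, Sum.inr k) : K) * (a' (j, Sum.inl k) + 1)) hY)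
  rw [← Submodule.smul_mem_iff _ (sub_ne_zero.2 hne)]
  convert h5 using 1
  rw [sub_smul, smul_add]
  abel

theorem gEF (a a' : Ex t m) (ha : Rd p a) (hs : HT p a s)
    (ha' : Rd p a') (hY : YJ K p (Jset m s) a ∈ G)
    (hpd : ∀ j k, a (j, Sum.inl k) + a (j, Sum.inr k) = a' (j, Sum.inl k) + a' (j, Sum.inr k)) :
    YJ K p (Jset m s) a' ∈ G := by
  induction hdd : ∑ jk : Fin t × Fin m, ((a (jk.1, Sum.inl jk.2) - a' (jk.1, Sum.inl jk.2)) +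
    (a' (jk.1, Sum.inl jk.2) - a (jk.1, Sum.inl jk.2))) using Nat.strong_induction_on generalizing a with
  | _ e ih =>
    by_cases heq : ∀ j k, a (j, Sum.inl k) = a' (j, Sum.inl k)
    · have : a = a' := by
        funext ⟨j, i⟩
        rcases i with k | k
        · exact heq j k
        · have h1 := hpd j k
          have h2 := heq j k
          omega
      rw [← this]; exact hY
    · push Not at heq
      obtain ⟨j, k, hjk⟩ := heq
      have hb := hpd j k
      have r1 := ha (j, Sum.inl k)
      have r2 := ha (j, Sum.inr k)
      have r3 := ha' (j, Sum.inl k)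
      have r4 := ha' (j, Sum.inr k)
      rcases Nat.lt_or_gt_of_ne hjk with hlt | hgt
      · have hc : cnd p k k j a := ⟨by omega, by omega⟩
        have hn := gE hp3 G hG s d hd hFil k j a ha hs hY hc
        refine ih _ ?_ (stp k k j a) (cnd_rd k k j a ha hc.1) (HT_mv s a j _ _ hc.2 hs) hn ?_ rfl
        · rw [← hdd]
          refine Finset.sum_lt_sum (fun jk _ => ?_) ⟨(j, k), Finset.mem_univ _, ?_⟩
          · obtain ⟨j', k'⟩ := jk
            by_cases he : j' = j ∧ k' = k
            · obtain ⟨rfl, rfl⟩ := he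
              simp only [stp, dl, Pi.add_apply, Pi.sub_apply, Pi.single_apply]
              simp
              omega
            · simp [stp, dl, Pi.single_apply, he]
          · simp [stp, dl, Pi.single_apply]
            omega
        · intro j' k'
          rw [← hpd j' k']
          by_cases he : j' = j ∧ k' = k
          · obtain ⟨rfl, rfl⟩ := he
            simp [stp, dl, Pi.single_apply]
            omega
          · simp [stp, dl, Pi.single_apply, he]
      · have hc : cndF p k j a := ⟨by omega, by omega⟩
        have hn := gF hp3 G hG s d hd hFil k j a ha hs hY hc
        refine ih _ ?_ (stpF k j a) (cndF_rd k j a ha hc.2) (HT_mv s a j _ _ hc.1 hs) hn ?_ rfl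
        · rw [← hdd]
          refine Finset.sum_lt_sum (fun jk _ => ?_) ⟨(j, k), Finset.mem_univ _, ?_⟩
          · obtain ⟨j', k'⟩ := jk
            by_cases he : j' = j ∧ k' = k
            · obtain ⟨rfl, rfl⟩ := he
              simp only [stpF, dl, Pi.add_apply, Pi.sub_apply, Pi.single_apply]
              simp
              omega
            · simp [stpF, dl, Pi.single_apply, he]
          · simp [stpF, dl, Pi.single_apply]
            omega
        · intro j' k'
          rw [← hpd j' k']
          by_cases he : j' = j ∧ k' = k
          · obtain ⟨rfl, rfl⟩ := he
            simp [stpF, dl, Pi.single_apply]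
            omega
          · simp [stpF, dl, Pi.single_apply, he]

end gen
end PR

namespace PR
set_option linter.all false

section gen
variable {K : Type} [Field K] [Fintype K] {p t m : ℕ} [Fact p.Prime] [CharP K p]
  [NeZero t] [Fact (Fintype.card K = p ^ t)]

/-- replace level `j` of `a` by the canonical exponents with pair degrees `n`. -/
def upd (p : ℕ) {t m : ℕ} (a : Ex t m) (j : Fin t) (n : Fin m → ℕ) : Ex t m := fun z =>
  if z.1 = j then Sum.elim (fun k => n k - (p - 1)) (fun k => min (n k) (p - 1)) z.2 else a z

theorem upd_inl (a : Ex t m) (j : Fin t) (n : Fin m → ℕ) (k : Fin m) :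
    upd p a j n (j, Sum.inl k) = n k - (p - 1) := by simp [upd]

theorem upd_inr (a : Ex t m) (j : Fin t) (n : Fin m → ℕ) (k : Fin m) :
    upd p a j n (j, Sum.inr k) = min (n k) (p - 1) := by simp [upd]

theorem upd_ne (a : Ex t m) (j j' : Fin t) (n : Fin m → ℕ) (i : Ix m) (h : j' ≠ j) :
    upd p a j n (j', i) = a (j', i) := by simp [upd, h]

theorem upd_rd (a : Ex t m) (j : Fin t) (n : Fin m → ℕ) (ha : Rd p a)
    (hn : ∀ k, n k ≤ 2 * (p - 1)) : Rd p (upd p a j n) := by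
  have hp : 2 ≤ p := (Fact.out : p.Prime).two_le
  rintro ⟨j', i⟩
  by_cases h : j' = j
  · subst h
    rcases i with k | k
    · rw [upd_inl]; have := hn k; omega
    · rw [upd_inr]; omega
  · rw [upd_ne _ _ _ _ _ h]; exact ha _

theorem upd_HT (s : Fin t → ℕ) (a : Ex t m) (j : Fin t) (n : Fin m → ℕ) (hs : HT p a s)
    (hn : ∑ k, n k = ∑ i, a (j, i)) : HT p (upd p a j n) s := by
  intro j'
  rw [← hs j']
  congr 1
  by_cases h : j' = j
  · subst h
    rw [← hn, Fintype.sum_sum_type, ← Finset.sum_add_distrib]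
    refine Finset.sum_congr rfl fun k _ => ?_
    rw [upd_inl, upd_inr]; omega
  · exact Finset.sum_congr rfl fun i _ => upd_ne _ _ _ _ _ h

variable (hp3 : 3 ≤ p) (G : Submodule K ((Ix m → K) → K)) (hG : Clo p t G) (s : Fin t → ℕ) (d : ℕ)
  (hd : d + ∑ j, s j = p * ∑ j, s j) (hFil : Fil K p t m d 1 ≤ G)
include hp3 hd hFil hG

theorem stp_pd (k l : Fin m) (hkl : k ≠ l) (j : Fin t) (a : Ex t m) (n : Fin m → ℕ)
    (hl : 1 ≤ n l) (j' : Fin t) (k' : Fin m) :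
    stp k l j (upd p a j n) (j', Sum.inl k') + stp k l j (upd p a j n) (j', Sum.inr k') =
    upd p a j (tr k l n) (j', Sum.inl k') + upd p a j (tr k l n) (j', Sum.inr k') := by
  by_cases h : j' = j
  · subst h
    simp only [stp, dl, Pi.add_apply, Pi.sub_apply, Pi.single_apply, upd_inl, upd_inr, tr,
      Prod.mk.injEq, true_and, Sum.inl.injEq, Sum.inr.injEq, reduceCtorEq, if_false]
    split_ifs with h1 h2 h2
    · exact absurd (h1.symm.trans h2) hkl
    · omega
    · subst h2; omega
    · omega
  · simp [stp, dl, Pi.single_apply, upd_ne _ _ _ _ _ h, h]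

theorem gStep (hm : 2 ≤ m) (j : Fin t) (a : Ex t m) (ha : Rd p a) (hs : HT p a s)
    (n n' : Fin m → ℕ) (hn : Vl (p - 1) (∑ i, a (j, i)) n) (hn' : Vl (p - 1) (∑ i, a (j, i)) n')
    (hg : YJ K p (Jset m s) (upd p a j n) ∈ G)
    (H3 : n ≠ (fun _ => p - 1) ∨ j ∈ Jset m s) : YJ K p (Jset m s) (upd p a j n') ∈ G := by
  have hR : ∀ n, Vl (p - 1) (∑ i, a (j, i)) n → Rd p (upd p a j n) := fun n h => upd_rd a j n ha h.1
  have hH : ∀ n, Vl (p - 1) (∑ i, a (j, i)) n → HT p (upd p a j n) s :=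
    fun n h => upd_HT s a j n hs h.2
  have hcn : ∀ n k l, Vl (p - 1) (∑ i, a (j, i)) n → 1 ≤ n l → n k + 1 ≤ 2 * (p - 1) →
      cnd p k l j (upd p a j n) := by
    intro n k l hn hl hk
    refine ⟨?_, ?_⟩
    · rw [upd_inl]; omega
    · rw [upd_inr]; omega
  have hcn' : ∀ n k l, Vl (p - 1) (∑ i, a (j, i)) n → cnd p k l j (upd p a j n) →
      1 ≤ n l ∧ n k + 1 ≤ 2 * (p - 1) := by
    intro n k l hn h
    have h1 := h.1
    have h2 := h.2
    rw [upd_inl] at h1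
    rw [upd_inr] at h2
    omega
  have hst : ∀ n k l, k ≠ l → Vl (p - 1) (∑ i, a (j, i)) n → cnd p k l j (upd p a j n) →
      YJ K p (Jset m s) (stp k l j (upd p a j n)) ∈ G →
      YJ K p (Jset m s) (upd p a j (tr k l n)) ∈ G := by
    intro n k l hkl hn hc hY
    obtain ⟨h1, h2⟩ := hcn' n k l hn hc
    exact gEF hp3 G hG s d hd hFil (stp k l j (upd p a j n)) _
      (cnd_rd k l j _ (hR n hn) hc.1) (HT_mv s _ j _ _ hc.2 (hH n hn))
      (hR _ (tr_vl _ _ k l n hkl hn h1 h2)) hY (stp_pd hp3 G hG s d hd hFil k l hkl j a n h1)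
  have hst' : ∀ n k l, k ≠ l → Vl (p - 1) (∑ i, a (j, i)) n → cnd p k l j (upd p a j n) →
      YJ K p (Jset m s) (upd p a j (tr k l n)) ∈ G →
      YJ K p (Jset m s) (stp k l j (upd p a j n)) ∈ G := by
    intro n k l hkl hn hc hY
    obtain ⟨h1, h2⟩ := hcn' n k l hn hc
    have hv := tr_vl _ _ k l n hkl hn h1 h2
    exact gEF hp3 G hG s d hd hFil _ (stp k l j (upd p a j n)) 
      (hR _ hv) (hH _ hv) (cnd_rd k l j _ (hR n hn) hc.1)
      hY (fun j' k' => (stp_pd hp3 G hG s d hd hFil k l hkl j a n h1 j' k').symm)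
  refine comb_main (p - 1) (∑ i, a (j, i)) (by omega)
    (fun n => YJ K p (Jset m s) (upd p a j n) ∈ G) ?_ ?_ hm n n' hn hn' hg ?_
  · intro n k l hkl hn hg hl hk hne
    have hc := hcn n k l hn hl hk
    apply hst n k l hkl hn hc
    have hS := gS hp3 G hG s d hd hFil k l hkl j _ (hR n hn) (hH n hn) hg
    rw [if_pos hc] at hS
    by_cases hc' : cnd p l k j (upd p a j n)
    · rw [if_pos hc'] at hS
      obtain ⟨q1, q2⟩ := hcn' n l k hn hc'
      have key : ∀ x : ℕ, x ≠ p - 1 → x + 1 ≤ 2 * (p - 1) → ((x : K) + 1) ≠ 0 := by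
        intro x hx hx'
        have : ((x + 1 : ℕ) : K) ≠ 0 := by
          rw [Ne, CharP.cast_eq_zero_iff K p]
          rintro ⟨c, hc⟩
          rcases c with _ | _ | c
          · omega
          · omega
          · have : p * (c + 1 + 1) = p * c + 2 * p := by ring
            have : 0 ≤ p * c := Nat.zero_le _
            omega
        exact_mod_cast this
      have hsplit : ∀ k, ((n k - (p - 1) : ℕ) : K) + ((min (n k) (p - 1) : ℕ) : K) = (n k : K) := by
        intro k
        rw [← Nat.cast_add]
        congr 1
        omega
      by_cases hk' : n k = p - 1
      · have hl' : n l ≠ p - 1 := fun h => hne ⟨hk', h⟩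
        refine gSep hp3 G hG s d hd hFil l j _ _ (cnd_rd k l j _ (hR n hn) hc.1)
          (HT_mv s _ j _ _ hc.2 (hH n hn)) (cnd_rd l k j _ (hR n hn) hc'.1)
          (HT_mv s _ j _ _ hc'.2 (hH n hn)) hS ?_
        have e1 : stp k l j (upd p a j n) (j, Sum.inr l) = min (n l) (p - 1) - 1 := by
          simp [stp, dl, Pi.single_apply, upd_inr]
        have e2 : stp k l j (upd p a j n) (j, Sum.inl l) = n l - (p - 1) := by
          simp [stp, dl, Pi.single_apply, upd_inl, hkl.symm]
        have e3 : stp l k j (upd p a j n) (j, Sum.inr l) = min (n l) (p - 1) := by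
          simp [stp, dl, Pi.single_apply, upd_inr, hkl.symm]
        have e4 : stp l k j (upd p a j n) (j, Sum.inl l) = n l - (p - 1) + 1 := by
          simp [stp, dl, Pi.single_apply, upd_inl]
        rw [e1, e2, e3, e4]
        intro h
        apply key (n l) hl' q2
        rw [Nat.cast_sub (by omega)] at h
        rw [← hsplit l]
        push_cast at h ⊢
        linear_combination -h
      · refine gSep hp3 G hG s d hd hFil k j _ _ (cnd_rd k l j _ (hR n hn) hc.1)
          (HT_mv s _ j _ _ hc.2 (hH n hn)) (cnd_rd l k j _ (hR n hn) hc'.1)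
          (HT_mv s _ j _ _ hc'.2 (hH n hn)) hS ?_
        have e1 : stp k l j (upd p a j n) (j, Sum.inr k) = min (n k) (p - 1) := by
          simp [stp, dl, Pi.single_apply, upd_inr, hkl]
        have e2 : stp k l j (upd p a j n) (j, Sum.inl k) = n k - (p - 1) + 1 := by
          simp [stp, dl, Pi.single_apply, upd_inl]
        have e3 : stp l k j (upd p a j n) (j, Sum.inr k) = min (n k) (p - 1) - 1 := by
          simp [stp, dl, Pi.single_apply, upd_inr]
        have e4 : stp l k j (upd p a j n) (j, Sum.inl k) = n k - (p - 1) := by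
          simp [stp, dl, Pi.single_apply, upd_inl, hkl]
        rw [e1, e2, e3, e4]
        intro h
        apply key (n k) hk' hk
        rw [Nat.cast_sub (by omega)] at h
        rw [← hsplit k]
        push_cast at h ⊢
        linear_combination h
    · rw [if_neg hc', add_zero] at hS
      exact hS
  · intro n k l hkl hn hg hk hl hg'
    have hc := hcn n k l hn (by omega) (by omega)
    have hc' := hcn n l k hn (by omega) (by omega)
    apply hst n k l hkl hn hc
    have hS := gS hp3 G hG s d hd hFil k l hkl j _ (hR n hn) (hH n hn) hg
    rw [if_pos hc, if_pos hc'] at hS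
    have := hst' n l k hkl.symm hn hc' hg'
    simpa using Submodule.sub_mem _ hS this
  · rcases H3 with H3 | H3
    · exact Or.inl H3
    · right
      intro k l hkl hsum hg
      have hn : Vl (p - 1) (∑ i, a (j, i)) (fun _ => p - 1) := ⟨fun _ => by show p - 1 ≤ _; omega, hsum⟩
      have hc := hcn _ k l hn (by omega) (by omega)
      have hc' := hcn _ l k hn (by omega) (by omega)
      apply hst _ k l hkl hn hc
      have hS := gS hp3 G hG s d hd hFil k l hkl j _ (hR _ hn) (hH _ hn) hg
      rw [if_pos hc, if_pos hc'] at hS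
      have hfl : YJ K p (Jset m s) (stp l k j (upd p a j (fun _ => p - 1))) =
          YJ K p (Jset m s) (stp k l j (upd p a j (fun _ => p - 1))) := by
        rw [← YJ_flip (Jset m s) {j} (by simpa using H3) (stp k l j (upd p a j (fun _ => p - 1)))
          (cnd_rd k l j _ (hR _ hn) hc.1)]
        congr 1
        funext ⟨j', i⟩
        by_cases h : j' = j
        · subst h
          rcases i with i | i
          · simp only [flip, Finset.mem_singleton, if_true, Sum.swap_inl, stp, dl, Pi.add_apply, Pi.sub_apply,
              Pi.single_apply, upd_inl, upd_inr, Prod.mk.injEq, true_and, Sum.inl.injEq, Sum.inr.injEq,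
              reduceCtorEq, if_false]
            split_ifs <;> omega
          · simp only [flip, Finset.mem_singleton, if_true, Sum.swap_inr, stp, dl, Pi.add_apply, Pi.sub_apply,
              Pi.single_apply, upd_inl, upd_inr, Prod.mk.injEq, true_and, Sum.inl.injEq, Sum.inr.injEq,
              reduceCtorEq, if_false]
            split_ifs <;> omega
        · simp [flip, stp, dl, Pi.single_apply, h]
      rw [hfl, ← two_smul K] at hS
      refine (Submodule.smul_mem_iff _ ?_).1 hS
      have := nat_ne (K := K) (p := p) 2 (by omega) (by omega)
      exact_mod_cast this

theorem gLevel (hm : 2 ≤ m) (j : Fin t) (a a' : Ex t m) (ha : Rd p a) (hs : HT p a s)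
    (ha' : Rd p a') (hs' : HT p a' s) (heq : ∀ j' i, j' ≠ j → a (j', i) = a' (j', i))
    (hg : YJ K p (Jset m s) a ∈ G)
    (H3 : (∃ k, a (j, Sum.inl k) + a (j, Sum.inr k) ≠ p - 1) ∨ j ∈ Jset m s) :
    YJ K p (Jset m s) a' ∈ G := by
  have hsum : ∑ i, a (j, i) = ∑ i, a' (j, i) := by
    have h1 := hs j
    have h2 := hs' j
    omega
  have e1 : ∀ a : Ex t m, ∑ k, (a (j, Sum.inl k) + a (j, Sum.inr k)) = ∑ i, a (j, i) := by
    intro a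
    rw [Fintype.sum_sum_type, ← Finset.sum_add_distrib]
  have vn : Vl (p - 1) (∑ i, a (j, i)) (fun k => a (j, Sum.inl k) + a (j, Sum.inr k)) := by
    refine ⟨fun k => ?_, e1 a⟩
    have := ha (j, Sum.inl k)
    have := ha (j, Sum.inr k)
    show _ + _ ≤ _
    omega
  have vn' : Vl (p - 1) (∑ i, a (j, i)) (fun k => a' (j, Sum.inl k) + a' (j, Sum.inr k)) := by
    refine ⟨fun k => ?_, by rw [e1 a', hsum]⟩
    have := ha' (j, Sum.inl k)
    have := ha' (j, Sum.inr k)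
    show _ + _ ≤ _
    omega
  have u1 : YJ K p (Jset m s) (upd p a j (fun k => a (j, Sum.inl k) + a (j, Sum.inr k))) ∈ G := by
    refine gEF hp3 G hG s d hd hFil a _ ha hs (upd_rd a j _ ha vn.1) hg ?_
    intro j' k
    by_cases h : j' = j
    · subst h
      rw [upd_inl, upd_inr]
      omega
    · rw [upd_ne _ _ _ _ _ h, upd_ne _ _ _ _ _ h]
  have u2 := gStep hp3 G hG s d hd hFil hm j a ha hs _ _ vn vn' u1 (by
    rcases H3 with ⟨k, hk⟩ | H3
    · left
      intro h
      exact hk (congrFun h k)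
    · exact Or.inr H3)
  refine gEF hp3 G hG s d hd hFil _ a' (upd_rd a j _ ha vn'.1) (upd_HT s a j _ hs vn'.2) ha' u2 ?_
  intro j' k
  by_cases h : j' = j
  · subst h
    rw [upd_inl, upd_inr]
    omega
  · rw [upd_ne _ _ _ _ _ h, upd_ne _ _ _ _ _ h, heq _ _ h, heq _ _ h]

theorem gGen (hm : 2 ≤ m) (a a' : Ex t m) (ha : Rd p a) (hs : HT p a s)
    (ha' : Rd p a') (hs' : HT p a' s) 
    (hg : YJ K p (Jset m s) a ∈ G)
    (H3 : ∀ j, (∃ k, a (j, Sum.inl k) + a (j, Sum.inr k) ≠ p - 1) ∨ j ∈ Jset m s) :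
    YJ K p (Jset m s) a' ∈ G := by
  have mrd : ∀ S : Finset (Fin t), Rd p (fun z => if z.1 ∈ S then a' z else a z) := by
    intro S z
    show (if _ then _ else _) < p
    split_ifs
    · exact ha' z
    · exact ha z
  have mht : ∀ S : Finset (Fin t), HT p (fun z : Fin t × Ix m => if z.1 ∈ S then a' z else a z) s := by
    intro S j
    by_cases h : j ∈ S
    · simpa [h] using hs' j
    · simpa [h] using hs j
  have : ∀ S : Finset (Fin t), YJ K p (Jset m s) (fun z => if z.1 ∈ S then a' z else a z) ∈ G := by
    intro S
    induction S using Finset.induction_on with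
    | empty => simpa using hg
    | insert j S hj ih =>
      refine gLevel hp3 G hG s d hd hFil hm j _ _ (mrd S) (mht S) (mrd _) (mht _) ?_ ih ?_
      · intro j' i h
        simp [h]
      · simpa [hj] using H3 j
  simpa using this Finset.univ

end gen
end PR

namespace PR
set_option linter.all false

section exact
variable {K : Type} [Field K] [Fintype K] {p t m : ℕ} [Fact p.Prime] [CharP K p]
  [NeZero t] [Fact (Fintype.card K = p ^ t)]

theorem geo (p : ℕ) (hp : 1 ≤ p) (n : ℕ) : ∑ l ∈ Finset.range n, p ^ l * (p - 1) + 1 = p ^ n := by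
  induction n with
  | zero => simp
  | succ n ih =>
    rw [Finset.sum_range_succ, pow_succ]
    have : p ^ n * p = p ^ n * (p - 1) + p ^ n := by
      rw [← Nat.mul_succ]
      congr 1
      omega
    omega

theorem geo_lt (p t : ℕ) (hp : 1 ≤ p) (j : Fin t) :
    ∑ l : Fin t, (if l < j then p ^ (l : ℕ) * (p - 1) else 0) + 1 = p ^ (j : ℕ) := by
  rw [← geo p hp j]
  congr 1
  have h1 : ∑ l : Fin t, (if l < j then p ^ (l : ℕ) * (p - 1) else 0) =
    ∑ l : Fin t, (fun l : ℕ => if l < j then p ^ (l : ℕ) * (p - 1) else 0) l :=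
    Finset.sum_congr rfl fun l _ => rfl
  rw [h1, Fin.sum_univ_eq_sum_range (fun l : ℕ => if l < j then p ^ (l : ℕ) * (p - 1) else 0),
    ← Finset.sum_filter]
  refine Finset.sum_congr ?_ fun _ _ => rfl
  ext x
  simp only [Finset.mem_filter, Finset.mem_range]
  have := j.2
  omega

theorem geo_univ (p t : ℕ) (hp : 1 ≤ p) : ∑ l : Fin t, p ^ (l : ℕ) * (p - 1) + 1 = p ^ t := by
  rw [← geo p hp t, Fin.sum_univ_eq_sum_range (fun l => p ^ l * (p - 1))]

theorem dig1 (n : Fin t → ℕ) (j : Fin t) (hn : ∀ l, l ≠ j → n l ≤ p - 1)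
    (hw : ∑ l : Fin t, p ^ (l : ℕ) * n l = p ^ (j : ℕ)) : n = Pi.single j 1 := by
  have hp : 2 ≤ p := (Fact.out : p.Prime).two_le
  have hpos : ∀ l : ℕ, 0 < p ^ l := fun l => Nat.pow_pos (by omega)
  by_cases h0 : n j = 0
  · exfalso
    have h1 : ∑ l : Fin t, p ^ (l : ℕ) * n l ≤ ∑ l : Fin t, (if l < j then p ^ (l : ℕ) * (p - 1) else 0) := by
      refine Finset.sum_le_sum fun l _ => ?_
      split_ifs with hl
      · exact Nat.mul_le_mul_left _ (hn l hl.ne)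
      · by_cases hlj : l = j
        · subst hlj
          simp [h0]
        · have hlt : j < l := lt_of_le_of_ne (not_lt.1 hl) (Ne.symm hlj)
          have h2 : p ^ (l : ℕ) * n l ≤ p ^ (j : ℕ) := by
            rw [← hw]
            exact Finset.single_le_sum (f := fun l : Fin t => p ^ (l : ℕ) * n l)
              (fun _ _ => Nat.zero_le _) (Finset.mem_univ l)
          have h3 : p ^ (j : ℕ) < p ^ (l : ℕ) := Nat.pow_lt_pow_right (by omega) hlt
          have : n l = 0 := by
            by_contra hc
            have : p ^ (l : ℕ) * 1 ≤ p ^ (l : ℕ) * n l := Nat.mul_le_mul_left _ (by omega)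
            omega
          simp [this]
    have := geo_lt p t (by omega) j
    omega
  · have h1 : ∑ l ∈ Finset.univ.erase j, p ^ (l : ℕ) * n l + p ^ (j : ℕ) * n j = p ^ (j : ℕ) := by
      exact (Finset.sum_erase_add (f := fun l : Fin t => p ^ (l : ℕ) * n l) _ (Finset.mem_univ j)).trans hw
    have h2 : p ^ (j : ℕ) * 1 ≤ p ^ (j : ℕ) * n j := Nat.mul_le_mul_left _ (by omega)
    have h3 : n j = 1 := by
      have : p ^ (j : ℕ) * n j = p ^ (j : ℕ) * 1 := by omega
      exact Nat.eq_of_mul_eq_mul_left (hpos _) this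
    have h4 : ∑ l ∈ Finset.univ.erase j, p ^ (l : ℕ) * n l = 0 := by
      rw [h3] at h1
      omega
    rw [Finset.sum_eq_zero_iff] at h4
    funext l
    by_cases hl : l = j
    · subst hl
      simp [h3]
    · rw [Pi.single_eq_of_ne hl]
      have := h4 l (by simp [hl])
      rcases Nat.mul_eq_zero.1 this with h | h
      · have := hpos l; omega
      · exact h

theorem wt_supp (n : Ex t m) (i : Ix m) (h : ∀ z, n z ≠ 0 → z.2 = i) :
    wt p n = ∑ l : Fin t, p ^ (l : ℕ) * n (l, i) := by
  rw [wt, Fintype.sum_prod_type]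
  refine Finset.sum_congr rfl fun l _ => ?_
  rw [Finset.sum_eq_single i]
  · intro i' _ hi'
    have : n (l, i') = 0 := by
      by_contra hc
      exact hi' (h _ hc)
    simp [this]
  · simp

theorem size_supp (n : Ex t m) (i : Ix m) (h : ∀ z, n z ≠ 0 → z.2 = i) :
    size n = ∑ l : Fin t, n (l, i) := by
  rw [size, Fintype.sum_prod_type]
  refine Finset.sum_congr rfl fun l _ => ?_
  rw [Finset.sum_eq_single i]
  · intro i' _ hi'
    by_contra hc
    exact hi' (h _ hc)
  · simp

theorem adm_cases (hp3 : 3 ≤ p) (i : Ix m) (j : Fin t) (N n : Ex t m)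
    (h1 : ∀ l, l ≠ j → N (l, i) ≤ p - 1) (h2 : N (j, i) ≤ p) (hn : n ∈ adm p {i} j N) :
    n = dl (j, i) ∨ (N (j, i) = p ∧ size n = t * (p - 1) + 1) := by
  have hj := pj_lt hp3 j
  simp only [adm, Finset.mem_filter, mem_box, Finset.mem_singleton] at hn
  obtain ⟨hle, hsup, e, he⟩ := hn
  have hpos : ∀ l : ℕ, 0 < p ^ l := fun l => Nat.pow_pos (by omega)
  rw [wt_supp n i hsup] at he
  have hb : ∀ l : Fin t, p ^ (l : ℕ) * n (l, i) ≤ p ^ (l : ℕ) * (p - 1) + (if l = j then p ^ (j : ℕ) else 0) := by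
    intro l
    split_ifs with h
    · subst h
      rw [← Nat.mul_succ]
      refine Nat.mul_le_mul_left _ ((hle _).trans ?_)
      show _ ≤ p - 1 + 1; omega
    · exact Nat.mul_le_mul_left _ ((hle _).trans (h1 l h))
  have hs : ∑ l : Fin t, (p ^ (l : ℕ) * (p - 1) + (if l = j then p ^ (j : ℕ) else 0)) =
      p ^ t - 1 + p ^ (j : ℕ) := by
    rw [Finset.sum_add_distrib, Finset.sum_ite_eq' Finset.univ j, if_pos (Finset.mem_univ _)]
    have := geo_univ p t (by omega)
    omega
  have hle2 := Finset.sum_le_sum (fun l (_ : l ∈ Finset.univ) => hb l)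
  rw [hs] at hle2
  have hpj := hpos j
  rcases e with _ | _ | _ | e
  · omega
  · left
    have := dig1 (p := p) (fun l => n (l, i)) j (fun l hl => (hle _).trans (h1 l hl)) (by omega)
    funext ⟨l, i'⟩
    by_cases hi : i' = i
    · subst hi
      rw [show n (l, i') = _ from congrFun this l]
      simp [dl, Pi.single_apply]
    · have : n (l, i') = 0 := by
        by_contra hc
        exact hi (hsup _ hc)
      simp [dl, Pi.single_apply, hi, this]
  · right
    have heq : ∑ l : Fin t, p ^ (l : ℕ) * n (l, i) =
      ∑ l : Fin t, (p ^ (l : ℕ) * (p - 1) + (if l = j then p ^ (j : ℕ) else 0)) := by omega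
    have hall := (Finset.sum_eq_sum_iff_of_le (fun l _ => hb l)).1 heq
    have hval : ∀ l, n (l, i) = (p - 1) + (if l = j then 1 else 0) := by
      intro l
      have := hall l (Finset.mem_univ _)
      apply Nat.eq_of_mul_eq_mul_left (hpos l)
      rw [this, mul_add]
      split_ifs with h
      · subst h; ring
      · simp
    constructor
    · have := hval j
      have := hle (j, i)
      simp at *
      omega
    · rw [size_supp n i hsup]
      simp only [hval, Finset.sum_add_distrib]
      simp
  · exfalso
    have : (p ^ t - 1) * (e + 1 + 1 + 1) = (p ^ t - 1) * e + 3 * (p ^ t - 1) := by ring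
    have : 0 ≤ (p ^ t - 1) * e := Nat.zero_le _
    omega

theorem op_exact (hp3 : 3 ≤ p) (i k : Ix m) (j : Fin t) (N : Ex t m)
    (h1 : ∀ l, N (l, i) ≤ p - 1) :
    op p {k} {i} j (mono K p N) = (N (j, i) : K) • mono K p (N - dl (j, i) + dl (j, k)) := by
  rw [op_mono hp3]
  have hsub : ∀ n ∈ adm p {i} j N, n = dl (j, i) := by
    intro n hn
    rcases adm_cases hp3 i j N n (fun l _ => h1 l) (by have := h1 j; omega) hn with h | h
    · exact h
    · have := h1 j; omega
  by_cases h0 : N (j, i) = 0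
  · rw [h0, Finset.sum_eq_zero]
    · simp
    · intro n hn
      have e := hsub n hn
      subst e
      rw [adm_dl hp3] at hn
      exact absurd h0 hn.2.2
  · have : adm p {i} j N = {dl (j, i)} := by
      ext n
      rw [Finset.mem_singleton]
      constructor
      · exact hsub n
      · rintro rfl
        rw [adm_dl hp3]
        exact ⟨rfl, by simp, h0⟩
    rw [this]
    simp [cf_dl]

theorem op_near (hp3 : 3 ≤ p) (i k : Ix m) (j : Fin t) (N : Ex t m)
    (h1 : ∀ l, l ≠ j → N (l, i) ≤ p - 1) (h2 : N (j, i) = p) :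
    op p {k} {i} j (mono K p N) ∈ Fil K p t m (size N) (t * (p - 1)) := by
  rw [op_mono hp3]
  refine Submodule.sum_mem _ fun n hn => ?_
  have hle : n ≤ N := (mem_box _ _).1 (Finset.mem_filter.1 hn).1
  rcases adm_cases hp3 i j N n h1 (by omega) hn with h | h
  · subst h
    rw [cf_dl, h2]
    simp
  · refine Submodule.smul_mem _ _ ?_
    simp only [Finset.sum_singleton]
    apply mono_mem_Fil
    rw [size_add, size_dl]
    have := size_sub N n hle
    omega

theorem opE_single (k : Fin m) (j : Fin t) :
    opE K p {k} j = op p {Sum.inl k} {Sum.inr k} j := by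
  simp [opE]

theorem E_mono (hp3 : 3 ≤ p) (k : Fin m) (j : Fin t) (a : Ex t m) (ha : Rd p a) :
    opE K p {k} j (mono K p a) = (a (j, Sum.inr k) : K) • mono K p (stp k k j a) := by
  rw [opE_single, op_exact hp3 _ _ _ _ (fun l => by have := ha (l, Sum.inr k); omega)]
  rfl

theorem FE_mono (hp3 : 3 ≤ p) (k : Fin m) (j : Fin t) (a : Ex t m) (ha : Rd p a) :
    opF K p k j (opE K p {k} j (mono K p a)) -
      ((a (j, Sum.inr k) : K) * (a (j, Sum.inl k) + 1)) • mono K p a ∈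
        Fil K p t m (size a) (t * (p - 1)) := by
  rw [E_mono hp3 k j a ha, map_smul]
  by_cases hb : a (j, Sum.inr k) = 0
  · simp [hb]
  have hsz : size (stp k k j a) = size a := by
    rw [stp, size_add, size_dl]
    have := size_sub a (dl (j, Sum.inr k)) ((dl_le _ _).2 (by omega))
    rw [size_dl] at this
    omega
  have e1 : stp k k j a (j, Sum.inl k) = a (j, Sum.inl k) + 1 := by
    simp [stp, dl, Pi.single_apply]
  have e2 : ∀ l, l ≠ j → stp k k j a (l, Sum.inl k) = a (l, Sum.inl k) := by
    intro l hl
    simp [stp, dl, Pi.single_apply, hl]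
  by_cases hx : a (j, Sum.inl k) + 1 = p
  · have h5 : (a (j, Sum.inl k) : K) + 1 = 0 := by
      have : ((a (j, Sum.inl k) + 1 : ℕ) : K) = 0 := (CharP.cast_eq_zero_iff K p _).2 ⟨1, by omega⟩
      exact_mod_cast this
    rw [h5, mul_zero, zero_smul, sub_zero]
    refine Submodule.smul_mem _ _ ?_
    have := op_near (K := K) hp3 (Sum.inl k) (Sum.inr k) j (stp k k j a) (fun l hl => by
      rw [e2 l hl]; have := ha (l, Sum.inl k); omega) (by rw [e1, hx])
    rw [hsz] at this
    exact this
  · have hF : opF K p k j (mono K p (stp k k j a)) =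
        ((stp k k j a (j, Sum.inl k) : ℕ) : K) • mono K p (stpF k j (stp k k j a)) :=
      op_exact hp3 (Sum.inl k) (Sum.inr k) j (stp k k j a) (fun l => by
        by_cases hl : l = j
        · subst hl
          rw [e1]; have := ha (l, Sum.inl k); omega
        · rw [e2 l hl]; have := ha (l, Sum.inl k); omega)
    have hss : stpF k j (stp k k j a) = a := by
      funext z
      simp only [stpF, stp, dl, Pi.add_apply, Pi.sub_apply, Pi.single_apply]
      by_cases h1 : z = (j, Sum.inr k)
      · subst h1
        simp
        omega
      · by_cases h2 : z = (j, Sum.inl k)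
        · subst h2
          simp
        · simp [h1, h2]
    rw [hF, hss, e1, smul_smul]
    push_cast
    simp

/-- the operator `FE`. -/
def opD (K : Type) [Field K] [Fintype K] (p : ℕ) {t m : ℕ} (k : Fin m) (j : Fin t) :
    ((Ix m → K) → K) →ₗ[K] ((Ix m → K) → K) := opF K p k j ∘ₗ opE K p {k} j

theorem opD_Fil (hp3 : 3 ≤ p) (k : Fin m) (j : Fin t) (d z : ℕ) (f : (Ix m → K) → K)
    (hf : f ∈ Fil K p t m d z) : opD K p k j f ∈ Fil K p t m d z :=
  op_Fil hp3 _ _ j d z _ (op_Fil hp3 _ _ j d z f hf)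

theorem opD_pow (hp3 : 3 ≤ p) (k : Fin m) (j : Fin t) (a : Ex t m) (ha : Rd p a) (n : ℕ) :
    ((opD K p k j) ^ n) (mono K p a) - (((a (j, Sum.inr k) : K) * (a (j, Sum.inl k) + 1)) ^ n) • mono K p a ∈
        Fil K p t m (size a) (t * (p - 1)) := by
  induction n with
  | zero => simp
  | succ n ih =>
    have h1 := opD_Fil hp3 k j _ _ _ ih
    have h2 := FE_mono (K := K) hp3 k j a ha
    have h3 := Submodule.smul_mem _ (((a (j, Sum.inr k) : K) * (a (j, Sum.inl k) + 1)) ^ n) h2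
    have h4 := Submodule.add_mem _ h1 h3
    convert h4 using 1
    rw [pow_succ', Module.End.mul_apply, map_sub, map_smul, smul_sub, smul_smul, ← pow_succ]
    have : opF K p k j (opE K p {k} j (mono K p a)) = opD K p k j (mono K p a) := rfl
    rw [this]
    abel

def opT (K : Type) [Field K] [Fintype K] (p : ℕ) {t m : ℕ} (k : Fin m) (j : Fin t) :
    ((Ix m → K) → K) →ₗ[K] ((Ix m → K) → K) :=
  opE K p {k} j ∘ₗ (LinearMap.id - (opD K p k j) ^ (p - 1))

theorem nat_pow_p (n : ℕ) (h : (n : K) ≠ 0) : (n : K) ^ (p - 1) = 1 := by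
  have h1 : ((n : ZMod p)) ≠ 0 := by
    intro hc
    rw [ZMod.natCast_eq_zero_iff] at hc
    exact h ((CharP.cast_eq_zero_iff K p n).2 hc)
  have h2 := ZMod.pow_card_sub_one_eq_one h1
  have h3 := congrArg (ZMod.castHom (dvd_refl p) K) h2
  simpa using h3

theorem opT_id (hp3 : 3 ≤ p) (k : Fin m) (j : Fin t) (a : Ex t m) (ha : Rd p a)
    (h0 : ((a (j, Sum.inr k) : K) * (a (j, Sum.inl k) + 1)) = 0) :
    opT K p k j (mono K p a) - (a (j, Sum.inr k) : K) • mono K p (stp k k j a) ∈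
      Fil K p t m (size a) (t * (p - 1)) := by
  have h1 := opD_pow (K := K) hp3 k j a ha (p - 1)
  rw [h0, zero_pow (by omega), zero_smul, sub_zero] at h1
  have h2 := op_Fil hp3 {Sum.inl k} {Sum.inr k} j _ _ _ h1
  rw [← opE_single] at h2
  rw [← E_mono hp3 k j a ha]
  simp only [opT, LinearMap.comp_apply, LinearMap.sub_apply, LinearMap.id_apply, map_sub]
  rw [sub_sub_cancel_left]
  exact Submodule.neg_mem _ h2

theorem opT_kill (hp3 : 3 ≤ p) (k : Fin m) (j : Fin t) (a : Ex t m) (ha : Rd p a)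
    (h0 : a (j, Sum.inr k) = 0) : opT K p k j (mono K p a) = 0 := by
  have hE : opE K p {k} j (mono K p a) = 0 := by
    rw [E_mono hp3 k j a ha, h0]; simp
  have hD : ((opD K p k j) ^ (p - 1)) (mono K p a) = 0 := by
    obtain ⟨n, hn⟩ : ∃ n, p - 1 = n + 1 := ⟨p - 2, by omega⟩
    rw [hn, pow_succ, Module.End.mul_apply]
    simp [opD, hE]
  simp [opT, hD, hE]

theorem opT_mono (hp3 : 3 ≤ p) (k : Fin m) (j : Fin t) (a : Ex t m) (ha : Rd p a) :
    opT K p k j (mono K p a) ∈ Fil K p t m (size a) (p - 1) := by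
  have ht : 0 < t := Nat.pos_of_ne_zero (NeZero.ne t)
  have hle : Fil K p t m (size a) (t * (p - 1)) ≤ Fil K p t m (size a) (p - 1) := by
    apply Fil_mono
    have : 1 * (p - 1) ≤ t * (p - 1) := Nat.mul_le_mul_right _ ht
    omega
  by_cases h0 : ((a (j, Sum.inr k) : K) * (a (j, Sum.inl k) + 1)) = 0
  · by_cases hb : a (j, Sum.inr k) = 0
    · rw [opT_kill hp3 k j a ha hb]
      exact Submodule.zero_mem _
    · have hx : a (j, Sum.inl k) + 1 = p := by
        by_contra hc
        have := ha (j, Sum.inl k)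
        have h3 := nat_ne (K := K) (p := p) (a (j, Sum.inl k) + 1) (by omega) (by omega)
        have h4 := nat_ne (K := K) (p := p) (a (j, Sum.inr k)) (ha _) (by omega)
        push_cast at h3
        exact mul_ne_zero h4 h3 h0
      have h1 := hle (opT_id hp3 k j a ha h0)
      have hsz : size (stp k k j a) = size a := by
        rw [stp, size_add, size_dl]
        have := size_sub a (dl (j, Sum.inr k)) ((dl_le _ _).2 (by omega))
        rw [size_dl] at this
        omega
      have h2 : mono K p (stp k k j a) ∈ Fil K p t m (size a) (p - 1) := by
        rw [← hsz]
        apply mono_unred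
        intro hr
        have := hr (j, Sum.inl k)
        rw [show stp k k j a (j, Sum.inl k) = a (j, Sum.inl k) + 1 by
          simp [stp, dl, Pi.single_apply]] at this
        omega
      have := Submodule.add_mem _ h1 (Submodule.smul_mem _ (a (j, Sum.inr k) : K) h2)
      simpa using this
  · have h1 := opD_pow (K := K) hp3 k j a ha (p - 1)
    have e : ((a (j, Sum.inr k) : K) * (a (j, Sum.inl k) + 1)) =
      ((a (j, Sum.inr k) * (a (j, Sum.inl k) + 1) : ℕ) : K) := by push_cast; ring
    rw [e] at h0 h1
    rw [nat_pow_p (p := p) _ h0, one_smul] at h1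
    have h2 := op_Fil hp3 {Sum.inl k} {Sum.inr k} j _ _ _ (hle h1)
    rw [← opE_single] at h2
    have h3 := Submodule.neg_mem _ h2
    rw [← map_neg, neg_sub] at h3
    exact h3

theorem opT_Fil (hp3 : 3 ≤ p) (k : Fin m) (j : Fin t) (d z : ℕ) (f : (Ix m → K) → K)
    (hf : f ∈ Fil K p t m d z) : opT K p k j f ∈ Fil K p t m d (z + (p - 1)) := by
  induction hf using Submodule.span_induction with
  | mem x h =>
    obtain ⟨N, hN, rfl⟩ := h
    obtain ⟨a, ha, hs, hm⟩ := exists_red (K := K) (p := p) N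
    rw [← hm]
    exact Fil_mono (by omega) (opT_mono hp3 k j a ha)
  | zero => simp
  | add x y _ _ hx hy => rw [map_add]; exact Submodule.add_mem _ hx hy
  | smul c x _ hx => rw [map_smul]; exact Submodule.smul_mem _ _ hx

theorem Clo_opT (G : Submodule K ((Ix m → K) → K)) (hG : Clo p t G) (k : Fin m) (j : Fin t)
    (f : (Ix m → K) → K) (hf : f ∈ G) : opT K p k j f ∈ G := by
  have hD : ∀ n, ((opD K p k j) ^ n) f ∈ G := by
    intro n
    induction n with
    | zero => simpa using hf
    | succ n ih =>
      rw [pow_succ', Module.End.mul_apply]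
      exact hG.2 k j _ (hG.1 {k} j _ ih)
  exact hG.1 {k} j _ (Submodule.sub_mem _ hf (hD _))

end exact
end PR

namespace PR
set_option linter.all false

section carry
variable {K : Type} [Field K] [Fintype K] {p t m : ℕ} [Fact p.Prime] [CharP K p]
  [NeZero t] [Fact (Fintype.card K = p ^ t)]

theorem fill {ι : Type} [Fintype ι] (h : ℕ) (S : Finset ι) (lam : ℕ) (hl : lam ≤ S.card * h) :
    ∃ c : ι → ℕ, (∀ i, c i ≤ h) ∧ (∀ i, i ∉ S → c i = 0) ∧ ∑ i, c i = lam := by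
  induction S using Finset.induction_on generalizing lam with
  | empty =>
    refine ⟨0, fun _ => Nat.zero_le _, fun _ _ => rfl, ?_⟩
    simp at hl
    simp [hl]
  | insert x S hx ih =>
    rw [Finset.card_insert_of_notMem hx, Nat.succ_mul] at hl
    obtain ⟨c, h1, h2, h3⟩ := ih (lam - min lam h) (by omega)
    refine ⟨Function.update c x (min lam h), ?_, ?_, ?_⟩
    · intro i
      by_cases hi : i = x
      · subst hi; simp
      · simp [hi, h1]
    · intro i hi
      rw [Finset.mem_insert, not_or] at hi
      simp [hi.1, h2 i hi.2]
    · have : ∑ i, Function.update c x (min lam h) i = ∑ i, (c i + if i = x then min lam h else 0) := by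
        refine Finset.sum_congr rfl fun i _ => ?_
        by_cases hi : i = x
        · subst hi; simp [h2 i hx]
        · simp [hi]
      rw [this, Finset.sum_add_distrib, h3]
      simp

theorem fill2 (k0 : Fin m) (h lam : ℕ) (hl : lam ≤ (2 * m - 2) * h) :
    ∃ c : Ix m → ℕ, (∀ i, c i ≤ h) ∧ c (Sum.inl k0) = 0 ∧ c (Sum.inr k0) = 0 ∧ ∑ i, c i = lam := by
  have hcard : ((Finset.univ.erase (Sum.inl k0)).erase (Sum.inr k0) : Finset (Ix m)).card = 2 * m - 2 := by
    rw [Finset.card_erase_of_mem (by simp), Finset.card_erase_of_mem (by simp)]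
    simp
    omega
  obtain ⟨c, h1, h2, h3⟩ := fill h ((Finset.univ.erase (Sum.inl k0)).erase (Sum.inr k0)) lam (by rw [hcard]; exact hl)
  exact ⟨c, h1, h2 _ (by simp), h2 _ (by simp), h3⟩

theorem fill3 (hp3 : 3 ≤ p) (hm : 2 ≤ m) (k0 : Fin m) (lam : ℕ) (h1 : 1 ≤ lam) (hl : lam + 1 ≤ p * m) :
    ∃ c : Ix m → ℕ, (∀ i, c i ≤ p - 1) ∧ c (Sum.inl k0) = 1 ∧ c (Sum.inr k0) = 0 ∧ ∑ i, c i = lam := by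
  obtain ⟨c, h1, h2, h3, h4⟩ := fill2 k0 (p - 1) (lam - 1) (by
    obtain ⟨M, rfl⟩ := Nat.exists_eq_add_of_le hm
    obtain ⟨P, rfl⟩ := Nat.exists_eq_add_of_le hp3
    have e : 2 * (2 + M) - 2 = 2 * M + 2 := by omega
    have e' : 3 + P - 1 = P + 2 := by omega
    rw [e, e']
    have : (3 + P) * (2 + M) = 6 + 2 * P + 3 * M + P * M := by ring
    have : (2 * M + 2) * (P + 2) = 2 * (P * M) + 4 * M + 2 * P + 4 := by ring
    have : 0 ≤ P * M := Nat.zero_le _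
    omega)
  refine ⟨fun i => c i + if i = Sum.inl k0 then 1 else 0, ?_, ?_, ?_, ?_⟩
  · intro i
    by_cases hi : i = Sum.inl k0
    · subst hi; simp [h2]; omega
    · simp [hi, h1]
  · simp [h2]
  · simp [h3]
  · simp only [Finset.sum_add_distrib, h4]
    simp
    omega

theorem sum_lvl (h : ℕ) (c : Ix m → ℕ) (k0 : Fin m) (e : ℕ)
    (hc : ∀ k, c (Sum.inr k) = h ∧ c (Sum.inl k) = if k = k0 then e else 0) :
    ∑ i, c i = m * h + e := by
  rw [Fintype.sum_sum_type, Finset.sum_congr rfl (fun k _ => (hc k).1),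
    Finset.sum_congr rfl (fun k _ => (hc k).2)]
  simp
  ring

theorem level_ex (hp3 : 3 ≤ p) (hm : 2 ≤ m) (s : Fin t → ℕ) (hs : ∀ l, 1 ≤ s l ∧ s l ≤ m)
    (j : Fin t) (hj : s (j + 1) < m) (hmin : ∀ l, s (j + 1) ≤ s l) (hne : j + 1 ≠ j)
    (k0 : Fin m) (lam : Fin t → ℕ) (hlam : ∀ l, lam l + s l = p * s (l + 1)) (l : Fin t) :
    ∃ c : Ix m → ℕ, (∀ i, c i ≤ p - 1) ∧ ∑ i, c i = lam l ∧
      (l = j → c (Sum.inl k0) = 0 ∧ c (Sum.inr k0) = 0) ∧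
      (l = j + 1 → c (Sum.inl k0) = 1) ∧
      (l = j + 1 → l ∈ Jset m (s + Pi.single (j + 1) 1) → ∀ k, c (Sum.inr k) = p - 1 ∧
        c (Sum.inl k) = if k = k0 then 1 else 0) ∧
      (l ∈ Jset m s → ∀ k, c (Sum.inr k) = p - 1 ∧ c (Sum.inl k) = 0) ∧
      (l ∉ Jset m s → ∃ k, c (Sum.inl k) + c (Sum.inr k) ≠ p - 1) := by
  have hjJ : j ∉ Jset m s := by rw [mem_Jset]; omega
  have hjJ' : j + 1 ∉ Jset m s := by rw [mem_Jset]; omega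
  by_cases h1 : l = j
  · subst h1
    have b1 := hlam l
    have b2 := (hs l).1
    obtain ⟨c, c1, c2, c3, c4⟩ := fill2 k0 (p - 1) (lam l) (by
      have e1 : p * s (l + 1) ≤ p * (m - 1) := Nat.mul_le_mul_left _ (by omega)
      have e2 : p * (m - 1) ≤ (2 * (p - 1)) * (m - 1) := Nat.mul_le_mul_right _ (by omega)
      have e3 : (2 * m - 2) * (p - 1) = (2 * (p - 1)) * (m - 1) := by
        rw [show 2 * m - 2 = 2 * (m - 1) by omega]; ring
      omega)
    exact ⟨c, c1, c4, fun _ => ⟨c2, c3⟩, fun h => absurd h.symm hne, fun h => absurd h.symm hne,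
      fun h => absurd h hjJ, fun _ => ⟨k0, by omega⟩⟩
  have bd : lam l + 1 ≤ p * m := by
    have b1 := hlam l
    have b2 := (hs l).1
    have e1 : p * s (l + 1) ≤ p * m := Nat.mul_le_mul_left _ (hs _).2
    omega
  by_cases h2 : l = j + 1
  · subst h2
    by_cases h3 : j + 1 ∈ Jset m (s + Pi.single (j + 1) 1)
    · refine ⟨Sum.elim (fun k => if k = k0 then 1 else 0) (fun _ => p - 1), ?_, ?_, 
        fun h => absurd h hne, fun _ => by simp, fun _ _ k => by simp, fun h => absurd h hjJ', 
        fun _ => ⟨k0, by simp⟩⟩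
      · rintro (k | k)
        · simp; split_ifs <;> omega
        · simp
      · rw [sum_lvl (p - 1) _ k0 1 (fun k => by simp)]
        rw [mem_Jset] at h3
        have b1 := hlam (j + 1)
        have e2 : s (j + 1 + 1) = m := by
          have := h3.2
          by_cases hh : j + 1 + 1 = j + 1
          · rw [hh] at this ⊢
            have h4 : j = j := rfl
            exact absurd (add_right_cancel hh) hne
          · simpa [Pi.single_apply, hh] using this
        have e1 : s (j + 1) + 1 = m := by simpa using h3.1
        rw [e2] at b1
        have : p * m = m * (p - 1) + m := by
          rw [← Nat.mul_succ, mul_comm]; congr 1; omega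
        omega
    · obtain ⟨c, c1, c2, c3, c4⟩ := fill3 hp3 hm k0 (lam (j + 1)) (by
        have b1 := hlam (j + 1)
        have b2 := (hs (j + 1)).1
        have e1 : p * s (j + 1) ≤ p * s (j + 1 + 1) := Nat.mul_le_mul_left _ (hmin _)
        have e2 : 3 * s (j + 1) ≤ p * s (j + 1) := Nat.mul_le_mul_right _ hp3
        omega) bd
      exact ⟨c, c1, c4, fun h => absurd h hne, fun _ => c2, fun _ h => absurd h h3, fun h => absurd h hjJ',
        fun _ => ⟨k0, by omega⟩⟩
  by_cases h3 : l ∈ Jset m s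
  · refine ⟨Sum.elim (fun k => 0) (fun _ => p - 1), ?_, ?_, fun h => absurd h h1, fun h => absurd h h2,
      fun h => absurd h h2, fun _ k => by simp, fun h => absurd h3 h⟩
    · rintro (k | k) <;> simp
    · rw [sum_lvl (p - 1) _ k0 0 (fun k => by simp)]
      rw [mem_Jset] at h3
      have b1 := hlam l
      rw [h3.1, h3.2] at b1
      have : p * m = m * (p - 1) + m := by
        rw [← Nat.mul_succ, mul_comm]; congr 1; omega
      omega
  by_cases h4 : lam l = 0
  · exact ⟨0, fun _ => Nat.zero_le _, by simp [h4], fun h => absurd h h1, fun h => absurd h h2,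
      fun h => absurd h h2, fun h => absurd h h3, fun _ => ⟨k0, by simp; omega⟩⟩
  · obtain ⟨c, c1, c2, c3, c4⟩ := fill3 hp3 hm k0 (lam l) (by omega) bd
    exact ⟨c, c1, c4, fun h => absurd h h1, fun h => absurd h h2,
      fun h => absurd h h2, fun h => absurd h h3, fun _ => ⟨k0, by omega⟩⟩

theorem flip_fix (T : Finset (Fin t)) (a : Ex t m) (ha : Rd p a)
    (h : ∀ l ∈ T, ∀ k, a (l, Sum.inr k) + a (l, Sum.inl k) = p - 1) : flip p T a = a := by
  funext ⟨l, i⟩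
  simp only [flip]
  split_ifs with hl
  · rcases i with k | k
    · have := h l hl k
      simp
      omega
    · have := h l hl k
      simp
      omega
  · rfl

theorem Fil_Clo (hp3 : 3 ≤ p) (d z : ℕ) : Clo p t (Fil K p t m d z) :=
  ⟨fun T j f hf => op_Fil hp3 _ _ j d z f hf, fun k j f hf => op_Fil hp3 _ _ j d z f hf⟩

theorem Clo_sup (C D : Submodule K ((Ix m → K) → K)) (hC : Clo p t C) (hD : Clo p t D) :
    Clo p t (C ⊔ D) := by
  constructor
  · intro T j f hf
    obtain ⟨x, hx, y, hy, rfl⟩ := Submodule.mem_sup.1 hf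
    rw [map_add]
    exact Submodule.add_mem_sup (hC.1 T j x hx) (hD.1 T j y hy)
  · intro T j f hf
    obtain ⟨x, hx, y, hy, rfl⟩ := Submodule.mem_sup.1 hf
    rw [map_add]
    exact Submodule.add_mem_sup (hC.2 T j x hx) (hD.2 T j y hy)

def PP (p : ℕ) {t m : ℕ} [NeZero t] (C : Submodule K ((Ix m → K) → K)) (s : Fin t → ℕ) : Prop :=
  ∀ a : Ex t m, Rd p a → HT p a s → YJ K p (Jset m s) a ∈ C ⊔ Fil K p t m (size a) 1

theorem PP_of (hp3 : 3 ≤ p) (hm : 2 ≤ m) (C : Submodule K ((Ix m → K) → K)) (hC : Clo p t C)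
    (s : Fin t → ℕ) (a : Ex t m) (ha : Rd p a) (hs : HT p a s)
    (hg : mono K p a ∈ C ⊔ Fil K p t m (size a) 1)
    (hJ : ∀ l ∈ Jset m s, ∀ k, a (l, Sum.inr k) + a (l, Sum.inl k) = p - 1)
    (hN : ∀ l, l ∉ Jset m s → ∃ k, a (l, Sum.inl k) + a (l, Sum.inr k) ≠ p - 1) : PP p C s := by
  intro a' ha' hs'
  have h1 := HT_size a s hs
  have h2 := HT_size a' s hs'
  have e : size a' = size a := by omega
  rw [e]
  refine gGen hp3 _ (Clo_sup C _ hC (Fil_Clo hp3 _ _)) s (size a) h1 le_sup_right hm a a' ha hs ha' hs' ?_ ?_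
  · unfold YJ
    refine Submodule.sum_mem _ fun T hT => ?_
    rw [flip_fix T a ha (fun l hl => hJ l (Finset.mem_powerset.1 hT hl))]
    exact Submodule.smul_mem _ _ hg
  · intro l
    by_cases h : l ∈ Jset m s
    · exact Or.inr h
    · exact Or.inl (hN l h)

theorem MM_drop (hp3 : 3 ≤ p) (f : (Ix m → K) → K) (s : Fin t → ℕ) (d : ℕ) (hd : d + ∑ j, s j = p * ∑ j, s j)
    (hf : f ∈ MM K p t m) (hf' : f ∈ Fil K p t m d 1) : f ∈ Fil K p t m d (p - 1) := by
  have h := MM_Fil f d 1 hf hf'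
  refine Submodule.span_le.2 ?_ h
  rintro g ⟨s', a, -, ha, hs, hsz, rfl⟩
  refine Submodule.sum_mem _ fun T hT => Submodule.smul_mem _ _ ?_
  apply mono_mem_Fil
  rw [flip_size s' T (Finset.mem_powerset.1 hT) a ha hs]
  have h1 := HT_size a s' hs
  obtain ⟨P, rfl⟩ := Nat.exists_eq_add_of_le hp3
  have e1 : (3 + P) * ∑ j, s j = ∑ j, s j + (P + 2) * ∑ j, s j := by ring
  have e2 : (3 + P) * ∑ j, s' j = ∑ j, s' j + (P + 2) * ∑ j, s' j := by ring
  have e3 : d = (P + 2) * ∑ j, s j := by omega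
  have e4 : size a = (P + 2) * ∑ j, s' j := by omega
  have e5 : ∑ j, s' j < ∑ j, s j := by
    by_contra hc
    have := Nat.mul_le_mul_left (P + 2) (not_lt.1 hc)
    omega
  have := Nat.mul_le_mul_left (P + 2) (Nat.succ_le_of_lt e5)
  rw [Nat.mul_succ] at this
  omega

theorem carry_step (hp3 : 3 ≤ p) (hm : 2 ≤ m) (C : Submodule K ((Ix m → K) → K)) (hC : Clo p t C)
    (hCM : C ≤ MM K p t m) (s : Fin t → ℕ) (hs : ∀ l, 1 ≤ s l ∧ s l ≤ m)
    (j : Fin t) (hj : s (j + 1) < m) (hmin : ∀ l, s (j + 1) ≤ s l) (ht : 2 ≤ t)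
    (hP : PP p C (s + Pi.single (j + 1) 1)) : PP p C s := by
  intro a' ha' hs'
  revert a'
  by_contra hcon
  push Not at hcon
  obtain ⟨a', ha', hs', hbad⟩ := hcon
  apply hbad
  clear hbad
  have hne : j + 1 ≠ j := by
    intro h
    have h0 : (1 : Fin t) = 0 := by simpa using h
    have := congrArg Fin.val h0
    have : Fact (1 < t) := ⟨by omega⟩
    simp at *
    omega
  have k0 : Fin m := ⟨0, by omega⟩
  choose c c1 c2 c3 c4 c5 c6 c7 using level_ex hp3 hm s hs j hj hmin hne k0 (fun l => ∑ i, a' (l, i)) hs'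
  set s' := s + Pi.single (j + 1) 1 with hs'def
  set a0 : Ex t m := fun z => c z.1 z.2 with ha0
  have r0 : Rd p a0 := fun z => by have := c1 z.1 z.2; show c z.1 z.2 < p; omega
  have t0 : HT p a0 s := fun l => by
    show ∑ i, c l i + s l = _
    rw [c2]; exact hs' l
  obtain ⟨a1, ha1⟩ := exists_sub a0 (j + 1, Sum.inl k0) 1 (c4 (j + 1) rfl).ge
  rw [one_smul] at ha1
  have v1 : ∀ z, a1 z = a0 z - dl (j + 1, Sum.inl k0) z := by
    intro z; rw [ha1]; simp
  set v : Ex t m := a1 + (p - 1) • dl (j, Sum.inl k0) + dl (j, Sum.inr k0) with hv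
  have b1 : a1 (j, Sum.inl k0) = 0 := by
    rw [v1]; have := (c3 j rfl).1; show c j _ - _ = _; rw [this]; simp
  have b2 : a1 (j, Sum.inr k0) = 0 := by
    rw [v1]; have := (c3 j rfl).2; show c j _ - _ = _; rw [this]; simp
  have vx : v (j, Sum.inl k0) = p - 1 := by
    simp [hv, b1, dl, Pi.single_apply]
  have vb : v (j, Sum.inr k0) = 1 := by
    simp [hv, b2, dl, Pi.single_apply]
  have rv : Rd p v := by
    intro z
    by_cases h1 : z = (j, Sum.inl k0)
    · subst h1; rw [vx]; omega
    by_cases h2 : z = (j, Sum.inr k0)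
    · subst h2; rw [vb]; omega
    have : v z = a1 z := by simp [hv, dl, Pi.single_apply, h1, h2]
    rw [this, v1]
    have := r0 z
    omega
  have tv : HT p v s' := by
    intro l
    have h0 := t0 l
    rw [ha1] at h0
    simp only [Pi.add_apply, Finset.sum_add_distrib, sum_dl] at h0
    have e1 : s' l = s l + if l = j + 1 then 1 else 0 := by
      simp [hs'def, Pi.single_apply]
    have e2 : s' (l + 1) = s (l + 1) + if l = j then 1 else 0 := by
      simp [hs'def, Pi.single_apply]
    rw [e1, e2]
    simp only [hv, Pi.add_apply, Pi.smul_apply, Finset.sum_add_distrib, smul_eq_mul, ← Finset.mul_sum, sum_dl]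
    rw [mul_add, ← h0]
    split_ifs <;> omega
  have szv : size v = size a0 + (p - 1) := by
    rw [hv, ha1]
    simp only [size_add, size_smul, size_dl]
    omega
  have stv : mono K p (stp k0 k0 j v) = mono K p a0 := by
    rw [ha1, ← mono_carry]
    congr 1
    rw [stp, hv, add_tsub_cancel_right, add_assoc]
    congr 1
    rw [← succ_nsmul]
    congr 1
    omega
  have Jsub : ∀ l ∈ Jset m s', l ≠ j → l ≠ j + 1 → l ∈ Jset m s := by
    intro l hl h1 h2
    rw [mem_Jset] at hl ⊢
    have e1 : s' l = s l := by simp [hs'def, Pi.single_apply, h2]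
    have e2 : s' (l + 1) = s (l + 1) := by simp [hs'def, Pi.single_apply, h1]
    rw [← e1, ← e2]; exact hl
  have vfix : ∀ l ∈ Jset m s', l ≠ j → ∀ k, v (l, Sum.inr k) + v (l, Sum.inl k) = p - 1 := by
    intro l hl h1 k
    have ev : ∀ i, v (l, i) = a1 (l, i) := by
      intro i; simp [hv, dl, Pi.single_apply, h1]
    rw [ev, ev, v1, v1]
    show c l _ - _ + (c l _ - _) = _
    by_cases h2 : l = j + 1
    · have := c5 l h2 hl k
      rw [this.1, this.2, h2]
      by_cases hk : k = k0
      · simp [hk, dl, Pi.single_apply]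
      · simp [hk, dl, Pi.single_apply]
    · have := c6 l (Jsub l hl h1 h2) k
      rw [this.1, this.2]
      simp [dl, Pi.single_apply, h2]
  have sm' : Sm m s' := by
    left
    intro l
    have := hs l
    have e1 : s' l = s l + if l = j + 1 then 1 else 0 := by
      simp [hs'def, Pi.single_apply]
    rw [e1]
    split_ifs with h
    · subst h; omega
    · omega
  -- main argument
  have hYC := hP v rv tv
  obtain ⟨f, hf, g, hg, hfg⟩ := Submodule.mem_sup.1 hYC
  have hYM : YJ K p (Jset m s') v ∈ MM K p t m :=
    Submodule.subset_span ⟨s', v, sm', rv, tv, trivial, rfl⟩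
  have hgM : g ∈ MM K p t m := by
    have := Submodule.sub_mem _ hYM (hCM hf)
    rw [← hfg] at this
    simpa using this
  have hg1 := MM_drop hp3 g s' (size v) (HT_size v s' tv) hgM hg
  have hTg := opT_Fil hp3 k0 j _ _ _ hg1
  have hTf := Clo_opT C hC k0 j f hf
  have hTY : opT K p k0 j (YJ K p (Jset m s') v) =
      ((2 : K) ^ ((Jset m s').erase j).card * (fct K v)⁻¹) • opT K p k0 j (mono K p v) := by
    unfold YJ
    rw [map_sum]
    rw [← Finset.sum_subset (Finset.powerset_mono.2 (Finset.erase_subset j (Jset m s')))]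
    · rw [Finset.sum_congr rfl (g := fun _ => (fct K v)⁻¹ • opT K p k0 j (mono K p v))]
      · rw [Finset.sum_const, Finset.card_powerset, ← Nat.cast_smul_eq_nsmul K, smul_smul]
        simp
      · intro T hT
        rw [flip_fix T v rv]
        · simp [wf]
        · intro l hl
          have := Finset.mem_powerset.1 hT hl
          rw [Finset.mem_erase] at this
          exact vfix l this.2 this.1
    · intro T hT hT'
      rw [Finset.mem_powerset] at hT hT'
      have hjT : j ∈ T := by
        by_contra hc
        exact hT' (Finset.subset_erase.2 ⟨hT, hc⟩)
      rw [wf, map_smul, opT_kill hp3 k0 j _ (flip_rd T v rv), smul_zero]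
      simp [flip, hjT, vx]
  have h0 : ((v (j, Sum.inr k0) : K) * (v (j, Sum.inl k0) + 1)) = 0 := by
    rw [vx]
    have : ((p - 1 + 1 : ℕ) : K) = 0 := (CharP.cast_eq_zero_iff K p _).2 ⟨1, by omega⟩
    push_cast at this
    rw [this, mul_zero]
  have hTv := opT_id hp3 k0 j v rv h0
  rw [vb, stv, Nat.cast_one, one_smul] at hTv
  have hle1 : Fil K p t m (size v) (t * (p - 1)) ≤ Fil K p t m (size a0) 1 := by
    apply Fil_mono
    have : 2 * (p - 1) ≤ t * (p - 1) := Nat.mul_le_mul_right _ ht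
    omega
  have hle2 : Fil K p t m (size v) (p - 1 + (p - 1)) ≤ Fil K p t m (size a0) 1 := by
    apply Fil_mono
    omega
  set cst := ((2 : K) ^ ((Jset m s').erase j).card * (fct K v)⁻¹) with hcst
  have hc0 : cst ≠ 0 := by
    refine mul_ne_zero (pow_ne_zero _ ?_) (inv_ne_zero (fct_ne v rv))
    have := nat_ne (K := K) (p := p) 2 (by omega) (by omega)
    exact_mod_cast this
  have hTv' : opT K p k0 j (mono K p v) ∈ C ⊔ Fil K p t m (size a0) 1 := by
    rw [← Submodule.smul_mem_iff _ hc0, ← hTY, ← hfg, map_add]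
    exact Submodule.add_mem_sup hTf (hle2 hTg)
  have hm0 : mono K p a0 ∈ C ⊔ Fil K p t m (size a0) 1 := by
    have := Submodule.sub_mem _ hTv' ((le_sup_right : _ ≤ C ⊔ Fil K p t m (size a0) 1) (hle1 hTv))
    simpa using this
  refine PP_of hp3 hm C hC s a0 r0 t0 hm0 ?_ ?_ a' ha' hs'
  · intro l hl k
    have := c6 l hl k
    show c l (Sum.inr k) + c l (Sum.inl k) = _
    omega
  · intro l hl
    exact c7 l hl

theorem lower (hp3 : 3 ≤ p) (hm : 2 ≤ m) (C : Submodule K ((Ix m → K) → K)) (hC : Clo p t C)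
    (hCM : C ≤ MM K p t m)
    (hst : ∀ r, r ≤ m → ∃ a : Ex t m, (∀ l i, a (l, i) = if ∃ k : Fin m, (k : ℕ) < r ∧ i = Sum.inl k then p - 1 else 0) ∧
      mono K p a ∈ C ⊔ Fil K p t m (size a) 1) : MM K p t m ≤ C := by
  have hconst : ∀ r, r ≤ m → PP p C (fun _ : Fin t => r) := by
    intro r hr
    obtain ⟨a, ha, hg⟩ := hst r hr
    have ar : ∀ l (k : Fin m), a (l, Sum.inr k) = 0 := by intro l k; rw [ha]; simp
    have al : ∀ l (k : Fin m), a (l, Sum.inl k) = if (k : ℕ) < r then p - 1 else 0 := by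
      intro l k; rw [ha]
      congr 1
      simp only [Sum.inl.injEq, eq_iff_iff]
      constructor
      · rintro ⟨k', h, rfl⟩; exact h
      · intro h; exact ⟨k, h, rfl⟩
    refine PP_of hp3 hm C hC _ a ?_ ?_ hg ?_ ?_
    · rintro ⟨l, i⟩
      rw [ha]; split_ifs <;> omega
    · intro l
      rw [Fintype.sum_sum_type]
      simp only [ar, al, Finset.sum_const_zero, add_zero]
      rw [Fin.sum_univ_eq_sum_range (fun k => if k < r then p - 1 else 0) m, ← Finset.sum_filter]
      have : (Finset.range m).filter (fun k => k < r) = Finset.range r := by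
        ext x; simp; omega
      rw [this]
      simp
      have : p * r = r * (p - 1) + r := by
        rw [← Nat.mul_succ, mul_comm]; congr 1; omega
      omega
    · intro l hl k
      rw [mem_Jset] at hl
      rw [ar, al, if_pos (by omega)]
      omega
    · intro l hl
      rw [mem_Jset] at hl
      refine ⟨⟨m - 1, by omega⟩, ?_⟩
      rw [ar, al, if_neg (by simp; omega)]
      omega
  have hall : ∀ e (s : Fin t → ℕ), (∀ l, 1 ≤ s l ∧ s l ≤ m) → ∑ l, (m - s l) = e → PP p C s := by
    intro e
    induction e using Nat.strong_induction_on with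
    | _ e ih =>
      intro s hs he
      by_cases hc : ∀ l, s l = s 0
      · have : s = fun _ => s 0 := funext hc
        rw [this]
        exact hconst _ (hs 0).2
      · push Not at hc
        obtain ⟨l1, hl1⟩ := hc
        obtain ⟨i, hi⟩ := Finite.exists_min s
        have him : s i < m := by
          by_contra hcon
          have h1 := hi l1
          have h2 := hi 0
          have h3 := (hs l1).2
          have h4 := (hs 0).2
          omega
        have ht : 2 ≤ t := by
          by_contra hcon
          have : t = 1 := by have := NeZero.ne t; omega
          subst this
          exact hl1 (by rw [Subsingleton.elim l1 0])
        have e1 : i - 1 + 1 = i := sub_add_cancel i 1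
        refine carry_step hp3 hm C hC hCM s hs (i - 1) (by rw [e1]; exact him) (by rw [e1]; exact hi) ht ?_
        rw [e1]
        refine ih _ ?_ _ ?_ rfl
        · rw [← he]
          refine Finset.sum_lt_sum (fun l _ => ?_) ⟨i, Finset.mem_univ _, ?_⟩
          · simp; omega
          · simp; omega
        · intro l
          have := hs l
          simp only [Pi.add_apply, Pi.single_apply]
          split_ifs with h
          · subst h; omega
          · omega
  have hPP : ∀ s : Fin t → ℕ, Sm m s → PP p C s := by
    rintro s (h | h)
    · exact hall _ s h rfl
    · subst h
      exact hconst 0 (Nat.zero_le _)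
  have fin : ∀ d, ∀ f ∈ gens K p t m (fun a => size a ≤ d), f ∈ C := by
    intro d
    induction d with
    | zero =>
      rintro f ⟨s, a, h1, h2, h3, h4, rfl⟩
      obtain ⟨f, hf, g, hg, hfg⟩ := Submodule.mem_sup.1 (hPP s h1 a h2 h3)
      have : Fil K p t m (size a) 1 ≤ ⊥ := by
        refine Submodule.span_le.2 ?_
        rintro g ⟨N, hN, -⟩
        omega
      have hg0 : g = 0 := by simpa using this hg
      rw [← hfg, hg0, add_zero]
      exact hf
    | succ d ih =>
      rintro f ⟨s, a, h1, h2, h3, h4, rfl⟩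
      obtain ⟨f, hf, g, hg, hfg⟩ := Submodule.mem_sup.1 (hPP s h1 a h2 h3)
      have hYM : YJ K p (Jset m s) a ∈ MM K p t m :=
        Submodule.subset_span ⟨s, a, h1, h2, h3, trivial, rfl⟩
      have hgM : g ∈ MM K p t m := by
        have := Submodule.sub_mem _ hYM (hCM hf)
        rw [← hfg] at this
        simpa using this
      have := MM_Fil g _ _ hgM hg
      have hgC : g ∈ C := by
        refine Submodule.span_le.2 ?_ this
        rintro x ⟨s, b, q1, q2, q3, q4, rfl⟩
        exact ih _ ⟨s, b, q1, q2, q3, by omega, rfl⟩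
      rw [← hfg]
      exact Submodule.add_mem _ hf hgC
  refine Submodule.span_le.2 ?_
  rintro f ⟨s, a, h1, h2, h3, -, rfl⟩
  exact fin (size a) _ ⟨s, a, h1, h2, h3, le_rfl, rfl⟩

end carry
end PR

namespace PR
set_option linter.all false

section cc
variable {K : Type} [Field K] [Fintype K] {p t m : ℕ} [Fact p.Prime] [CharP K p]
  [NeZero t] [Fact (Fintype.card K = p ^ t)]

def bform {K : Type} [Field K] {m : ℕ} (v w : Ix m → K) : K :=
  ∑ k : Fin m, (v (Sum.inl k) * w (Sum.inr k) - v (Sum.inr k) * w (Sum.inl k))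

def Lag {K : Type} [Field K] {m : ℕ} (W : Submodule K (Ix m → K)) : Prop :=
  (∀ u ∈ W, ∀ w ∈ W, bform u w = 0) ∧ Module.finrank K W = m

def chi {K : Type} [Field K] {m : ℕ} (W : Submodule K (Ix m → K)) : (Ix m → K) → K :=
  fun v => if v ∈ W then 1 else 0

def CC (K : Type) [Field K] (m : ℕ) : Submodule K ((Ix m → K) → K) :=
  Submodule.span K {f | ∃ W, Lag W ∧ f = chi W}

def shl (P Q : Finset (Ix m)) (c : K) : (Ix m → K) →ₗ[K] (Ix m → K) where
  toFun := shear P Q c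
  map_add' u v := by
    funext i
    simp only [shear, Pi.add_apply, Finset.sum_add_distrib]
    split_ifs <;> ring
  map_smul' r v := by
    funext i
    simp only [shear, Pi.smul_apply, smul_eq_mul, ← Finset.mul_sum, RingHom.id_apply]
    split_ifs <;> ring

theorem shear_inv (P Q : Finset (Ix m)) (hd : Disjoint P Q) (c : K) (v : Ix m → K) :
    shear P Q (-c) (shear P Q c v) = v := by
  have h : ∑ k ∈ P, shear P Q c v k = ∑ k ∈ P, v k := by
    refine Finset.sum_congr rfl fun k hk => ?_
    simp [shear, Finset.disjoint_left.1 hd hk]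
  funext i
  show shear P Q c v i + (if i ∈ Q then -c * ∑ k ∈ P, shear P Q c v k else 0) = _
  rw [h]
  simp only [shear]
  split_ifs <;> ring

def sheq (P Q : Finset (Ix m)) (hd : Disjoint P Q) (c : K) : (Ix m → K) ≃ₗ[K] (Ix m → K) :=
  LinearEquiv.ofLinear (shl P Q c) (shl P Q (-c))
    (by
      ext1 v
      have := shear_inv P Q hd (-c)
      rw [neg_neg] at this
      refine LinearMap.ext fun v => ?_
      exact this _)
    (by
      ext1 v
      refine LinearMap.ext fun v => ?_
      exact shear_inv P Q hd c _)

theorem Lag_comap (e : (Ix m → K) ≃ₗ[K] (Ix m → K)) (he : ∀ u v, bform (e u) (e v) = bform u v)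
    (W : Submodule K (Ix m → K)) (hW : Lag W) : Lag (W.comap (e : (Ix m → K) →ₗ[K] (Ix m → K))) := by
  constructor
  · intro u hu w hw
    rw [← he]
    exact hW.1 _ hu _ hw
  · refine Eq.trans ?_ hW.2
    have := Submodule.comap_equiv_eq_map_symm e W
    rw [this]
    exact LinearEquiv.finrank_map_eq e.symm W

theorem op_CC (P Q : Finset (Ix m)) (hd : Disjoint P Q)
    (hi : ∀ (c : K) u v, bform (shear P Q c u) (shear P Q c v) = bform u v) (j : Fin t)
    (f : (Ix m → K) → K) (hf : f ∈ CC K m) : op p P Q j f ∈ CC K m := by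
  induction hf using Submodule.span_induction with
  | mem x h =>
    obtain ⟨W, hW, rfl⟩ := h
    have : op p P Q j (chi W) = - ∑ c : K, c ^ (p ^ t - 1 - p ^ (j : ℕ)) •
        chi (W.comap ((sheq P Q hd c : _ ≃ₗ[K] _) : (Ix m → K) →ₗ[K] (Ix m → K))) := by
      funext v
      simp only [op, LinearMap.coe_mk, AddHom.coe_mk, Pi.neg_apply, Finset.sum_apply, Pi.smul_apply,
        smul_eq_mul]
      rfl
    rw [this]
    refine Submodule.neg_mem _ (Submodule.sum_mem _ fun c _ => Submodule.smul_mem _ _ ?_)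
    exact Submodule.subset_span ⟨_, Lag_comap _ (hi c) W hW, rfl⟩
  | zero => simp
  | add x y _ _ hx hy => rw [map_add]; exact Submodule.add_mem _ hx hy
  | smul c x _ hx => rw [map_smul]; exact Submodule.smul_mem _ _ hx

theorem CC_Clo : Clo p t (CC K m) := by
  constructor
  · intro T j f hf
    refine op_CC _ _ ?_ ?_ j f hf
    · rw [Finset.disjoint_left]
      intro x hx hx'
      simp only [Finset.mem_map, Function.Embedding.coeFn_mk] at hx hx'
      obtain ⟨a, -, rfl⟩ := hx
      obtain ⟨b, -, hb⟩ := hx'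
      cases hb
    · intro c u v
      have e : ∀ w : Ix m → K, ∑ k ∈ T.map ⟨Sum.inl, Sum.inl_injective⟩, w k = ∑ k ∈ T, w (Sum.inl k) := by
        intro w; simp
      have e1 : ∀ (w : Ix m → K) k, shear (T.map ⟨Sum.inl, Sum.inl_injective⟩)
          (T.map ⟨Sum.inr, Sum.inr_injective⟩) c w (Sum.inl k) = w (Sum.inl k) := by
        intro w k; simp [shear]
      have e2 : ∀ (w : Ix m → K) k, shear (T.map ⟨Sum.inl, Sum.inl_injective⟩)
          (T.map ⟨Sum.inr, Sum.inr_injective⟩) c w (Sum.inr k) = w (Sum.inr k) +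
            if k ∈ T then c * ∑ k ∈ T, w (Sum.inl k) else 0 := by
        intro w k; simp [shear]
      simp only [bform, e1, e2]
      rw [← sub_eq_zero, ← Finset.sum_sub_distrib]
      have : ∀ k, (u (Sum.inl k) * (v (Sum.inr k) + if k ∈ T then c * ∑ k ∈ T, v (Sum.inl k) else 0) -
          (u (Sum.inr k) + if k ∈ T then c * ∑ k ∈ T, u (Sum.inl k) else 0) * v (Sum.inl k) -
          (u (Sum.inl k) * v (Sum.inr k) - u (Sum.inr k) * v (Sum.inl k))) =
          if k ∈ T then (c * ∑ k ∈ T, v (Sum.inl k)) * u (Sum.inl k) -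
            (c * ∑ k ∈ T, u (Sum.inl k)) * v (Sum.inl k) else 0 := by
        intro k
        split_ifs <;> ring
      rw [Finset.sum_congr rfl (fun k _ => this k), ← Finset.sum_filter, Finset.sum_sub_distrib,
        ← Finset.mul_sum, ← Finset.mul_sum]
      simp only [Finset.filter_mem_eq_inter, Finset.univ_inter]
      ring
  · intro k j f hf
    refine op_CC _ _ (by simp) ?_ j f hf
    intro c u v
    simp only [bform]
    refine Finset.sum_congr rfl fun l _ => ?_
    by_cases h : l = k
    · subst h
      simp [shear]
      ring
    · simp [shear, h]

/-- product Lagrangians -/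
def prL (th : Fin m → Option K) : (Fin m → K) →ₗ[K] (Ix m → K) where
  toFun u := Sum.elim (fun k => match th k with | none => 0 | some _ => u k)
    (fun k => match th k with | none => u k | some b => b * u k)
  map_add' u v := by
    funext i
    rcases i with k | k <;> rcases h : th k with _ | b <;> simp [h]
    ring
  map_smul' r v := by
    funext i
    rcases i with k | k <;> rcases h : th k with _ | b <;> simp [h]
    ring

def lin1 (o : Option K) (x y : K) : K := match o with
  | none => if x = 0 then 1 else 0
  | some b => if y = b * x then 1 else 0

theorem prL_Lag (th : Fin m → Option K) : Lag (LinearMap.range (prL th)) := by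
  constructor
  · rintro _ ⟨u, rfl⟩ _ ⟨w, rfl⟩
    simp only [bform]
    refine Finset.sum_eq_zero fun k _ => ?_
    rcases h : th k with _ | b <;> simp [prL, h]
    ring
  · rw [LinearMap.finrank_range_of_inj]
    · simp
    · intro u w h
      funext k
      have h1 := congrFun h (Sum.inl k)
      have h2 := congrFun h (Sum.inr k)
      rcases h : th k with _ | b <;> simp [prL, h] at h1 h2
      · exact h2
      · exact h1

theorem prL_chi (th : Fin m → Option K) (v : Ix m → K) :
    chi (LinearMap.range (prL th)) v = ∏ k, lin1 (th k) (v (Sum.inl k)) (v (Sum.inr k)) := by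
  by_cases h : ∀ k, lin1 (th k) (v (Sum.inl k)) (v (Sum.inr k)) = 1
  · rw [Finset.prod_congr rfl (fun k _ => h k), Finset.prod_const_one]
    simp only [chi]
    rw [if_pos]
    refine ⟨fun k => match th k with | none => v (Sum.inr k) | some _ => v (Sum.inl k), ?_⟩
    funext i
    rcases i with k | k <;> have := h k <;> rcases h : th k with _ | b <;> simp [prL, h, lin1] at this ⊢
    · exact this.symm
    · exact this.symm
  · push Not at h
    obtain ⟨k, hk⟩ := h
    have hz : lin1 (th k) (v (Sum.inl k)) (v (Sum.inr k)) = 0 := by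
      rcases h : th k with _ | b <;> simp [lin1, h] at hk ⊢ <;> exact hk
    rw [Finset.prod_eq_zero (Finset.mem_univ k) hz]
    simp only [chi]
    rw [if_neg]
    rintro ⟨u, rfl⟩
    apply hk
    rcases h : th k with _ | b <;> simp [lin1, prL, h]

theorem lin1_sum (x y : K) : ∑ o : Option K, lin1 o x y = 1 := by
  rw [Fintype.sum_option]
  simp only [lin1]
  by_cases hx : x = 0
  · subst hx
    by_cases hy : y = 0
    · have : ((Fintype.card K : ℕ) : K) = 0 := Nat.cast_card_eq_zero K
      simp [hy, this]
    · simp [hy]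
  · have : ∀ b, (y = b * x) ↔ b = y / x := by
      intro b
      rw [eq_div_iff hx]
      exact eq_comm
    simp [hx, this]

theorem start_mem (r : ℕ) :
    (fun v : Ix m → K => ∏ k : Fin m, if (k : ℕ) < r then (if v (Sum.inl k) = 0 then (1 : K) else 0) else 1) ∈ CC K m := by
  have : (fun v : Ix m → K => ∏ k : Fin m, if (k : ℕ) < r then (if v (Sum.inl k) = 0 then (1 : K) else 0) else 1) =
      ∑ th ∈ Fintype.piFinset (fun k : Fin m => if (k : ℕ) < r then ({none} : Finset (Option K)) else Finset.univ),
        chi (LinearMap.range (prL th)) := by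
    funext v
    rw [Finset.sum_apply]
    simp only [prL_chi]
    refine Eq.trans ?_ (Finset.prod_univ_sum (fun k : Fin m => if (k : ℕ) < r then ({none} : Finset (Option K)) else Finset.univ)
      (fun k o => lin1 o (v (Sum.inl k)) (v (Sum.inr k))))
    refine Finset.prod_congr rfl fun k _ => ?_
    split_ifs with h1 h2 h2
    · simp [lin1, h2]
    · simp [lin1, h2]
    · exact (lin1_sum _ _).symm
  rw [this]
  exact Submodule.sum_mem _ fun th _ => Submodule.subset_span ⟨_, prL_Lag th, rfl⟩

def exS (p t : ℕ) {m : ℕ} (T : Finset (Fin m)) : Ex t m :=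
  fun z => Sum.elim (fun k => if k ∈ T then p - 1 else 0) (fun _ => 0) z.2

theorem mono_exS (T : Finset (Fin m)) (v : Ix m → K) :
    mono K p (exS p t T) v = ∏ k ∈ T, (v (Sum.inl k)) ^ (p ^ t - 1) := by
  have hp : 2 ≤ p := (Fact.out : p.Prime).two_le
  rw [mono, Fintype.prod_prod_type, Finset.prod_comm, Fintype.prod_sum_type]
  simp only [exS, Sum.elim_inl, Sum.elim_inr, mul_zero, pow_zero, Finset.prod_const_one, mul_one]
  rw [← Finset.prod_subset (Finset.subset_univ T)]
  · refine Finset.prod_congr rfl fun k hk => ?_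
    rw [Finset.prod_pow_eq_pow_sum]
    congr 1
    simp only [if_pos hk]
    have := geo_univ p t (by omega)
    omega
  · intro k _ hk
    simp [hk]

theorem size_exS (T : Finset (Fin m)) : size (exS p t T) = t * (T.card * (p - 1)) := by
  rw [size, Fintype.sum_prod_type]
  simp only [exS, Fintype.sum_sum_type, Sum.elim_inl, Sum.elim_inr, Finset.sum_const_zero, add_zero]
  simp

theorem start (hp3 : 3 ≤ p) (r : ℕ) (hr : r ≤ m) :
    ∃ a : Ex t m, (∀ l i, a (l, i) = if ∃ k : Fin m, (k : ℕ) < r ∧ i = Sum.inl k then p - 1 else 0) ∧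
      mono K p a ∈ CC K m ⊔ Fil K p t m (size a) 1 := by
  have hc : Fintype.card K = p ^ t := Fact.out
  have ht : 0 < t := Nat.pos_of_ne_zero (NeZero.ne t)
  have hpt : p ^ t - 1 ≠ 0 := by
    have := pj_lt (p := p) (t := t) hp3 0
    omega
  set S := Finset.univ.filter (fun k : Fin m => (k : ℕ) < r) with hS
  refine ⟨exS p t S, ?_, ?_⟩
  · intro l i
    rcases i with k | k
    · simp [exS, hS]
    · simp [exS]
  · have h1 := start_mem (K := K) (m := m) r
    have h2 : (fun v : Ix m → K => ∏ k : Fin m, if (k : ℕ) < r then (if v (Sum.inl k) = 0 then (1 : K) else 0) else 1) =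
        ∑ T ∈ S.powerset, (-1 : K) ^ T.card • mono K p (exS p t T) := by
      funext v
      rw [Finset.sum_apply]
      simp only [Pi.smul_apply, smul_eq_mul, mono_exS]
      rw [← Finset.prod_filter]
      have : ∀ x : K, (if x = 0 then (1 : K) else 0) = 1 + (- x ^ (p ^ t - 1)) := by
        intro x
        split_ifs with hx
        · simp [hx, hpt]
        · rw [← hc, FiniteField.pow_card_sub_one_eq_one x hx]; ring
      simp only [this]
      rw [Finset.prod_one_add]
      refine Finset.sum_congr rfl fun T _ => ?_
      rw [Finset.prod_neg]
    rw [h2, ← Finset.sum_erase_add _ _ (Finset.mem_powerset_self S)] at h1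
    have h3 : ∑ T ∈ S.powerset.erase S, (-1 : K) ^ T.card • mono K p (exS p t T) ∈
        Fil K p t m (size (exS p t S)) 1 := by
      refine Submodule.sum_mem _ fun T hT => Submodule.smul_mem _ _ ?_
      rw [Finset.mem_erase, Finset.mem_powerset] at hT
      apply mono_mem_Fil
      rw [size_exS, size_exS]
      have hlt : T.card < S.card := Finset.card_lt_card (lt_of_le_of_ne hT.2 hT.1)
      have : T.card * (p - 1) < S.card * (p - 1) := Nat.mul_lt_mul_of_pos_right hlt (by omega)
      have : t * (T.card * (p - 1)) < t * (S.card * (p - 1)) := Nat.mul_lt_mul_of_pos_left this ht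
      omega
    have h4 := Submodule.sub_mem _ (Submodule.mem_sup_left (T := Fil K p t m (size (exS p t S)) 1) h1)
      (Submodule.mem_sup_right h3)
    rw [add_sub_cancel_left] at h4
    exact (Submodule.smul_mem_iff _ (pow_ne_zero _ (by simp))).1 h4

theorem lowerC (hp3 : 3 ≤ p) (hm : 2 ≤ m) (hCM : CC K m ≤ MM K p t m) : CC K m = MM K p t m :=
  le_antisymm hCM (lower hp3 hm _ CC_Clo hCM (start hp3))

end cc
end PR

namespace PR
set_option linter.all false

section swaps
variable {K : Type} [Field K] [Fintype K] {p t m : ℕ} [Fact p.Prime] [CharP K p]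
  [NeZero t] [Fact (Fintype.card K = p ^ t)]

theorem wilson0 : ((Nat.factorial (p - 1) : ℕ) : K) = -1 := by
  have h := ZMod.wilsons_lemma p
  have h2 : (((Nat.factorial (p - 1) + 1 : ℕ)) : ZMod p) = 0 := by
    push_cast; rw [h]; ring
  rw [ZMod.natCast_eq_zero_iff] at h2
  have h3 := (CharP.cast_eq_zero_iff K p _).2 h2
  push_cast at h3
  linear_combination h3

theorem wilson (n : ℕ) (hn : n < p) :
    ((Nat.factorial n : ℕ) : K) * ((Nat.factorial (p - 1 - n) : ℕ) : K) = (-1) ^ (n + 1) := by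
  induction n with
  | zero => simp [wilson0 (K := K) (p := p)]
  | succ n ih =>
    have ih := ih (by omega)
    have h1 : p - 1 - n = (p - 1 - (n + 1)) + 1 := by omega
    have h2 : ((p - 1 - (n + 1) + 1 : ℕ) : K) = -((n + 1 : ℕ) : K) := by
      have : ((p - 1 - (n + 1) + 1 : ℕ) : K) + ((n + 1 : ℕ) : K) = ((p : ℕ) : K) := by
        rw [← Nat.cast_add]; congr 1; omega
      rw [CharP.cast_eq_zero K p] at this
      linear_combination this
    rw [h1, Nat.factorial_succ, Nat.cast_mul, h2] at ih
    rw [Nat.factorial_succ, Nat.cast_mul, pow_succ, ← ih]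
    ring

def sg (S : Finset (Fin m)) : Ix m → Ix m :=
  Sum.elim (fun k => if k ∈ S then Sum.inr k else Sum.inl k)
    (fun k => if k ∈ S then Sum.inl k else Sum.inr k)

theorem sg_sg (S : Finset (Fin m)) (i : Ix m) : sg S (sg S i) = i := by
  rcases i with k | k <;> by_cases h : k ∈ S <;> simp [sg, h]

theorem sg_swap (S : Finset (Fin m)) (i : Ix m) : sg S i.swap = (sg S i).swap := by
  rcases i with k | k <;> by_cases h : k ∈ S <;> simp [sg, h]

def sge (S : Finset (Fin m)) : Ix m ≃ Ix m := ⟨sg S, sg S, sg_sg S, sg_sg S⟩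

def swp {K : Type} [Field K] {m : ℕ} (S : Finset (Fin m)) (v : Ix m → K) : Ix m → K :=
  Sum.elim (fun k => if k ∈ S then v (Sum.inr k) else v (Sum.inl k))
    (fun k => if k ∈ S then - v (Sum.inl k) else v (Sum.inr k))

def sgx (S : Finset (Fin m)) (a : Ex t m) : Ex t m := fun z => a (z.1, sg S z.2)

theorem sgx_flip (S : Finset (Fin m)) (T : Finset (Fin t)) (a : Ex t m) :
    sgx S (flip p T a) = flip p T (sgx S a) := by
  funext z
  simp only [sgx, flip, sg_swap]

theorem neg_pow_pp (hp : Odd p) (l n : ℕ) : ((-1 : K)) ^ (p ^ l * n) = (-1) ^ n := by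
  rw [pow_mul, Odd.neg_one_pow (hp.pow)]

def sgn (K : Type) [Field K] (S : Finset (Fin m)) (a : Ex t m) : K :=
  ∏ l : Fin t, ∏ k : Fin m, if k ∈ S then (-1 : K) ^ (a (l, Sum.inr k)) else 1

def rho (K : Type) [Field K] (S : Finset (Fin m)) (a : Ex t m) : K :=
  ∏ l : Fin t, ∏ k : Fin m, if k ∈ S then (-1 : K) ^ (a (l, Sum.inr k)) *
    ((Nat.factorial (a (l, Sum.inl k)) : ℕ) : K) * ((Nat.factorial (a (l, Sum.inr k)) : ℕ) : K)⁻¹ else 1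

theorem mono_swp (hp : Odd p) (S : Finset (Fin m)) (a : Ex t m) (v : Ix m → K) :
    mono K p a (swp S v) = sgn K S a * mono K p (sgx S a) v := by
  have h1 : mono K p (sgx S a) v = ∏ l : Fin t, ∏ i : Ix m, (v (sg S i)) ^ (p ^ (l : ℕ) * a (l, i)) := by
    rw [mono, Fintype.prod_prod_type]
    refine Finset.prod_congr rfl fun l _ => ?_
    rw [← Equiv.prod_comp (sge S)]
    refine Finset.prod_congr rfl fun i _ => ?_
    simp only [sge, Equiv.coe_fn_mk, sgx, sg_sg]
  rw [h1, mono, Fintype.prod_prod_type, sgn, ← Finset.prod_mul_distrib]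
  refine Finset.prod_congr rfl fun l _ => ?_
  rw [Fintype.prod_sum_type, Fintype.prod_sum_type, mul_left_comm]
  refine congrArg₂ (· * ·) ?_ ?_
  · refine Finset.prod_congr rfl fun k _ => ?_
    by_cases h : k ∈ S <;> simp [swp, sg, h]
  · rw [← Finset.prod_mul_distrib]
    refine Finset.prod_congr rfl fun k _ => ?_
    by_cases h : k ∈ S <;> simp [swp, sg, h]
    rw [neg_pow, neg_pow_pp hp]

theorem fct_sgn (S : Finset (Fin m)) (a : Ex t m) (ha : Rd p a) :
    (fct K a)⁻¹ * sgn K S a = rho K S a * (fct K (sgx S a))⁻¹ := by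
  simp only [fct, sgn, rho, ← Finset.prod_inv_distrib, ← Finset.prod_mul_distrib]
  refine Finset.prod_congr rfl fun l _ => Finset.prod_congr rfl fun k _ => ?_
  have h1 := fact_ne (K := K) (p := p) _ (ha (l, Sum.inl k))
  have h2 := fact_ne (K := K) (p := p) _ (ha (l, Sum.inr k))
  by_cases h : k ∈ S
  · simp only [h, if_true, sgx, sg, Sum.elim_inr]
    field_simp
  · simp [h, sgx, sg]

theorem rho_flip (S : Finset (Fin m)) (T : Finset (Fin t)) (a : Ex t m) (ha : Rd p a) (hp : Odd p) :
    rho K S (flip p T a) = rho K S a := by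
  simp only [rho]
  refine Finset.prod_congr rfl fun l _ => Finset.prod_congr rfl fun k _ => ?_
  by_cases h : k ∈ S
  · simp only [h, if_true, flip]
    by_cases hl : l ∈ T
    · simp only [hl, if_true, Sum.swap_inl, Sum.swap_inr]
      have hb := ha (l, Sum.inr k)
      have hx := ha (l, Sum.inl k)
      set b := a (l, Sum.inr k)
      set x := a (l, Sum.inl k)
      have w1 := wilson (K := K) b hb
      have w2 := wilson (K := K) x hx
      have h1 := fact_ne (K := K) (p := p) _ hx
      have h2 := fact_ne (K := K) (p := p) _ hb
      have h3 := fact_ne (K := K) (p := p) (p - 1 - x) (by omega)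
      have h4 : (-1 : K) ^ (p - 1 - x) = (-1) ^ x := by
        have h5 : (-1 : K) ^ (p - 1 - x) * (-1) ^ x = 1 := by
          rw [← pow_add]
          refine Even.neg_one_pow ?_
          obtain ⟨r, hr⟩ := hp
          exact ⟨r, by omega⟩
        have h6 : (-1 : K) ^ x * (-1) ^ x = 1 := by
          rw [← pow_add]; exact Even.neg_one_pow ⟨x, rfl⟩
        have h7 : (-1 : K) ^ x ≠ 0 := pow_ne_zero _ (by simp)
        exact mul_right_cancel₀ h7 (h5.trans h6.symm)
      have h6 : (-1 : K) ^ x * (-1) ^ x = 1 := by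
        rw [← pow_add]; exact Even.neg_one_pow ⟨x, rfl⟩
      rw [h4]
      field_simp
      rw [pow_succ] at w1 w2
      linear_combination (-1 : K) ^ x * w1 - (-1) ^ b * w2
    · simp [hl]
  · simp [h]

theorem MM_swp (hp : Odd p) (S : Finset (Fin m)) (f : (Ix m → K) → K) (hf : f ∈ MM K p t m) :
    (fun v => f (swp S v)) ∈ MM K p t m := by
  induction hf using Submodule.span_induction with
  | mem x h =>
    obtain ⟨s, a, h1, h2, h3, -, rfl⟩ := h
    have h4 : Rd p (sgx S a) := fun z => h2 _
    have : (fun v => YJ K p (Jset m s) a (swp S v)) = rho K S a • YJ K p (Jset m s) (sgx S a) := by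
      funext v
      simp only [YJ, Finset.sum_apply, Pi.smul_apply, smul_eq_mul, Finset.mul_sum, wf]
      refine Finset.sum_congr rfl fun T _ => ?_
      rw [mono_swp hp, ← mul_assoc, fct_sgn (p := p) S _ (flip_rd T a h2), rho_flip S T a h2 hp, sgx_flip]
      ring
    rw [this]
    refine Submodule.smul_mem _ _ (Submodule.subset_span ⟨s, _, h1, h4, ?_, trivial, rfl⟩)
    intro j
    rw [← h3 j]
    congr 1
    exact Equiv.sum_comp (sge S) (fun i => a (j, i))
  | zero => exact Submodule.zero_mem _
  | add x y _ _ hx hy => exact Submodule.add_mem _ hx hy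
  | smul c x _ hx => exact Submodule.smul_mem _ c hx

end swaps
end PR

namespace PR
set_option linter.all false

section zj
variable {K : Type} [Field K] [Fintype K] {p t m : ℕ} [Fact p.Prime] [CharP K p]
  [NeZero t] [Fact (Fintype.card K = p ^ t)]

def fcJ (K : Type) [Field K] {t m : ℕ} (J : Finset (Fin t)) (a : Ex t m) : K :=
  ∏ j ∈ J, ∏ k : Fin m, ((Nat.factorial (a (j, Sum.inr k)) : ℕ) : K)

def ZJ (K : Type) [Field K] (p : ℕ) {t m : ℕ} (J : Finset (Fin t)) (a : Ex t m) :
    (Ix m → K) → K := ∑ T ∈ J.powerset, (fcJ K J (flip p T a))⁻¹ • mono K p (flip p T a)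

theorem flip_add_dl (T : Finset (Fin t)) (N : Ex t m) (n : ℕ) (j : Fin t) (i : Ix m) (hj : j ∉ T) :
    flip p T (N + n • dl (j, i)) = flip p T N + n • dl (j, i) := by
  funext z
  by_cases h : z.1 ∈ T
  · have h1 : z.1 ≠ j := fun e => hj (e ▸ h)
    have h2 : z ≠ (j, i) := fun e => h1 (by rw [e])
    have h3 : (z.1, z.2.swap) ≠ (j, i) := fun e => h1 (congrArg Prod.fst e)
    simp [flip, h, dl, Pi.single_apply, h2, h3]
  · simp [flip, h]

theorem fcJ_congr (J : Finset (Fin t)) (a b : Ex t m) (h : ∀ j ∈ J, ∀ i, a (j, i) = b (j, i)) :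
    fcJ K J a = fcJ K J b := by
  refine Finset.prod_congr rfl fun j hj => Finset.prod_congr rfl fun k _ => ?_
  rw [h j hj]

theorem ZJ_carry (J : Finset (Fin t)) (N : Ex t m) (j : Fin t) (i : Ix m) (h1 : j ∉ J) (h2 : j + 1 ∉ J) :
    ZJ K p J (N + p • dl (j, i)) = ZJ K p J (N + dl (j + 1, i)) := by
  unfold ZJ
  refine Finset.sum_congr rfl fun T hT => ?_
  rw [Finset.mem_powerset] at hT
  have e2 := flip_add_dl (p := p) T N 1 (j + 1) i (fun h => h2 (hT h))
  rw [one_smul] at e2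
  rw [flip_add_dl T N p j i (fun h => h1 (hT h)), e2, mono_carry]
  congr 2
  refine fcJ_congr _ _ _ fun l hl i' => ?_
  have e3 : (l, i') ≠ (j, i) := fun e => h1 (by rw [Prod.mk.injEq] at e; exact e.1 ▸ hl)
  have e4 : (l, i') ≠ (j + 1, i) := fun e => h2 (by rw [Prod.mk.injEq] at e; exact e.1 ▸ hl)
  simp [dl, Pi.single_apply, e3, e4]

theorem flip_insert (T : Finset (Fin t)) (N : Ex t m) (l : Fin t) (hl : l ∉ T) :
    flip p (insert l T) N = flip p T (flip p {l} N) := by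
  funext z
  by_cases h : z.1 ∈ T
  · have : z.1 ≠ l := fun e => hl (e ▸ h)
    simp [flip, h, this]
  · simp [flip, h]

theorem ZJ_insert (J : Finset (Fin t)) (N : Ex t m) (l : Fin t) (hl : l ∉ J) :
    ∃ c c' : K, ZJ K p (insert l J) N = c • ZJ K p J N + c' • ZJ K p J (flip p {l} N) := by
  have key : ∀ N : Ex t m, ∀ T ∈ J.powerset, (fcJ K (insert l J) (flip p T N))⁻¹ =
      (∏ k : Fin m, ((Nat.factorial (N (l, Sum.inr k)) : ℕ) : K))⁻¹ * (fcJ K J (flip p T N))⁻¹ := by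
    intro N T hT
    rw [Finset.mem_powerset] at hT
    rw [fcJ, Finset.prod_insert hl, mul_inv, fcJ]
    congr 3
    funext k
    have : l ∉ T := fun h => hl (hT h)
    simp [flip, this]
  refine ⟨(∏ k : Fin m, ((Nat.factorial (N (l, Sum.inr k)) : ℕ) : K))⁻¹,
    (∏ k : Fin m, ((Nat.factorial (flip p {l} N (l, Sum.inr k)) : ℕ) : K))⁻¹, ?_⟩
  rw [ZJ, Finset.sum_powerset_insert hl, ZJ, ZJ, Finset.smul_sum, Finset.smul_sum]
  refine congrArg₂ (· + ·) (Finset.sum_congr rfl fun T hT => ?_) (Finset.sum_congr rfl fun T hT => ?_)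
  · rw [key _ _ hT, mul_smul]
  · have : l ∉ T := fun h => hl (Finset.mem_powerset.1 hT h)
    rw [flip_insert T N l this, key _ _ hT, mul_smul]

theorem flip1_HT (s : Fin t → ℕ) (l : Fin t) (hl : l ∈ Jset m s) (N : Ex t m)
    (h : ∀ i, N (l, i) < p) (ha : HT p N s) :
    HT p (flip p {l} N) s ∧ size (flip p {l} N) = size N := by
  have key : ∀ j, ∑ i, flip p {l} N (j, i) = ∑ i, N (j, i) := by
    intro j
    by_cases hj : j = l
    · subst hj
      have hd := J_deg s N ha j hl
      have h1 : ∑ i, flip p {j} N (j, i) + ∑ i, N (j, i) = 2 * m * (p - 1) := by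
        rw [← sum_swap (fun i => N (j, i)), ← Finset.sum_add_distrib]
        rw [Finset.sum_congr rfl (g := fun _ => p - 1)]
        · simp only [Finset.sum_const, Finset.card_univ, Fintype.card_sum, Fintype.card_fin, smul_eq_mul]; ring
        · intro i _
          have := h i.swap
          simp only [flip, Finset.mem_singleton, if_true]
          omega
      rw [hd] at h1 ⊢
      nlinarith
    · simp [flip, hj]
  constructor
  · intro j; rw [key]; exact ha j
  · simp only [size, Fintype.sum_prod_type, key]

theorem ZJ_red (s : Fin t → ℕ) (N : Ex t m) (ha : HT p N s) (hs : ∀ j, s j ≤ m) (hN : Rd p N) :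
    ZJ K p (Jset m s) N ∈ MM K p t m := by
  have hSm : Sm m s := by
    by_cases h : ∃ j, s j = 0
    · obtain ⟨j, hj⟩ := h
      exact Or.inr (HT_pos s N ha j hj)
    · push Not at h
      exact Or.inl fun j => ⟨Nat.one_le_iff_ne_zero.2 (h j), hs j⟩
  have : ZJ K p (Jset m s) N = fcJ K (Jset m s)ᶜ N • YJ K p (Jset m s) N := by
    rw [ZJ, YJ, Finset.smul_sum]
    refine Finset.sum_congr rfl fun T hT => ?_
    rw [Finset.mem_powerset] at hT
    rw [wf, smul_smul]
    congr 1
    have h1 : fct K (flip p T N) = fcJ K (Jset m s) (flip p T N) * fcJ K (Jset m s)ᶜ N := by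
      rw [fct, ← Finset.prod_mul_prod_compl (Jset m s)]
      refine congrArg₂ (· * ·) rfl ?_
      refine fcJ_congr _ _ _ fun j hj i => ?_
      have : j ∉ T := fun h => (Finset.mem_compl.1 hj) (hT h)
      simp [flip, this]
    have h2 := fct_ne (K := K) (p := p) _ (flip_rd T N hN)
    rw [h1] at h2 ⊢
    have h3 := left_ne_zero_of_mul h2
    have h4 := right_ne_zero_of_mul h2
    field_simp
  rw [this]
  exact Submodule.smul_mem _ _ (Submodule.subset_span ⟨s, N, hSm, hN, ha, trivial, rfl⟩)

theorem ZJ_mem (n : ℕ) : ∀ (N : Ex t m) (s : Fin t → ℕ) (J : Finset (Fin t)), size N = n →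
    HT p N s → (∀ j, s j ≤ m) → J ⊆ Jset m s → (∀ l ∈ J, ∀ i, N (l, i) < p) →
    (∀ l ∈ Jset m s, l ∉ J → ∃ i, p ≤ N (l, i)) → ZJ K p J N ∈ MM K p t m := by
  have hp : 2 ≤ p := (Fact.out : p.Prime).two_le
  induction n using Nat.strong_induction_on with
  | _ n ih =>
    -- the carry step
    have step : ∀ (N : Ex t m) (s : Fin t → ℕ) (J : Finset (Fin t)) (j : Fin t) (i : Ix m), size N = n →
        HT p N s → (∀ j, s j ≤ m) → J ⊆ Jset m s → (∀ l ∈ J, ∀ i, N (l, i) < p) →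
        j ∉ J → j + 1 ∉ J → p ≤ N (j, i) →
        (∀ l ∈ Jset m s, l ∉ J → l ≠ j → l ≠ j + 1 → ∃ i, p ≤ N (l, i)) → ZJ K p J N ∈ MM K p t m := by
      intro N s J j i hn hH hs hJ hr hj hj1 hN hu
      obtain ⟨N0, rfl⟩ := exists_sub N (j, i) p hN
      rw [ZJ_carry J N0 j i hj hj1]
      obtain ⟨c1, c2⟩ := HT_carry s N0 j i hH
      have hlev : ∀ l, l ≠ j → l ≠ j + 1 → ∀ i', (N0 + dl (j + 1, i) : Ex t m) (l, i') = (N0 + p • dl (j, i)) (l, i') := by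
        intro l h1 h2 i'
        have e3 : (l, i') ≠ (j, i) := fun e => h1 (congrArg Prod.fst e)
        have e4 : (l, i') ≠ (j + 1, i) := fun e => h2 (congrArg Prod.fst e)
        simp [dl, Pi.single_apply, e3, e4]
      have hs1 : ∀ l, l ≠ j + 1 → (s - Pi.single (j + 1) 1 : Fin t → ℕ) l = s l := by
        intro l hl
        simp [Pi.single_apply, hl]
      have hs2 : (s - Pi.single (j + 1) 1 : Fin t → ℕ) (j + 1) < m := by
        have := hs (j + 1)
        simp only [Pi.sub_apply, Pi.single_eq_same]
        omega
      have hJs : ∀ l, l ∈ Jset m (s - Pi.single (j + 1) 1) ↔ l ∈ Jset m s ∧ l ≠ j ∧ l ≠ j + 1 := by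
        intro l
        rw [mem_Jset, mem_Jset]
        constructor
        · rintro ⟨h1, h2⟩
          have a1 : l ≠ j := by rintro rfl; omega
          have a2 : l ≠ j + 1 := by rintro rfl; omega
          have a3 : l + 1 ≠ j + 1 := fun e => a1 (add_right_cancel e)
          rw [hs1 _ a2] at h1
          rw [hs1 _ a3] at h2
          exact ⟨⟨h1, h2⟩, a1, a2⟩
        · rintro ⟨⟨h1, h2⟩, a1, a2⟩
          have a3 : l + 1 ≠ j + 1 := fun e => a1 (add_right_cancel e)
          rw [hs1 _ a2, hs1 _ a3]
          exact ⟨h1, h2⟩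
      refine ih (size (N0 + dl (j + 1, i))) ?_ _ (s - Pi.single (j + 1) 1) J rfl c2 ?_ ?_ ?_ ?_
      · rw [← hn, size_add, size_add, size_smul, size_dl, size_dl]
        omega
      · intro l
        have := hs l
        simp only [Pi.sub_apply]
        omega
      · intro l hl
        rw [hJs]
        exact ⟨hJ hl, fun e => hj (e ▸ hl), fun e => hj1 (e ▸ hl)⟩
      · intro l hl i'
        rw [hlev l (fun e => hj (e ▸ hl)) (fun e => hj1 (e ▸ hl))]
        exact hr l hl i'
      · intro l hl hlJ
        rw [hJs] at hl
        obtain ⟨i', hi'⟩ := hu l hl.1 hlJ hl.2.1 hl.2.2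
        exact ⟨i', by rw [hlev l hl.2.1 hl.2.2]; exact hi'⟩
    intro N s J hn hH hs hJ hr hu
    by_cases hR : Rd p N
    · have : J = Jset m s := by
        refine Finset.Subset.antisymm hJ fun l hl => ?_
        by_contra h
        obtain ⟨i, hi⟩ := hu l hl h
        have := hR (l, i)
        omega
      rw [this]
      exact ZJ_red s N hH hs hR
    · rw [Rd] at hR
      push Not at hR
      obtain ⟨⟨j, i⟩, hji⟩ := hR
      have hjJ : j ∉ J := fun h => by
        have := hr j h i
        omega
      by_cases hj1 : j + 1 ∈ J
      · have hne : j ≠ j + 1 := fun e => hjJ (e ▸ hj1)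
        obtain ⟨c, c', e⟩ := ZJ_insert (K := K) (p := p) (J.erase (j + 1)) N (j + 1) (Finset.notMem_erase _ _)
        rw [Finset.insert_erase hj1] at e
        rw [e]
        obtain ⟨f1, f2⟩ := flip1_HT s (j + 1) (hJ hj1) N (hr _ hj1) hH
        have fl : ∀ l, l ≠ j + 1 → ∀ i, flip p {j + 1} N (l, i) = N (l, i) := by
          intro l hl i
          simp [flip, hl]
        refine Submodule.add_mem _ (Submodule.smul_mem _ _ ?_) (Submodule.smul_mem _ _ ?_)
        · refine step N s _ j i hn hH hs ((Finset.erase_subset _ _).trans hJ) ?_ ?_ (Finset.notMem_erase _ _) hji ?_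
          · intro l hl; exact hr l (Finset.mem_of_mem_erase hl)
          · intro h; exact hjJ (Finset.mem_of_mem_erase h)
          · intro l hl hlJ h1 h2
            refine hu l hl fun h => hlJ (Finset.mem_erase.2 ⟨h2, h⟩)
        · refine step _ s _ j i (f2.trans hn) f1 hs ((Finset.erase_subset _ _).trans hJ) ?_ ?_ (Finset.notMem_erase _ _) ?_ ?_
          · intro l hl i
            rw [fl l (Finset.ne_of_mem_erase hl)]
            exact hr l (Finset.mem_of_mem_erase hl) i
          · intro h; exact hjJ (Finset.mem_of_mem_erase h)
          · rw [fl _ hne]; exact hji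
          · intro l hl hlJ h1 h2
            obtain ⟨i, hi⟩ := hu l hl fun h => hlJ (Finset.mem_erase.2 ⟨h2, h⟩)
            exact ⟨i, by rw [fl l h2]; exact hi⟩
      · exact step N s J j i hn hH hs hJ hr hjJ hj1 hji (fun l hl hlJ _ _ => hu l hl hlJ)

end zj
end PR

namespace PR
set_option linter.all false

section zprod
variable {K : Type} [Field K] [Fintype K] {p t m : ℕ} [Fact p.Prime] [CharP K p]
  [NeZero t] [Fact (Fintype.card K = p ^ t)]

def lm (K : Type) [Field K] {m : ℕ} (c : Ix m → ℕ) : (Ix m → K) → K := fun v => ∏ i, v i ^ c i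

def flc (p : ℕ) {m : ℕ} (c : Ix m → ℕ) : Ix m → ℕ := fun i => p - 1 - c i.swap

def fc1 (K : Type) [Field K] {m : ℕ} (c : Ix m → ℕ) : K := ∏ k : Fin m, ((Nat.factorial (c (Sum.inr k)) : ℕ) : K)

def zc (K : Type) [Field K] (p : ℕ) {m : ℕ} (c : Ix m → ℕ) : (Ix m → K) → K :=
  (fc1 K (flc p c))⁻¹ • lm K (flc p c) + (fc1 K c)⁻¹ • lm K c

def HS (K : Type) [Field K] (p m r : ℕ) : Set ((Ix m → K) → K) :=
  {f | ∃ c : Ix m → ℕ, ∑ i, c i = r * (p - 1) ∧ f = if r = m ∧ ∀ i, c i < p then zc K p c else lm K c}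

theorem nat_frob (n l : ℕ) : ((n : ℕ) : K) ^ (p ^ l) = n := by
  have := map_natCast (iterateFrobenius K p l) n
  rwa [iterateFrobenius_def] at this

theorem fc1_frob (c : Ix m → ℕ) (l : ℕ) : (fc1 K c) ^ (p ^ l) = fc1 K c := by
  have : fc1 K c = ((∏ k : Fin m, Nat.factorial (c (Sum.inr k)) : ℕ) : K) := by
    simp [fc1]
  rw [this, nat_frob]

theorem mono_lm (N : Ex t m) (v : Ix m → K) :
    mono K p N v = ∏ l : Fin t, (lm K (fun i => N (l, i)) v) ^ (p ^ (l : ℕ)) := by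
  rw [mono, Fintype.prod_prod_type]
  refine Finset.prod_congr rfl fun l _ => ?_
  rw [lm, ← Finset.prod_pow]
  refine Finset.prod_congr rfl fun i _ => ?_
  rw [← pow_mul, mul_comm]

theorem ZJ_prod (J : Finset (Fin t)) (N : Ex t m) :
    ∏ l : Fin t, (if l ∈ J then zc K p (fun i => N (l, i)) else lm K (fun i => N (l, i))) ^ (p ^ (l : ℕ)) =
      ZJ K p J N := by
  funext v
  rw [Finset.prod_apply, ← Finset.prod_mul_prod_compl J, ZJ, Finset.sum_apply]
  have h1 : ∀ l ∈ J, ((if l ∈ J then zc K p (fun i => N (l, i)) else lm K (fun i => N (l, i))) ^ (p ^ (l : ℕ))) v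
      = (fc1 K (flc p (fun i => N (l, i))))⁻¹ * lm K (flc p (fun i => N (l, i))) v ^ (p ^ (l : ℕ)) +
        (fc1 K ((fun i => N (l, i))))⁻¹ * lm K (fun i => N (l, i)) v ^ (p ^ (l : ℕ)) := by
    intro l hl
    rw [if_pos hl, Pi.pow_apply, zc, Pi.add_apply, add_pow_char_pow, Pi.smul_apply, Pi.smul_apply,
      smul_eq_mul, smul_eq_mul, mul_pow, mul_pow, inv_pow, inv_pow, fc1_frob, fc1_frob]
  have h2 : ∏ l ∈ Jᶜ, ((if l ∈ J then zc K p (fun i => N (l, i)) else lm K (fun i => N (l, i))) ^ (p ^ (l : ℕ))) v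
      = ∏ l ∈ Jᶜ, lm K (fun i => N (l, i)) v ^ (p ^ (l : ℕ)) := by
    refine Finset.prod_congr rfl fun l hl => ?_
    rw [if_neg (Finset.mem_compl.1 hl), Pi.pow_apply]
  rw [Finset.prod_congr rfl h1, h2, Finset.prod_add, Finset.sum_mul]
  refine Finset.sum_congr rfl fun T hT => ?_
  rw [Finset.mem_powerset] at hT
  rw [Pi.smul_apply, smul_eq_mul, mono_lm, ← Finset.prod_mul_prod_compl J, ← mul_assoc]
  refine congrArg₂ (· * ·) ?_ ?_
  · rw [fcJ, ← Finset.prod_inv_distrib, ← Finset.prod_mul_distrib, ← Finset.prod_sdiff hT, mul_comm]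
    refine congrArg₂ (· * ·) ?_ ?_
    · refine Finset.prod_congr rfl fun l hl => ?_
      have : l ∉ T := (Finset.mem_sdiff.1 hl).2
      simp [flip, this, fc1]
    · refine Finset.prod_congr rfl fun l hl => ?_
      simp only [flip, hl, fc1, flc, if_true]
      rfl
  · refine Finset.prod_congr rfl fun l hl => ?_
    have : l ∉ T := fun h => Finset.mem_compl.1 hl (hT h)
    simp [flip, this]

theorem HS_prod (r : ℕ) (hr : r ≤ m) (g : Fin t → (Ix m → K) → K) (hg : ∀ l, g l ∈ HS K p m r) :
    ∏ l : Fin t, g l ^ (p ^ (l : ℕ)) ∈ MM K p t m := by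
  have hp : 2 ≤ p := (Fact.out : p.Prime).two_le
  choose c hc1 hc2 using hg
  set N : Ex t m := fun z => c z.1 z.2 with hN
  set J : Finset (Fin t) := Finset.univ.filter (fun l => r = m ∧ ∀ i, c l i < p) with hJ
  have h1 : ∏ l : Fin t, g l ^ (p ^ (l : ℕ)) = ZJ K p J N := by
    rw [← ZJ_prod]
    refine Finset.prod_congr rfl fun l _ => ?_
    rw [hc2 l]
    simp only [hJ, Finset.mem_filter, Finset.mem_univ, true_and, hN]
  rw [h1]
  refine ZJ_mem _ N (fun _ => r) J rfl ?_ (fun _ => hr) ?_ ?_ ?_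
  · intro j
    simp only [hN, hc1]
    obtain ⟨p', rfl⟩ : ∃ p', p = p' + 1 := ⟨p - 1, by omega⟩
    simp
    ring
  · intro l hl
    rw [mem_Jset]
    simp only [hJ, Finset.mem_filter] at hl
    exact ⟨hl.2.1, hl.2.1⟩
  · intro l hl i
    simp only [hJ, Finset.mem_filter] at hl
    exact hl.2.2 i
  · intro l hl hlJ
    rw [mem_Jset] at hl
    by_contra hh
    push Not at hh
    apply hlJ
    simp only [hJ, Finset.mem_filter, Finset.mem_univ, true_and]
    exact ⟨hl.1, hh⟩

theorem frob_span (S : Set ((Ix m → K) → K)) (h : (Ix m → K) → K) (hh : h ∈ Submodule.span K S) (l : ℕ) :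
    h ^ (p ^ l) ∈ Submodule.span K ((fun g => g ^ (p ^ l)) '' S) := by
  have hp : 2 ≤ p := (Fact.out : p.Prime).two_le
  induction hh using Submodule.span_induction with
  | mem x hx => exact Submodule.subset_span ⟨x, hx, rfl⟩
  | zero =>
    rw [zero_pow (by positivity)]
    exact Submodule.zero_mem _
  | add x y _ _ hx hy =>
    have : (x + y) ^ (p ^ l) = x ^ (p ^ l) + y ^ (p ^ l) := by
      funext v
      simp only [Pi.pow_apply, Pi.add_apply, add_pow_char_pow]
    rw [this]
    exact Submodule.add_mem _ hx hy
  | smul c x _ hx =>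
    rw [smul_pow]
    exact Submodule.smul_mem _ _ hx

theorem prod_mem_prodS {A ι : Type} [CommRing A] [Algebra K A] (s : Finset ι) (f : ι → A)
    (M : ι → Submodule K A) (h : ∀ i ∈ s, f i ∈ M i) : ∏ i ∈ s, f i ∈ ∏ i ∈ s, M i := by
  induction s using Finset.induction_on with
  | empty => simp only [Finset.prod_empty]; exact Submodule.one_le.1 le_rfl
  | insert a s ha ih =>
    rw [Finset.prod_insert ha, Finset.prod_insert ha]
    exact Submodule.mul_mem_mul (h a (Finset.mem_insert_self _ _))
      (ih fun i hi => h i (Finset.mem_insert_of_mem hi))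

theorem span_prod_MM (r : ℕ) (hr : r ≤ m) (h : (Ix m → K) → K) (hh : h ∈ Submodule.span K (HS K p m r)) :
    ∏ l : Fin t, h ^ (p ^ (l : ℕ)) ∈ MM K p t m := by
  have h1 : ∏ l : Fin t, h ^ (p ^ (l : ℕ)) ∈
      ∏ l : Fin t, Submodule.span K ((fun g => g ^ (p ^ (l : ℕ))) '' (HS K p m r)) :=
    prod_mem_prodS _ _ _ fun l _ => frob_span _ h hh _
  rw [Submodule.prod_span] at h1
  refine (Submodule.span_le.2 ?_) h1
  intro f hf
  rw [Set.mem_fintype_prod] at hf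
  obtain ⟨g, hg, rfl⟩ := hf
  choose g' hg1 hg2 using hg
  have := HS_prod (t := t) r hr g' hg1
  rwa [Finset.prod_congr rfl (fun l _ => (hg2 l))] at this

end zprod
end PR

namespace PR
set_option linter.all false

section expand
variable {K : Type} [Field K] [Fintype K] {p t m : ℕ} [Fact p.Prime] [CharP K p]
  [NeZero t] [Fact (Fintype.card K = p ^ t)]

def ell {K : Type} [Field K] {m : ℕ} (B : Fin m → Fin m → K) (i : Fin m) : (Ix m → K) → K :=
  fun v => v (Sum.inr i) + ∑ k, B i k * v (Sum.inl k)

def Hom (K : Type) [Field K] (m d : ℕ) : Submodule K ((Ix m → K) → K) :=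
  Submodule.span K {f | ∃ c : Ix m → ℕ, ∑ i, c i = d ∧ f = lm K c}

theorem lm_add (c c' : Ix m → ℕ) : lm K c * lm K c' = lm K (c + c') := by
  funext v
  simp [lm, pow_add, Finset.prod_mul_distrib]

theorem lm_single (i : Ix m) : lm K (Pi.single i 1) = fun v => v i := by
  funext v
  rw [lm, Finset.prod_eq_single i]
  · simp
  · intro j _ hj; simp [hj]
  · simp

theorem Hom_mul (d d' : ℕ) (f g : (Ix m → K) → K) (hf : f ∈ Hom K m d) (hg : g ∈ Hom K m d') :
    f * g ∈ Hom K m (d + d') := by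
  have h := Submodule.mul_mem_mul hf hg
  rw [Hom, Hom, Submodule.span_mul_span] at h
  refine Submodule.span_mono ?_ h
  rintro _ ⟨_, ⟨c, hc, rfl⟩, _, ⟨c', hc', rfl⟩, rfl⟩
  exact ⟨c + c', by simp [Finset.sum_add_distrib, hc, hc'], lm_add c c'⟩

theorem Hom_one : (1 : (Ix m → K) → K) ∈ Hom K m 0 :=
  Submodule.subset_span ⟨0, by simp, by funext v; simp [lm]⟩

theorem Hom_pow (d n : ℕ) (f : (Ix m → K) → K) (hf : f ∈ Hom K m d) : f ^ n ∈ Hom K m (n * d) := by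
  induction n with
  | zero => simpa using Hom_one
  | succ n ih =>
    rw [pow_succ, Nat.succ_mul]
    exact Hom_mul _ _ _ _ ih hf

theorem Hom_prod {ι : Type} (T : Finset ι) (d : ℕ) (f : ι → (Ix m → K) → K) (hf : ∀ i ∈ T, f i ∈ Hom K m d) :
    ∏ i ∈ T, f i ∈ Hom K m (T.card * d) := by
  induction T using Finset.induction_on with
  | empty => simpa using Hom_one
  | insert a s ha ih =>
    rw [Finset.prod_insert ha, Finset.card_insert_of_notMem ha, Nat.succ_mul, add_comm]
    exact Hom_mul _ _ _ _ (hf a (Finset.mem_insert_self _ _))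
      (ih fun i hi => hf i (Finset.mem_insert_of_mem hi))

theorem ell_Hom (B : Fin m → Fin m → K) (i : Fin m) : ell B i ∈ Hom K m 1 := by
  have hv : ∀ i : Ix m, (fun v : Ix m → K => v i) ∈ Hom K m 1 := fun i =>
    Submodule.subset_span ⟨Pi.single i 1, by simp, (lm_single i).symm⟩
  have : ell B i = (fun v : Ix m → K => v (Sum.inr i)) + ∑ k, B i k • (fun v : Ix m → K => v (Sum.inl k)) := by
    funext v
    simp [ell]
  rw [this]
  exact Submodule.add_mem _ (hv _) (Submodule.sum_mem _ fun k _ => Submodule.smul_mem _ _ (hv _))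

theorem partial_prod (B : Fin m → Fin m → K) (T : Finset (Fin m)) (hT : T.card ≠ m) :
    ∏ i ∈ T, ell B i ^ (p - 1) ∈ Submodule.span K (HS K p m T.card) := by
  have h1 : ∏ i ∈ T, ell B i ^ (p - 1) ∈ Hom K m (T.card * (p - 1)) := by
    refine Hom_prod T _ _ fun i _ => ?_
    have := Hom_pow 1 (p - 1) _ (ell_Hom B i)
    rwa [mul_one] at this
  refine Submodule.span_mono ?_ h1
  rintro _ ⟨c, hc, rfl⟩
  exact ⟨c, hc, by simp [hT]⟩

/-- exponent of a term -/
def cN (N : Fin m → Option (Fin m) → ℕ) : Ix m → ℕ :=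
  Sum.elim (fun k => ∑ i, N i (some k)) (fun i => N i none)

def kap {K : Type} [Field K] (p : ℕ) {m : ℕ} (B : Fin m → Fin m → K) (N : Fin m → Option (Fin m) → ℕ) : K :=
  ∏ i : Fin m, (((Nat.factorial (p - 1) : ℕ) : K) *
    ∏ k : Fin m, (((Nat.factorial (N i (some k)) : ℕ) : K)⁻¹ * B i k ^ N i (some k)))

def Nset (p m : ℕ) : Finset (Fin m → Option (Fin m) → ℕ) :=
  Fintype.piFinset fun _ => Finset.piAntidiag Finset.univ (p - 1)

theorem mem_Nset (N : Fin m → Option (Fin m) → ℕ) :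
    N ∈ Nset p m ↔ ∀ i, N i none + ∑ k, N i (some k) = p - 1 := by
  simp [Nset, Fintype.sum_option]

theorem full_expand (B : Fin m → Fin m → K) :
    ∏ i, ell B i ^ (p - 1) = ∑ N ∈ Nset p m, (kap p B N * (fc1 K (cN N))⁻¹) • lm K (cN N) := by
  have hp : 2 ≤ p := (Fact.out : p.Prime).two_le
  funext v
  rw [Finset.prod_apply, Finset.sum_apply]
  have h1 : ∀ i, (ell B i ^ (p - 1)) v = ∑ n ∈ Finset.piAntidiag (Finset.univ : Finset (Option (Fin m))) (p - 1),
      (Nat.multinomial Finset.univ n : K) * ∏ o : Option (Fin m), (match o with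
        | none => v (Sum.inr i)
        | some k => B i k * v (Sum.inl k)) ^ n o := by
    intro i
    rw [← Finset.sum_pow_eq_sum_piAntidiag, Fintype.sum_option]
    rfl
  rw [Finset.prod_congr rfl (fun i _ => h1 i)]
  rw [Finset.prod_univ_sum]
  refine Finset.sum_congr rfl fun N hN => ?_
  have hN' := (mem_Nset N).1 hN
  simp only [Pi.smul_apply, smul_eq_mul, kap, fc1, lm, Fintype.prod_sum_type, cN, Sum.elim_inl, Sum.elim_inr,
    Fintype.prod_option]
  have h2 : ∏ k : Fin m, v (Sum.inl k) ^ (∑ i, N i (some k)) = ∏ i : Fin m, ∏ k : Fin m, v (Sum.inl k) ^ N i (some k) := by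
    rw [Finset.prod_comm]
    exact Finset.prod_congr rfl fun k _ => (Finset.prod_pow_eq_pow_sum _ _ _).symm
  rw [h2, ← Finset.prod_inv_distrib, ← Finset.prod_mul_distrib, ← Finset.prod_mul_distrib, ← Finset.prod_mul_distrib]
  refine Finset.prod_congr rfl fun i _ => ?_
  have h3 : (Nat.multinomial Finset.univ (N i) : K) = ((Nat.factorial (p - 1) : ℕ) : K) *
      (∏ k : Fin m, ((Nat.factorial (N i (some k)) : ℕ) : K)⁻¹) * (((Nat.factorial (N i none) : ℕ) : K))⁻¹ := by
    have h4 := Nat.multinomial_spec (Finset.univ : Finset (Option (Fin m))) (N i)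
    rw [Fintype.sum_option, hN' i, Fintype.prod_option] at h4
    have h5 := congrArg (Nat.cast : ℕ → K) h4
    push_cast at h5
    rw [Finset.prod_inv_distrib, ← h5]
    have e1 : ((Nat.factorial (N i none) : ℕ) : K) ≠ 0 := fact_ne (p := p) _ (by have := hN' i; omega)
    have e2 : ∏ k : Fin m, ((Nat.factorial (N i (some k)) : ℕ) : K) ≠ 0 := by
      refine Finset.prod_ne_zero_iff.2 fun k _ => fact_ne (p := p) _ ?_
      have := hN' i
      have := Finset.single_le_sum (f := fun k => N i (some k)) (fun _ _ => Nat.zero_le _) (Finset.mem_univ k)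
      omega
    field_simp
  rw [h3]
  simp only [mul_pow, Finset.prod_mul_distrib]
  ring

def trN (p : ℕ) {m : ℕ} (N : Fin m → Option (Fin m) → ℕ) : Fin m → Option (Fin m) → ℕ :=
  fun i o => match o with
    | none => p - 1 - ∑ k, N k (some i)
    | some k => N k (some i)

theorem full_prod (hp3 : 3 ≤ p) (B : Fin m → Fin m → K) (hB : ∀ i k, B i k = B k i) :
    ∏ i, ell B i ^ (p - 1) ∈ Submodule.span K (HS K p m m) := by
  rw [full_expand, ← Finset.sum_filter_add_sum_filter_not _ (fun N => ∀ i, cN N i < p)]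
  have hsum : ∀ N ∈ Nset p m, ∑ i, cN N i = m * (p - 1) := by
    intro N hN
    rw [mem_Nset] at hN
    simp only [Fintype.sum_sum_type, cN, Sum.elim_inl, Sum.elim_inr]
    rw [Finset.sum_comm, ← Finset.sum_add_distrib]
    rw [Finset.sum_congr rfl (fun i _ => (add_comm _ _).trans (hN i))]
    simp
  refine Submodule.add_mem _ ?_ ?_
  · set S := (Nset p m).filter (fun N => ∀ i, cN N i < p) with hS
    set F : (Fin m → Option (Fin m) → ℕ) → (Ix m → K) → K :=
      fun N => (kap p B N * (fc1 K (cN N))⁻¹) • lm K (cN N) with hF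
    have hmem : ∀ N, N ∈ S ↔ (∀ i, N i none + ∑ k, N i (some k) = p - 1) ∧ ∀ i, cN N i < p := by
      intro N
      rw [hS, Finset.mem_filter, mem_Nset]
    have htc : ∀ N ∈ S, cN (trN p N) = flc p (cN N) := by
      intro N hN
      rw [hmem] at hN
      funext i
      rcases i with k | k
      · have := hN.1 k
        simp only [cN, trN, flc, Sum.elim_inl, Sum.swap_inl, Sum.elim_inr]
        omega
      · simp only [cN, trN, flc, Sum.elim_inl, Sum.swap_inr, Sum.elim_inr]
    have htS : ∀ N ∈ S, trN p N ∈ S := by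
      intro N hN
      have h1 := htc N hN
      rw [hmem] at hN ⊢
      constructor
      · intro i
        have := hN.2 (Sum.inl i)
        simp only [cN, Sum.elim_inl] at this
        simp only [trN]
        omega
      · intro i
        rw [h1, flc]
        omega
    have htt : ∀ N ∈ S, trN p (trN p N) = N := by
      intro N hN
      rw [hmem] at hN
      funext i o
      rcases o with _ | k
      · have := hN.1 i
        simp only [trN]
        omega
      · rfl
    have hk : ∀ N, kap p B (trN p N) = kap p B N := by
      intro N
      simp only [kap, trN, Finset.prod_mul_distrib]
      rw [Finset.prod_comm (f := fun x x_1 => ((Nat.factorial (N x_1 (some x)) : ℕ) : K)⁻¹),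
        Finset.prod_comm (f := fun x x_1 => B x x_1 ^ (N x_1 (some x)))]
      simp only [hB]
    have h1 : ∑ N ∈ S, F N = ∑ N ∈ S, F (trN p N) :=
      (Finset.sum_nbij' (trN p) (trN p) htS htS htt htt (fun N hN => rfl)).symm
    have h2 : (2 : K) • ∑ N ∈ S, F N = ∑ N ∈ S, (kap p B N) • zc K p (cN N) := by
      rw [two_smul]
      nth_rewrite 1 [h1]
      rw [← Finset.sum_add_distrib]
      refine Finset.sum_congr rfl fun N hN => ?_
      simp only [hF, htc N hN, hk, zc, smul_add, smul_smul]
    have h20 : (2 : K) ≠ 0 := by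
      have := nat_ne (K := K) (p := p) 2 (by omega) (by omega)
      simpa using this
    refine (Submodule.smul_mem_iff _ h20).1 ?_
    rw [h2]
    refine Submodule.sum_mem _ fun N hN => Submodule.smul_mem _ _ (Submodule.subset_span ⟨cN N, ?_, ?_⟩)
    · exact hsum N (Finset.mem_filter.1 hN).1
    · rw [if_pos ⟨rfl, (Finset.mem_filter.1 hN).2⟩]
  · refine Submodule.sum_mem _ fun N hN => Submodule.smul_mem _ _ (Submodule.subset_span ⟨cN N, ?_, ?_⟩)
    · exact hsum N (Finset.mem_filter.1 hN).1
    · rw [if_neg (fun h => (Finset.mem_filter.1 hN).2 h.2)]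

theorem norm_mem (hp3 : 3 ≤ p) (B : Fin m → Fin m → K) (hB : ∀ i k, B i k = B k i) :
    (fun v => ∏ i, (1 - ell B i v ^ (p ^ t - 1))) ∈ MM K p t m := by
  have h1 : (fun v => ∏ i, (1 - ell B i v ^ (p ^ t - 1))) =
      ∑ T ∈ (Finset.univ : Finset (Fin m)).powerset, (-1 : K) ^ T.card •
        ∏ l : Fin t, (∏ i ∈ T, ell B i ^ (p - 1)) ^ (p ^ (l : ℕ)) := by
    funext v
    rw [Finset.sum_apply]
    simp only [sub_eq_add_neg]
    rw [Finset.prod_one_add]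
    refine Finset.sum_congr rfl fun T _ => ?_
    rw [Finset.prod_neg, Pi.smul_apply, smul_eq_mul]
    congr 1
    simp only [Finset.prod_apply, Pi.pow_apply, ← Finset.prod_pow]
    rw [Finset.prod_comm]
    refine Finset.prod_congr rfl fun i _ => ?_
    simp only [← pow_mul]
    rw [Finset.prod_pow_eq_pow_sum]
    congr 1
    have := geo_univ p t (by omega)
    simp only [mul_comm (p - 1)]
    omega
  rw [h1]
  refine Submodule.sum_mem _ fun T _ => Submodule.smul_mem _ _ ?_
  have hc : T.card ≤ m := by simpa using Finset.card_le_univ T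
  refine span_prod_MM T.card hc _ ?_
  by_cases hT : T.card = m
  · have : T = Finset.univ := by rw [← Finset.card_eq_iff_eq_univ]; simpa using hT
    rw [hT, this]
    exact full_prod hp3 B hB
  · exact partial_prod B T hT

end expand
end PR

namespace PR
set_option linter.all false

section lagr
variable {K : Type} [Field K] [Fintype K] {p t m : ℕ} [Fact p.Prime] [CharP K p]
  [NeZero t] [Fact (Fintype.card K = p ^ t)]

def swL (S : Finset (Fin m)) : (Ix m → K) →ₗ[K] (Ix m → K) where
  toFun := swp S
  map_add' u v := by
    funext i
    rcases i with k | k <;> by_cases h : k ∈ S <;> simp [swp, h]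
    ring
  map_smul' r v := by
    funext i
    rcases i with k | k <;> by_cases h : k ∈ S <;> simp [swp, h]

theorem swL_inj (S : Finset (Fin m)) (u v : Ix m → K) (h : swL S u = swL S v) : u = v := by
  funext i
  rcases i with k | k
  · by_cases hk : k ∈ S
    · have := congrFun h (Sum.inr k)
      simpa [swL, swp, hk] using this
    · have := congrFun h (Sum.inl k)
      simpa [swL, swp, hk] using this
  · by_cases hk : k ∈ S
    · have := congrFun h (Sum.inl k)
      simpa [swL, swp, hk] using this
    · have := congrFun h (Sum.inr k)
      simpa [swL, swp, hk] using this

theorem swL_bform (S : Finset (Fin m)) (u v : Ix m → K) : bform (swL S u) (swL S v) = bform u v := by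
  simp only [bform]
  refine Finset.sum_congr rfl fun k _ => ?_
  by_cases hk : k ∈ S <;> simp [swL, swp, hk]
  ring

theorem lag_S (W : Submodule K (Ix m → K)) (hW : Lag W) :
    ∃ S : Finset (Fin m), ∀ u ∈ W, (∀ k, swL S u (Sum.inl k) = 0) → u = 0 := by
  set A : Finset (Fin m) → Finset (Ix m → K) := fun S =>
    Finset.univ.filter (fun u => u ∈ W ∧ ∀ k, swL S u (Sum.inl k) = 0) with hA
  obtain ⟨S, -, hS⟩ := Finset.exists_min_image (Finset.univ : Finset (Finset (Fin m))) (fun S => (A S).card)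
    ⟨∅, Finset.mem_univ _⟩
  refine ⟨S, fun w hw h0 => ?_⟩
  by_contra hne
  have : ∃ k, swL S w (Sum.inr k) ≠ 0 := by
    by_contra hh
    push Not at hh
    apply hne
    apply swL_inj S
    rw [map_zero]
    funext i
    rcases i with k | k
    · exact h0 k
    · exact hh k
  obtain ⟨k, hk⟩ := this
  set S' := symmDiff S {k} with hS'
  have hS1 : ∀ l, l ≠ k → (l ∈ S' ↔ l ∈ S) := by
    intro l hl
    simp [hS', Finset.mem_symmDiff, hl]
  have hS2 : k ∈ S' ↔ k ∉ S := by
    simp [hS', Finset.mem_symmDiff]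
  have hsub : A S' ⊂ A S := by
    rw [Finset.ssubset_iff_of_subset]
    · refine ⟨w, ?_, ?_⟩
      · simp only [hA, Finset.mem_filter, Finset.mem_univ, true_and]
        exact ⟨hw, h0⟩
      · simp only [hA, Finset.mem_filter, Finset.mem_univ, true_and, not_and]
        intro _ h
        have h1 := h k
        apply hk
        by_cases hkS : k ∈ S
        · have : k ∉ S' := fun h => hS2.1 h hkS
          simp [swL, swp, this] at h1
          simp [swL, swp, hkS, h1]
        · have : k ∈ S' := hS2.2 hkS
          simp [swL, swp, this] at h1
          simp [swL, swp, hkS, h1]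
    · intro u hu
      simp only [hA, Finset.mem_filter, Finset.mem_univ, true_and] at hu ⊢
      refine ⟨hu.1, ?_⟩
      have hl : ∀ l, l ≠ k → swL S u (Sum.inl l) = 0 := by
        intro l hl
        have := hu.2 l
        simpa [swL, swp, hS1 l hl] using this
      have hb := hW.1 u hu.1 w hw
      rw [← swL_bform S] at hb
      simp only [bform, h0, mul_zero, sub_zero] at hb
      rw [Finset.sum_eq_single k (fun l _ hlk => by rw [hl l hlk, zero_mul]) (by simp)] at hb
      intro l
      by_cases hlk : l = k
      · rw [hlk]; exact (mul_eq_zero.1 hb).resolve_right hk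
      · exact hl l hlk
  have := Finset.card_lt_card hsub
  have := hS S' (Finset.mem_univ _)
  omega

theorem lag_norm (W : Submodule K (Ix m → K)) (hW : Lag W) :
    ∃ (S : Finset (Fin m)) (B : Fin m → Fin m → K), (∀ i k, B i k = B k i) ∧
      ∀ v, v ∈ W ↔ ∀ i, ell B i (swp S v) = 0 := by
  obtain ⟨S, hS⟩ := lag_S W hW
  let X : W →ₗ[K] (Fin m → K) :=
    (LinearMap.funLeft K K (Sum.inl : Fin m → Ix m)).comp ((swL S).comp W.subtype)
  have hX : ∀ u : W, ∀ k, X u k = swL S (u : Ix m → K) (Sum.inl k) := fun u k => rfl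
  have hinj : Function.Injective X := by
    rw [← LinearMap.ker_eq_bot, LinearMap.ker_eq_bot']
    intro u hu
    apply Subtype.ext
    exact hS u u.2 fun k => by rw [← hX, hu]; rfl
  have hsurj : Function.Surjective X := by
    rw [← LinearMap.injective_iff_surjective_of_finrank_eq_finrank]
    · exact hinj
    · rw [hW.2]; simp
  choose w hw using fun k : Fin m => hsurj (Pi.single k 1)
  have hwl : ∀ k l, swL S (w k : Ix m → K) (Sum.inl l) = if l = k then 1 else 0 := by
    intro k l
    rw [← hX, hw, Pi.single_apply]
  have hcomb : ∀ x : Fin m → K, ∀ l, swL S ((∑ k, x k • w k : W) : Ix m → K) (Sum.inl l) = x l := by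
    intro x l
    rw [← hX, map_sum, Finset.sum_apply]
    simp [hw, Pi.single_apply]
  have hcombr : ∀ x : Fin m → K, ∀ l, swL S ((∑ k, x k • w k : W) : Ix m → K) (Sum.inr l) =
      ∑ k, x k * swL S (w k : Ix m → K) (Sum.inr l) := by
    intro x l
    simp
  have key : ∀ x : Fin m → K, ∀ i, ell (fun i k => - swL S (w k : Ix m → K) (Sum.inr i)) i
      (swL S ((∑ k, x k • w k : W) : Ix m → K)) = 0 := by
    intro x i
    simp only [ell]
    rw [hcombr]
    simp only [hcomb]
    rw [← Finset.sum_add_distrib]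
    exact Finset.sum_eq_zero fun k _ => by ring
  refine ⟨S, fun i k => - swL S (w k : Ix m → K) (Sum.inr i), ?_, ?_⟩
  · intro i k
    have hb := hW.1 _ (w i).2 _ (w k).2
    rw [← swL_bform S] at hb
    simp only [bform, hwl, Finset.sum_sub_distrib] at hb
    simp at hb
    linear_combination -hb
  · intro v
    constructor
    · intro hv
      have : (⟨v, hv⟩ : W) = ∑ k, X ⟨v, hv⟩ k • w k := by
        apply hinj
        funext l
        rw [hX, hX, hcomb]
        rfl
      have h2 := key (X ⟨v, hv⟩)
      rw [← this] at h2
      exact h2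
    · intro hv
      set u : W := ∑ k, (swL S v (Sum.inl k)) • w k with hu
      have h1 : (u : Ix m → K) = v := by
        apply swL_inj S
        have hl : ∀ l, swL S (u : Ix m → K) (Sum.inl l) = swL S v (Sum.inl l) := hcomb _
        funext i
        rcases i with l | l
        · exact hl l
        · have a1 := key (fun k => swL S v (Sum.inl k)) l
          have a2 := hv l
          change ell _ l (swL S (u : Ix m → K)) = 0 at a1
          change ell _ l (swL S v) = 0 at a2
          simp only [ell, hl] at a1 a2
          exact add_right_cancel (a1.trans a2.symm)
      rw [← h1]
      exact u.2

theorem CC_le_MM (hp : Odd p) (hp3 : 3 ≤ p) : CC K m ≤ MM K p t m := by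
  have hc : Fintype.card K = p ^ t := Fact.out
  have hpt : p ^ t - 1 ≠ 0 := by
    have := pj_lt (p := p) (t := t) hp3 0
    omega
  refine Submodule.span_le.2 ?_
  rintro _ ⟨W, hW, rfl⟩
  obtain ⟨S, B, hB, h⟩ := lag_norm W hW
  have h1 := MM_swp hp S _ (norm_mem (t := t) hp3 B hB)
  have : chi W = (fun v => (fun v => ∏ i, (1 - ell B i v ^ (p ^ t - 1))) (swp S v)) := by
    funext v
    simp only [chi]
    split_ifs with hv
    · rw [h] at hv
      simp [hv, hpt]
    · rw [h] at hv
      push Not at hv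
      obtain ⟨i, hi⟩ := hv
      rw [Finset.prod_eq_zero (Finset.mem_univ i)]
      rw [← hc, FiniteField.pow_card_sub_one_eq_one _ hi, sub_self]
  rw [this]
  exact h1

theorem CC_eq_MM (hp : Odd p) (hp3 : 3 ≤ p) (hm : 2 ≤ m) : CC K m = MM K p t m :=
  lowerC hp3 hm (CC_le_MM hp hp3)

end lagr
end PR

namespace PR
set_option linter.all false

section dim
variable {K : Type} [Field K] [Fintype K] {p t m : ℕ} [Fact p.Prime] [CharP K p]
  [NeZero t] [Fact (Fintype.card K = p ^ t)]

def flF {p m : ℕ} (c : Ix m → Fin p) : Ix m → Fin p := fun i => Fin.rev (c i.swap)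

theorem flF_flF (c : Ix m → Fin p) : flF (flF c) = c := by
  funext i
  simp [flF]

def Rep {p m : ℕ} (c : Ix m → Fin p) : Prop :=
  (Fintype.equivFin (Ix m → Fin p) c) ≤ (Fintype.equivFin (Ix m → Fin p) (flF c))

theorem Rep_or (c : Ix m → Fin p) : Rep c ∨ Rep (flF c) := by
  rw [Rep, Rep, flF_flF]
  exact le_total _ _

theorem Rep_and (c : Ix m → Fin p) (h : Rep c) (h' : Rep (flF c)) : flF c = c := by
  rw [Rep] at h
  rw [Rep, flF_flF] at h'
  exact (Fintype.equivFin _).injective (le_antisymm h' h)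

def flR (T : Finset (Fin t)) (a : RI p t m) : RI p t m :=
  fun z => if z.1 ∈ T then Fin.rev (a (z.1, z.2.swap)) else a z

theorem toE_flR (T : Finset (Fin t)) (a : RI p t m) : toE (flR T a) = flip p T (toE a) := by
  funext z
  simp only [toE, flR, flip]
  split_ifs
  · rw [Fin.val_rev]; omega
  · rfl

def lvl (a : RI p t m) (j : Fin t) : Ix m → Fin p := fun i => a (j, i)

theorem lvl_flR (T : Finset (Fin t)) (a : RI p t m) (j : Fin t) :
    lvl (flR T a) j = if j ∈ T then flF (lvl a j) else lvl a j := by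
  funext i
  by_cases h : j ∈ T <;> simp [lvl, flR, flF, h]

theorem lvl_ext (a b : RI p t m) (h : ∀ j, lvl a j = lvl b j) : a = b := by
  funext z
  exact congrFun (h z.1) z.2

/-- index set of the basis -/
def BI (p t m : ℕ) [NeZero t] : Type :=
  {x : (Fin t → ℕ) × RI p t m // Sm m x.1 ∧ HT p (toE x.2) x.1 ∧ ∀ j ∈ Jset m x.1, Rep (lvl x.2 j)}

theorem BI_ext (x y : BI p t m) (h : x.1.2 = y.1.2) : x = y := by
  apply Subtype.ext
  apply Prod.ext _ h
  have h1 := x.2.2.1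
  rw [h] at h1
  exact HT_unique _ _ _ h1 y.2.2.1

instance : Finite (BI p t m) :=
  Finite.of_injective (fun x : BI p t m => x.1.2) (fun x y h => BI_ext x y h)

instance : Fintype (BI p t m) := Fintype.ofFinite _

def BY (K : Type) [Field K] {p t m : ℕ} [NeZero t] (x : BI p t m) : (Ix m → K) → K :=
  YJ K p (Jset m x.1.1) (toE x.1.2)

theorem coord_YJ (J : Finset (Fin t)) (a b : RI p t m) :
    (mb K p t m).coord b (YJ K p J (toE a)) =
      ∑ T ∈ J.powerset, if flR T a = b then (fct K (toE b))⁻¹ else 0 := by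
  rw [YJ, map_sum]
  refine Finset.sum_congr rfl fun T _ => ?_
  rw [wf, map_smul, ← toE_flR, ← mb_apply, Module.Basis.coord_apply, Module.Basis.repr_self,
    Finsupp.single_apply, smul_eq_mul]
  split_ifs with h
  · rw [h, mul_one]
  · rw [mul_zero]

theorem coord_off (x y : BI p t m) (h : x ≠ y) : (mb K p t m).coord y.1.2 (BY K x) = 0 := by
  rw [BY, coord_YJ]
  refine Finset.sum_eq_zero fun T hT => if_neg fun he => h ?_
  rw [Finset.mem_powerset] at hT
  apply BI_ext
  have hs : x.1.1 = y.1.1 := by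
    have h1 := flip_HT x.1.1 T hT _ (toE_rd x.1.2) x.2.2.1
    rw [← toE_flR, he] at h1
    exact HT_unique _ _ _ h1 y.2.2.1
  apply lvl_ext
  intro j
  have hj := lvl_flR T x.1.2 j
  rw [he] at hj
  by_cases hjT : j ∈ T
  · rw [if_pos hjT] at hj
    have h1 := x.2.2.2 j (hT hjT)
    have h2 := y.2.2.2 j (hs ▸ hT hjT)
    rw [hj] at h2 ⊢
    exact (Rep_and _ h1 h2).symm
  · rw [if_neg hjT] at hj
    exact hj.symm

theorem coord_diag (hp3 : 3 ≤ p) (x : BI p t m) : (mb K p t m).coord x.1.2 (BY K x) ≠ 0 := by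
  rw [BY, coord_YJ, ← Finset.sum_filter, Finset.sum_const, nsmul_eq_mul]
  refine mul_ne_zero ?_ (inv_ne_zero (fct_ne (p := p) _ (toE_rd _)))
  have : (Jset m x.1.1).powerset.filter (fun T => flR T x.1.2 = x.1.2) =
      ((Jset m x.1.1).filter (fun j => flF (lvl x.1.2 j) = lvl x.1.2 j)).powerset := by
    ext T
    rw [Finset.mem_filter, Finset.mem_powerset, Finset.mem_powerset]
    constructor
    · rintro ⟨h1, h2⟩ j hj
      rw [Finset.mem_filter]
      refine ⟨h1 hj, ?_⟩
      have := lvl_flR T x.1.2 j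
      rw [h2, if_pos hj] at this
      exact this.symm
    · intro h
      refine ⟨fun j hj => (Finset.mem_filter.1 (h hj)).1, ?_⟩
      apply lvl_ext
      intro j
      rw [lvl_flR]
      split_ifs with hj
      · exact (Finset.mem_filter.1 (h hj)).2
      · rfl
  rw [this, Finset.card_powerset, Nat.cast_pow]
  exact pow_ne_zero _ (nat_ne (p := p) 2 (by omega) (by omega))

theorem BY_li (hp3 : 3 ≤ p) : LinearIndependent K (BY K : BI p t m → _) := by
  rw [Fintype.linearIndependent_iff]
  intro g hg y
  have h1 := congrArg ((mb K p t m).coord y.1.2) hg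
  rw [map_sum, map_zero, Finset.sum_eq_single y] at h1
  · rw [map_smul, smul_eq_mul] at h1
    exact (mul_eq_zero.1 h1).resolve_right (coord_diag hp3 y)
  · intro x _ hx
    rw [map_smul, coord_off x y hx, smul_zero]
  · simp

theorem BY_span : Submodule.span K (Set.range (BY K : BI p t m → _)) = MM K p t m := by
  refine Submodule.span_eq_span ?_ ?_
  · rintro _ ⟨x, rfl⟩
    exact Submodule.subset_span ⟨x.1.1, toE x.1.2, x.2.1, toE_rd _, x.2.2.1, trivial, rfl⟩
  · rintro _ ⟨s, a, h1, h2, h3, -, rfl⟩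
    obtain ⟨b, rfl⟩ : ∃ b : RI p t m, a = toE b := ⟨ofE a h2, rfl⟩
    set T := (Jset m s).filter (fun j => ¬ Rep (lvl b j)) with hT
    have hTs : T ⊆ Jset m s := Finset.filter_subset _ _
    refine Submodule.subset_span ⟨⟨(s, flR T b), h1, ?_, ?_⟩, ?_⟩
    · rw [toE_flR]
      exact flip_HT s T hTs _ h2 h3
    · intro j hj
      simp only at hj ⊢
      rw [lvl_flR]
      split_ifs with hjT
      · rw [hT, Finset.mem_filter] at hjT
        exact (Rep_or _).resolve_left hjT.2
      · by_contra hh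
        exact hjT (Finset.mem_filter.2 ⟨hj, hh⟩)
    · simp only [BY]
      rw [toE_flR, YJ_flip _ _ hTs _ h2]

theorem finrank_MM (hp3 : 3 ≤ p) : Module.finrank K (MM K p t m) = Fintype.card (BI p t m) := by
  rw [← BY_span, finrank_span_eq_card (BY_li hp3)]

end dim

section walk
theorem walk_trace {ι : Type} [Fintype ι] [DecidableEq ι] (M : Matrix ι ι ℚ) (n : ℕ) :
    ∀ N : Matrix ι ι ℚ, ∑ σ : Fin (n + 1) → ι, (∏ j : Fin n, M (σ j.castSucc) (σ j.succ)) *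
      N (σ (Fin.last n)) (σ 0) = Matrix.trace (M ^ n * N) := by
  induction n with
  | zero =>
    intro N
    rw [← Equiv.sum_comp (Equiv.funUnique (Fin 1) ι).symm]
    simp [Matrix.trace]
  | succ n ih =>
    intro N
    rw [← Equiv.sum_comp (Fin.snocEquiv (fun _ : Fin (n + 2) => ι)), Fintype.sum_prod_type, Finset.sum_comm]
    rw [pow_succ, Matrix.mul_assoc, ← ih (M * N)]
    refine Finset.sum_congr rfl fun τ _ => ?_
    rw [Matrix.mul_apply, Finset.mul_sum]
    refine Finset.sum_congr rfl fun x _ => ?_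
    rw [Fin.prod_univ_castSucc]
    have e0 : (Fin.snocEquiv (fun _ : Fin (n + 2) => ι)) (x, τ) 0 = τ 0 := by
      have := Fin.snoc_castSucc (α := fun _ : Fin (n + 2) => ι) x τ 0
      simpa [Fin.snocEquiv] using this
    have e1 : ∀ j : Fin (n + 1), (Fin.snocEquiv (fun _ : Fin (n + 2) => ι)) (x, τ) j.castSucc = τ j := by
      intro j
      simp [Fin.snocEquiv]
    have e2 : (Fin.snocEquiv (fun _ : Fin (n + 2) => ι)) (x, τ) (Fin.last (n + 1)) = x := by
      simp [Fin.snocEquiv]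
    rw [e0, e2, e1, Fin.succ_last, e2]
    simp only [e1, Fin.succ_castSucc]
    ring

theorem trace_pow_walk {ι : Type} [Fintype ι] [DecidableEq ι] (M : Matrix ι ι ℚ) (t : ℕ) [NeZero t] :
    Matrix.trace (M ^ t) = ∑ σ : Fin t → ι, ∏ j : Fin t, M (σ j) (σ (j + 1)) := by
  obtain ⟨n, rfl⟩ : ∃ n, t = n + 1 := ⟨t - 1, by have := NeZero.ne t; omega⟩
  rw [pow_succ, ← walk_trace]
  refine Finset.sum_congr rfl fun σ _ => ?_
  rw [Fin.prod_univ_castSucc]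
  simp

end walk
end PR

namespace PR
set_option linter.all false

section count
variable {p t m : ℕ} [Fact p.Prime] [NeZero t]

def InR (p : ℕ) {m : ℕ} (α β : ℕ) (c : Ix m → Fin p) : Prop :=
  (∑ i, (c i : ℕ)) + α = p * β ∧ (α = m ∧ β = m → Rep c)

theorem card_dlam (p m : ℕ) (L : ℤ) :
    Fintype.card {c : Ix m → Fin p // ∑ i, ((c i : ℕ) : ℤ) = L} = dlam p m L := by
  rw [dlam, ← Fintype.card_subtype]
  have e : Fin (2 * m) ≃ Ix m := Fintype.equivOfCardEq (by simp; ring)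
  refine Fintype.card_congr (Equiv.subtypeEquiv (e.arrowCongr (Equiv.refl (Fin p))).symm ?_)
  intro c
  have : ∑ i, ((((e.arrowCongr (Equiv.refl (Fin p))).symm c) i : ℕ) : ℤ) = ∑ i, ((c i : ℕ) : ℤ) := by
    rw [← Equiv.sum_comp e]
    rfl
  rw [this]

theorem flF_sum (c : Ix m → Fin p) (h : ∑ i, (c i : ℕ) = m * (p - 1)) :
    ∑ i, (flF c i : ℕ) = m * (p - 1) := by
  have h1 : ∑ i, (flF c i : ℕ) + ∑ i, (c i : ℕ) = 2 * m * (p - 1) := by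
    rw [← sum_swap (fun i => (c i : ℕ)), ← Finset.sum_add_distrib]
    rw [Finset.sum_congr rfl (g := fun _ => p - 1)]
    · simp only [Finset.sum_const, Finset.card_univ, Fintype.card_sum, Fintype.card_fin, smul_eq_mul]; ring
    · intro i _
      rw [flF, Fin.val_rev]
      have := (c i.swap).2
      omega
  rw [h] at h1
  nlinarith

theorem fix_sum (c : Ix m → Fin p) (h : flF c = c) : ∑ i, (c i : ℕ) = m * (p - 1) := by
  rw [Fintype.sum_sum_type, ← Finset.sum_add_distrib, Finset.sum_congr rfl (g := fun _ => p - 1)]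
  · simp
  · intro k _
    have := congrArg Fin.val (congrFun h (Sum.inl k))
    rw [flF, Fin.val_rev] at this
    simp only [Sum.swap_inl] at this
    have := (c (Sum.inr k)).2
    omega

theorem card_fix : (Finset.univ.filter (fun c : Ix m → Fin p => flF c = c)).card = p ^ m := by
  rw [← Fintype.card_subtype]
  have e : {c : Ix m → Fin p // flF c = c} ≃ (Fin m → Fin p) :=
    { toFun := fun c k => c.1 (Sum.inl k)
      invFun := fun d => ⟨Sum.elim d (fun k => Fin.rev (d k)), by
        funext i
        rcases i with k | k <;> simp [flF]⟩
      left_inv := by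
        intro c
        apply Subtype.ext
        funext i
        rcases i with k | k
        · rfl
        · have := congrFun c.2 (Sum.inr k)
          simpa [flF] using this
      right_inv := fun d => rfl }
  rw [Fintype.card_congr e]
  simp

theorem card_rep : 2 * (Finset.univ.filter (fun c : Ix m → Fin p => ∑ i, (c i : ℕ) = m * (p - 1) ∧ Rep c)).card =
    (Finset.univ.filter (fun c : Ix m → Fin p => ∑ i, (c i : ℕ) = m * (p - 1))).card + p ^ m := by
  set S := Finset.univ.filter (fun c : Ix m → Fin p => ∑ i, (c i : ℕ) = m * (p - 1))
  set A := Finset.univ.filter (fun c : Ix m → Fin p => ∑ i, (c i : ℕ) = m * (p - 1) ∧ Rep c)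
  set A' := Finset.univ.filter (fun c : Ix m → Fin p => ∑ i, (c i : ℕ) = m * (p - 1) ∧ Rep (flF c))
  have h1 : A.card = A'.card := by
    refine Finset.card_nbij' flF flF ?_ ?_ ?_ ?_
    · intro c hc
      simp only [A, A', Finset.coe_filter, Finset.mem_filter, Finset.mem_univ, true_and, Set.mem_setOf_eq] at hc ⊢
      rw [flF_flF]
      exact ⟨flF_sum c hc.1, hc.2⟩
    · intro c hc
      simp only [A, A', Finset.coe_filter, Finset.mem_filter, Finset.mem_univ, true_and, Set.mem_setOf_eq] at hc ⊢
      exact ⟨flF_sum c hc.1, hc.2⟩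
    · intro c _; exact flF_flF c
    · intro c _; exact flF_flF c
  have h2 : A ∪ A' = S := by
    ext c
    simp only [A, A', S, Finset.mem_union, Finset.mem_filter, Finset.mem_univ, true_and]
    have := Rep_or c
    tauto
  have h3 : A ∩ A' = Finset.univ.filter (fun c : Ix m → Fin p => flF c = c) := by
    ext c
    simp only [A, A', Finset.mem_inter, Finset.mem_filter, Finset.mem_univ, true_and]
    constructor
    · rintro ⟨h, h'⟩
      exact Rep_and c h.2 h'.2
    · intro h
      have h4 := fix_sum c h
      have : Rep c := by
        rcases Rep_or c with h5 | h5
        · exact h5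
        · rwa [h] at h5
      rw [h]
      exact ⟨⟨h4, this⟩, h4, this⟩
  have h4 := Finset.card_union_add_card_inter A A'
  rw [h2, h3, card_fix] at h4
  omega

theorem card_InR (a b : ℕ) : (Fintype.card {c : Ix m → Fin p // InR p a b c} : ℚ) = dpair p m a b := by
  have hp : 2 ≤ p := (Fact.out : p.Prime).two_le
  rw [dpair]
  split_ifs with h
  · obtain ⟨rfl, rfl⟩ := h
    have h1 := card_rep (p := p) (m := b)
    have h2 := card_dlam p b ((b : ℤ) * ((p : ℤ) - 1))
    have h5 : ∀ c : Ix b → Fin p, ∑ i, ((c i : ℕ) : ℤ) = (b : ℤ) * ((p : ℤ) - 1) ↔ ∑ i, (c i : ℕ) = b * (p - 1) := by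
      intro c
      have : ((b * (p - 1) : ℕ) : ℤ) = (b : ℤ) * ((p : ℤ) - 1) := by
        push_cast [Nat.cast_sub (show 1 ≤ p by omega)]
        ring
      rw [← this, ← Nat.cast_sum, Nat.cast_inj]
    have h6 : ∀ c : Ix b → Fin p, InR p b b c ↔ ∑ i, (c i : ℕ) = b * (p - 1) ∧ Rep c := by
      intro c
      have : b * (p - 1) + b = p * b := by
        obtain ⟨p', rfl⟩ : ∃ p', p = p' + 1 := ⟨p - 1, by omega⟩
        simp; ring
      simp only [InR, and_self, true_implies]
      constructor
      · rintro ⟨h, h'⟩; exact ⟨by omega, h'⟩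
      · rintro ⟨h, h'⟩; exact ⟨by omega, h'⟩
    rw [← h2, Fintype.card_subtype, Fintype.card_subtype]
    simp only [h5, h6]
    have h7 := congrArg (Nat.cast : ℕ → ℚ) h1
    push_cast at h7
    linarith
  · rw [← card_dlam]
    congr 1
    refine Fintype.card_congr (Equiv.subtypeEquiv (Equiv.refl _) ?_)
    intro c
    simp only [InR, Equiv.refl_apply]
    rw [← Nat.cast_sum]
    constructor
    · rintro ⟨h1, -⟩
      have := congrArg (Nat.cast : ℕ → ℤ) h1
      push_cast at this ⊢
      linarith
    · intro h1
      refine ⟨?_, fun hh => absurd hh h⟩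
      zify
      push_cast at h1 ⊢
      linarith

def BF (hm : 1 ≤ m) : Unit ⊕ (Σ σ : Fin t → Fin m, ∀ j : Fin t,
    {c : Ix m → Fin p // InR p ((σ j : ℕ) + 1) ((σ (j + 1) : ℕ) + 1) c}) → BI p t m
  | Sum.inl _ => ⟨(0, fun _ => ⟨0, (Fact.out : p.Prime).pos⟩), Or.inr rfl, by
      intro j; simp [toE], by
      intro j hj
      rw [mem_Jset] at hj
      have := hj.1
      simp only [Pi.zero_apply] at this
      omega⟩
  | Sum.inr ⟨σ, c⟩ => ⟨(fun j => (σ j : ℕ) + 1, fun z => (c z.1).1 z.2),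
      Or.inl (fun j => ⟨by simp, by have := (σ j).2; simp only; omega⟩),
      fun j => (c j).2.1, fun j hj => (c j).2.2 ((mem_Jset _ _).1 hj)⟩

theorem BF_bij (hm : 1 ≤ m) : Function.Bijective (BF (p := p) (t := t) hm) := by
  constructor
  · rintro (u | ⟨σ, c⟩) (u' | ⟨σ', c'⟩) h
    · rfl
    · have := congrFun (congrArg (fun x : BI p t m => x.1.1) h) 0
      simp [BF] at this
    · have := congrFun (congrArg (fun x : BI p t m => x.1.1) h) 0
      simp [BF] at this
    · have h1 := congrArg (fun x : BI p t m => x.1.1) h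
      have h2 := congrArg (fun x : BI p t m => x.1.2) h
      simp only [BF] at h1 h2
      have hs : σ = σ' := by
        funext j
        have := congrFun h1 j
        apply Fin.ext
        omega
      subst hs
      have hc : c = c' := by
        funext j
        apply Subtype.ext
        funext i
        exact congrFun h2 (j, i)
      rw [hc]
  · rintro ⟨⟨s, a⟩, h1, h2, h3⟩
    simp only at h1 h2 h3
    rcases h1 with h1 | h1
    · refine ⟨Sum.inr ⟨fun j => ⟨s j - 1, by have := h1 j; omega⟩, fun j => ⟨lvl a j, ?_⟩⟩, ?_⟩
      · have e1 : s j - 1 + 1 = s j := by have := h1 j; omega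
        have e2 : s (j + 1) - 1 + 1 = s (j + 1) := by have := h1 (j + 1); omega
        simp only [e1, e2]
        exact ⟨h2 j, fun h => h3 j ((mem_Jset _ _).2 h)⟩
      · apply BI_ext
        rfl
    · subst h1
      refine ⟨Sum.inl (), ?_⟩
      apply BI_ext
      funext z
      have := h2 z.1
      simp only [Pi.zero_apply, add_zero, mul_zero] at this
      have := (Finset.sum_eq_zero_iff.1 this) z.2 (Finset.mem_univ _)
      simp only [toE] at this
      apply Fin.ext
      exact this.symm

theorem card_BI (hm : 1 ≤ m) : (Fintype.card (BI p t m) : ℚ) = 1 + Matrix.trace (Dmat p m ^ t) := by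
  rw [← Fintype.card_congr (Equiv.ofBijective _ (BF_bij (p := p) (t := t) hm)), Fintype.card_sum, Fintype.card_sigma,
    trace_pow_walk]
  push_cast
  rw [Fintype.card_unit, Nat.cast_one]
  congr 1
  refine Finset.sum_congr rfl fun σ _ => ?_
  rw [Fintype.card_pi]
  push_cast
  refine Finset.prod_congr rfl fun j _ => ?_
  rw [Dmat, ← card_InR]

end count
end PR

namespace PR
set_option linter.all false

section rk

theorem li_map {F E : Type} [Field F] [Field E] (f : F →+* E) {R C : Type} [Fintype R] [Fintype C]
    (A : Matrix R C F) (h : LinearIndependent F A.row) : LinearIndependent E (A.map f).row := by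
  have h1 : Function.Surjective A.mulVec := by
    have h2 := h.rank_matrix
    rw [Matrix.rank] at h2
    have h3 : LinearMap.range A.mulVecLin = ⊤ := by
      apply Submodule.eq_top_of_finrank_eq
      rw [h2]; simp
    exact LinearMap.range_eq_top.1 h3
  obtain ⟨B, hB⟩ := Matrix.mulVec_surjective_iff_exists_right_inverse.1 h1
  rw [← Matrix.vecMul_injective_iff]
  have h4 : A.map f * B.map f = 1 := by
    rw [← Matrix.map_mul, hB]; simp
  intro u v huv
  have := congrArg (fun w => Matrix.vecMul w (B.map f)) huv
  simpa [Matrix.vecMul_vecMul, h4] using this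

theorem rank_map_field {F E : Type} [Field F] [Field E] (f : F →+* E) {R C : Type} [Fintype R] [Fintype C]
    (A : Matrix R C F) : (A.map f).rank = A.rank := by
  obtain ⟨κ, a, ha, hs, hl⟩ := exists_linearIndependent' F A.row
  haveI : Fintype κ := Fintype.ofInjective a ha
  have hl2 : LinearIndependent E ((A.map f).row ∘ a) := li_map f (A.submatrix a id) hl
  rw [Matrix.rank_eq_finrank_span_row, Matrix.rank_eq_finrank_span_row, ← hs, finrank_span_eq_card hl]
  have : Submodule.span E (Set.range (A.map f).row) = Submodule.span E (Set.range ((A.map f).row ∘ a)) := by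
    apply le_antisymm
    · rw [Submodule.span_le]
      rintro _ ⟨i, rfl⟩
      have h1 : A.row i ∈ Submodule.span F (Set.range (A.row ∘ a)) := by
        rw [hs]; exact Submodule.subset_span ⟨i, rfl⟩
      obtain ⟨c, hc⟩ := (Submodule.mem_span_range_iff_exists_fun F).1 h1
      refine (Submodule.mem_span_range_iff_exists_fun E).2 ⟨fun k => f (c k), ?_⟩
      funext j
      have := congrArg f (congrFun hc j)
      rw [Finset.sum_apply, map_sum] at this
      rw [Finset.sum_apply]
      rw [show (A.map f).row i j = f (A.row i j) from rfl, ← this]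
      refine Finset.sum_congr rfl fun k _ => ?_
      exact (map_mul f _ _).symm
    · exact Submodule.span_mono (Set.range_comp_subset_range _ _)
  rw [this, finrank_span_eq_card hl2]

end rk

section pts
variable {K : Type} [Field K] [Fintype K] {p t m : ℕ} [Fact p.Prime] [CharP K p]
  [NeZero t] [Fact (Fintype.card K = p ^ t)]

theorem CC_smul (f : (Ix m → K) → K) (hf : f ∈ CC K m) (c : K) (hc : c ≠ 0) (v : Ix m → K) :
    f (c • v) = f v := by
  induction hf using Submodule.span_induction with
  | mem f h =>
    obtain ⟨W, -, rfl⟩ := h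
    simp only [chi, W.smul_mem_iff hc]
  | zero => rfl
  | add f g _ _ h1 h2 => simp [h1, h2]
  | smul a f _ h => simp [h]

include p t in
theorem CC_sum (hm : 1 ≤ m) (f : (Ix m → K) → K) (hf : f ∈ CC K m) : ∑ v, f v = 0 := by
  induction hf using Submodule.span_induction with
  | mem f h =>
    obtain ⟨W, hW, rfl⟩ := h
    simp only [chi, Finset.sum_boole]
    rw [← Fintype.card_subtype]
    have h1 : Fintype.card {x // x ∈ W} = (p ^ t) ^ m := by
      rw [← (Fact.out : Fintype.card K = p ^ t), Module.card_eq_pow_finrank (K := K) (V := W), hW.2]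
    rw [h1]
    push_cast
    rw [CharP.cast_eq_zero, zero_pow (NeZero.ne t), zero_pow (by omega)]
  | zero => simp
  | add f g _ _ h1 h2 => simp [Finset.sum_add_distrib, h1, h2]
  | smul a f _ h => simp [← Finset.mul_sum, h]

include p t in
theorem CC_inj (hm : 1 ≤ m) (f : (Ix m → K) → K) (hf : f ∈ CC K m) (h : ∀ v, v ≠ 0 → f v = 0) : f = 0 := by
  have h1 := CC_sum (p := p) (t := t) hm f hf
  rw [Finset.sum_eq_single 0 (fun v _ hv => h v hv) (by simp)] at h1
  funext v
  by_cases hv : v = 0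
  · rw [hv, h1]; rfl
  · exact h v hv

include p t in
/-- generic rank statement: points given by representatives `r`, flats given by `w`. -/
theorem finrank_rows (hm : 1 ≤ m) {R C : Type} [Fintype R] [Fintype C]
    (w : R → Submodule K (Ix m → K)) (hw : ∀ W, Lag W ↔ ∃ i, w i = W)
    (r : C → (Ix m → K)) (hr : ∀ v : Ix m → K, v ≠ 0 → ∃ c : K, c ≠ 0 ∧ ∃ j, v = c • r j)
    (A : Matrix R C K) (hA : ∀ i j, A i j = if r j ∈ w i then 1 else 0) :
    A.rank = Module.finrank K (CC K m) := by
  rw [Matrix.rank_eq_finrank_span_row]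
  set L : ((Ix m → K) → K) →ₗ[K] (C → K) := LinearMap.funLeft K K r with hL
  have h1 : Submodule.span K (Set.range A.row) = (CC K m).map L := by
    rw [CC, Submodule.map_span]
    congr 1
    ext g
    simp only [Set.mem_range, Set.mem_image, Set.mem_setOf_eq]
    have key : ∀ i, L (chi (w i)) = A.row i := by
      intro i
      funext j
      simp only [L, LinearMap.funLeft_apply, chi, Matrix.row, hA]
    constructor
    · rintro ⟨i, rfl⟩
      exact ⟨_, ⟨w i, (hw _).2 ⟨i, rfl⟩, rfl⟩, key i⟩
    · rintro ⟨_, ⟨W, hW, rfl⟩, rfl⟩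
      obtain ⟨i, rfl⟩ := (hw W).1 hW
      exact ⟨i, (key i).symm⟩
  rw [h1]
  have h2 : Function.Injective (L.domRestrict (CC K m)) := by
    rw [← LinearMap.ker_eq_bot, LinearMap.ker_eq_bot']
    rintro ⟨f, hf⟩ h
    apply Subtype.ext
    refine CC_inj (p := p) (t := t) hm f hf fun v hv => ?_
    obtain ⟨c, hc, j, rfl⟩ := hr v hv
    rw [CC_smul f hf c hc]
    exact congrFun h j
  rw [← LinearMap.range_domRestrict, LinearMap.finrank_range_of_inj h2]

end pts

section final

def eS (p t m : ℕ) [Fact p.Prime] : SympV p t m ≃ₗ[GaloisField p t] (Ix m → GaloisField p t) :=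
  (LinearEquiv.sumArrowLequivProdArrow (Fin m) (Fin m) (GaloisField p t) (GaloisField p t)).symm

theorem eS_form (p t m : ℕ) [Fact p.Prime] (u v : SympV p t m) :
    bform (eS p t m u) (eS p t m v) = sform u v := by
  rfl

theorem rank_eq (p t m : ℕ) [Fact p.Prime] (ht : 1 ≤ t) (hm : 1 ≤ m) :
    (incMat p t m m).rank = Module.finrank (GaloisField p t) (CC (GaloisField p t) m) := by
  haveI : Fintype (GaloisField p t) := Fintype.ofFinite _
  haveI : NeZero t := ⟨by omega⟩
  haveI : Fact (Fintype.card (GaloisField p t) = p ^ t) := ⟨by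
    rw [← Nat.card_eq_fintype_card, GaloisField.card p t (by omega)]⟩
  rw [← rank_map_field (algebraMap (ZMod p) (GaloisField p t))]
  have hZ : ∀ Z : Pts p t m, ∃ v : SympV p t m, v ≠ 0 ∧ Z.1 = Submodule.span (GaloisField p t) {v} := by
    intro Z
    obtain ⟨v, hv, h⟩ := finrank_eq_one_iff'.1 Z.2
    refine ⟨v, fun h0 => hv (Subtype.ext h0), ?_⟩
    apply le_antisymm
    · intro w hw
      obtain ⟨c, hc⟩ := h ⟨w, hw⟩
      exact Submodule.mem_span_singleton.2 ⟨c, congrArg Subtype.val hc⟩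
    · rw [Submodule.span_singleton_le_iff_mem]; exact v.2
  choose r hr0 hr using hZ
  refine finrank_rows (p := p) (t := t) hm
    (fun W : IsoFlats p t m m => W.1.map (eS p t m : SympV p t m →ₗ[GaloisField p t] (Ix m → GaloisField p t))) ?_
    (fun Z => eS p t m (r Z)) ?_ _ ?_
  · intro W
    constructor
    · intro hW
      refine ⟨⟨W.map ((eS p t m).symm : (Ix m → GaloisField p t) →ₗ[GaloisField p t] SympV p t m), ?_, ?_⟩, ?_⟩
      · rintro _ ⟨u, hu, rfl⟩ _ ⟨v, hv, rfl⟩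
        rw [← eS_form]
        simpa using hW.1 u hu v hv
      · rw [LinearEquiv.finrank_map_eq]; exact hW.2
      · simp only
        rw [← Submodule.map_comp]
        simp
    · rintro ⟨⟨W, h1, h2⟩, rfl⟩
      refine ⟨?_, ?_⟩
      · rintro _ ⟨u, hu, rfl⟩ _ ⟨v, hv, rfl⟩
        exact (eS_form p t m u v).trans (h1 u hu v hv)
      · simp only
        rw [LinearEquiv.finrank_map_eq]; exact h2
  · intro v hv
    have hv' : (eS p t m).symm v ≠ 0 := by simpa using hv
    set Z : Pts p t m := ⟨Submodule.span (GaloisField p t) {(eS p t m).symm v}, finrank_span_singleton hv'⟩ with hZd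
    have h1 : (eS p t m).symm v ∈ Submodule.span (GaloisField p t) {r Z} := by
      rw [← hr Z]
      exact Submodule.mem_span_singleton_self _
    obtain ⟨c, hc⟩ := Submodule.mem_span_singleton.1 h1
    refine ⟨c, ?_, Z, ?_⟩
    · rintro rfl
      exact hv' (by rw [← hc]; simp)
    · rw [← map_smul, hc]; simp
  · intro W Z
    have h1 : eS p t m (r Z) ∈ W.1.map (eS p t m : SympV p t m →ₗ[GaloisField p t] (Ix m → GaloisField p t)) ↔ Z.1 ≤ W.1 := by
      rw [hr Z, Submodule.span_singleton_le_iff_mem]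
      constructor
      · rintro ⟨w, hw, h⟩
        rw [(eS p t m).injective h] at hw
        exact hw
      · intro h; exact ⟨_, h, rfl⟩
    simp only [Matrix.map_apply, incMat, h1]
    split_ifs <;> simp

end final
end PR

/-- Corollary: for `p` odd, the `p`-rank of the incidence matrix between points and
`m`-flats of `W(2m−1,p^t)` equals `1 + trace(D^t)`. -/
theorem prank_trace (p t m : ℕ) [Fact p.Prime]
    (hodd : Odd p) (ht : 1 ≤ t) (hm : 2 ≤ m) :
    ((incMat p t m m).rank : ℚ) = 1 + Matrix.trace (Dmat p m ^ t) := by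
  haveI : Fintype (GaloisField p t) := Fintype.ofFinite _
  haveI : NeZero t := ⟨by omega⟩
  haveI : Fact (Fintype.card (GaloisField p t) = p ^ t) := ⟨by
    rw [← Nat.card_eq_fintype_card, GaloisField.card p t (by omega)]⟩
  have hp3 : 3 ≤ p := by
    have := (Fact.out : p.Prime).two_le
    obtain ⟨k, rfl⟩ := hodd
    omega
  rw [PR.rank_eq p t m ht (by omega), PR.CC_eq_MM (p := p) (t := t) hodd hp3 hm, PR.finrank_MM hp3,
    PR.card_BI (by omega)]

end
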